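/- arXiv:2307.00256 — 6 statements merged into one kernel-verified Lean document; each statement's English description precedes it below -/
import Mathlib

section
/- Let p and N be two distinct prime numbers. Then Σ_{χ ∈ D₊(N)} χ(p)/τ(χ) = ((N−1)/N) · cos(2πp/N) + 1/N. -/
open Finset

/-- The Gauss sum `τ(χ) = Σ_{b=1}^{N} χ(b) e^{2πib/N}`. -/
noncomputable def gaussSum' {N : ℕ} (χ : DirichletCharacter ℂ N) : ℂ :=
  ∑ b ∈ Finset.Icc 1 N,
    χ ((b : ℕ) : ZMod N) * Complex.exp (2 * Real.pi * Complex.I * (b : ℂ) / (N : ℂ))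

theorem ZMod.sum_Icc_one_natCast {M : Type*} [AddCommMonoid M] (N : ℕ) [NeZero N]
    (f : ZMod N → M) : ∑ b ∈ Finset.Icc 1 N, f (b : ZMod N) = ∑ x, f x := by
  refine Finset.sum_nbij (fun b : ℕ => (b : ZMod N)) (by simp) ?_ ?_ (by simp)
  · intro a ha b hb hab
    simp only [Finset.coe_Icc, Set.mem_Icc] at ha hb
    have h := (Nat.modEq_iff_dvd).1 ((ZMod.natCast_eq_natCast_iff a b N).1 hab)
    have := Int.eq_zero_of_abs_lt_dvd h (by rw [abs_lt]; omega)
    omega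
  · intro x _
    by_cases hx : x = 0
    · exact ⟨N, by simp [NeZero.one_le], by simp [hx]⟩
    · have := ZMod.val_lt x
      have h0 : x.val ≠ 0 := by simpa using hx
      exact ⟨x.val, by simp only [Finset.coe_Icc, Set.mem_Icc]; omega, by simp⟩

theorem ZMod.stdAddChar_natCast {N : ℕ} [NeZero N] (b : ℕ) :
    ZMod.stdAddChar (b : ZMod N) = Complex.exp (2 * Real.pi * Complex.I * b / N) := by
  simpa using ZMod.stdAddChar_coe (N := N) (b : ℤ)

theorem gaussSum'_eq_gaussSum {N : ℕ} [NeZero N] (χ : DirichletCharacter ℂ N) :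
    gaussSum' χ = gaussSum χ ZMod.stdAddChar := by
  rw [gaussSum, ← ZMod.sum_Icc_one_natCast, gaussSum']
  simp only [ZMod.stdAddChar_natCast]

theorem DirichletCharacter.isPrimitive_iff_ne_one_of_prime {R : Type*} [CommMonoidWithZero R]
    {N : ℕ} (hN : N.Prime) (χ : DirichletCharacter R N) : χ.IsPrimitive ↔ χ ≠ 1 := by
  have : NeZero N := ⟨hN.ne_zero⟩
  rw [DirichletCharacter.isPrimitive_def, Ne, DirichletCharacter.eq_one_iff_conductor_eq_one]
  have := (Nat.dvd_prime hN).1 χ.conductor_dvd_level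
  have := hN.one_lt
  omega

/-- Summing `χ(a) τ(χ⁻¹, ψ)` over all characters isolates the value of `ψ` at `a`. -/
theorem DirichletCharacter.sum_apply_mul_gaussSum_inv {N : ℕ} [Fact N.Prime]
    (ψ : AddChar (ZMod N) ℂ) {a : ZMod N} (ha : a ≠ 0) :
    ∑ χ : DirichletCharacter ℂ N, χ a * gaussSum χ⁻¹ ψ = (N - 1) * ψ a := by
  have hN : N.Prime := Fact.out
  simp only [gaussSum, Finset.mul_sum]
  rw [Finset.sum_comm]
  have key (b : ZMod N) : ∑ χ : DirichletCharacter ℂ N, χ a * (χ⁻¹ b * ψ b) =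
      if b = a then (N - 1) * ψ a else 0 := by
    by_cases hb : b = 0
    · simp [hb, ha.symm, MulChar.map_zero]
    · have h := DirichletCharacter.sum_char_inv_mul_char_eq ℂ (isUnit_iff_ne_zero.2 hb) a
      calc _ = (∑ χ : DirichletCharacter ℂ N, χ b⁻¹ * χ a) * ψ b := by
            rw [Finset.sum_mul]
            refine Finset.sum_congr rfl fun χ _ => ?_
            rw [MulChar.inv_apply']; ring
        _ = _ := by
            rw [h, Nat.totient_prime hN]
            split_ifs with hba
            · rw [hba, Nat.cast_sub hN.one_le, Nat.cast_one]
            · simp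
  simp [key]

theorem even_primitive_character_sum (p N : ℕ) (hp : p.Prime) (hN : N.Prime)
    (hpN : p ≠ N) :
    ∑ᶠ χ ∈ {χ : DirichletCharacter ℂ N | χ.IsPrimitive ∧ χ (-1) = 1},
        χ ((p : ℕ) : ZMod N) / gaussSum' χ
      = Complex.ofReal ((((N : ℝ) - 1) / N) * Real.cos (2 * Real.pi * p / N) + 1 / N) := by
  classical
  have : Fact N.Prime := ⟨hN⟩
  have hN0 : (N : ℂ) ≠ 0 := Nat.cast_ne_zero.2 hN.ne_zero
  have hp0 : (p : ZMod N) ≠ 0 := by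
    rw [Ne, ZMod.natCast_eq_zero_iff, Nat.prime_dvd_prime_iff_eq hN hp]
    exact hpN.symm
  set ψ : AddChar (ZMod N) ℂ := ZMod.stdAddChar with hψ
  have hprim : ψ.IsPrimitive := ZMod.isPrimitive_stdAddChar N
  have hψ1 : ψ⁻¹ ≠ 1 := by
    rw [Ne, inv_eq_one]
    rintro h
    exact hprim one_ne_zero (by rw [h]; ext; simp)
  let F (χ : DirichletCharacter ℂ N) : ℂ :=
    (χ p * gaussSum χ⁻¹ ψ⁻¹ + χ (-p) * gaussSum χ⁻¹ ψ⁻¹) / (2 * N)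
  have hF (χ : DirichletCharacter ℂ N) (hχ : χ ≠ 1) :
      (if χ (-1) = 1 then χ p / gaussSum' χ else 0) = F χ := by
    have hτ : gaussSum χ ψ * gaussSum χ⁻¹ ψ⁻¹ = N := by
      simpa using gaussSum_mul_gaussSum_eq_card hχ hprim
    have hneg : χ (-p) = χ (-1) * χ p := by rw [← map_mul, neg_one_mul]
    have hτ0 : gaussSum χ ψ ≠ 0 := fun h => hN0 (by rw [← hτ, h, zero_mul])
    simp only [F]
    rw [hneg]
    split_ifs with h
    · rw [gaussSum'_eq_gaussSum, h, ← hψ]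
      field_simp
      rw [← hτ]; ring
    · have : χ (-1) = -1 := by
        have := χ.even_or_odd
        exact this.resolve_left h
      rw [this]; ring
  have hF1 : F 1 = -1 / N := by
    have hg : gaussSum (1 : DirichletCharacter ℂ N)⁻¹ ψ⁻¹ = -1 := by
      rw [inv_one]
      exact gaussSum_one_left hψ1
    have h1 : (1 : DirichletCharacter ℂ N) p = 1 := MulChar.one_apply (isUnit_iff_ne_zero.2 hp0)
    have h2 : (1 : DirichletCharacter ℂ N) (-p) = 1 :=
      MulChar.one_apply (isUnit_iff_ne_zero.2 (neg_ne_zero.2 hp0))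
    simp only [F]
    rw [hg, h1, h2]
    field_simp; ring
  have hFsum : ∑ χ, F χ = (N - 1) * (ψ p + ψ (-p)) / (2 * N) := by
    simp only [F]
    rw [← Finset.sum_div, Finset.sum_add_distrib,
      DirichletCharacter.sum_apply_mul_gaussSum_inv _ hp0,
      DirichletCharacter.sum_apply_mul_gaussSum_inv _ (neg_ne_zero.2 hp0),
      AddChar.inv_apply, AddChar.inv_apply, neg_neg]
    ring
  have hcos : ψ p + ψ (-p) = 2 * Complex.cos (2 * Real.pi * p / N) := by
    rw [AddChar.map_neg_eq_inv, hψ, ZMod.stdAddChar_natCast, ← Complex.exp_neg,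
      Complex.two_cos]
    congr 2 <;> ring
  have hLHS : ∑ᶠ χ ∈ {χ : DirichletCharacter ℂ N | χ.IsPrimitive ∧ χ (-1) = 1},
      χ ((p : ℕ) : ZMod N) / gaussSum' χ = ∑ χ ∈ Finset.univ.erase 1, F χ := by
    rw [← Finset.sum_congr rfl fun χ hχ => hF χ (Finset.ne_of_mem_erase hχ),
      ← Finset.sum_filter, ← finsum_mem_coe_finset]
    congr! 4 with χ
    simp [DirichletCharacter.isPrimitive_iff_ne_one_of_prime hN]
  rw [hLHS, ← sub_eq_of_eq_add' (Finset.add_sum_erase _ F (Finset.mem_univ 1)).symm, hFsum, hF1,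
    hcos]
  push_cast
  field_simp
  ring
end

section
/- Fix y > 0. For every function N : ℝ → ℝ satisfying N(X) ≥ X for all X > 0, one has lim_{X → ∞} (⌈yX⌉^𝔭 − yX)/N(X) = 0. -/
open Filter Topology

/-- `⌈x⌉^𝔭`: the smallest prime number that is `≥ x`. -/
noncomputable def leastPrime (x : ℝ) : ℕ := sInf {p : ℕ | p.Prime ∧ x ≤ (p : ℝ)}

section Tauberian

open MeasureTheory FourierTransform

/-- A continuous even function vanishing outside `[-1, 1]` whose Fourier transform is nonpositive
outside `[-1, 1]`. -/
noncomputable def bandKernel (ξ : ℝ) : ℝ :=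
  (1 - min |ξ| 1) * Real.cos (Real.pi * min |ξ| 1) +
    2 / Real.pi * Real.sin (Real.pi * min |ξ| 1)

lemma continuous_bandKernel : Continuous bandKernel := by
  unfold bandKernel
  fun_prop

lemma bandKernel_neg (ξ : ℝ) : bandKernel (-ξ) = bandKernel ξ := by
  simp [bandKernel]

lemma bandKernel_zero : bandKernel 0 = 1 := by
  simp [bandKernel]

lemma bandKernel_of_one_le_abs {ξ : ℝ} (h : 1 ≤ |ξ|) : bandKernel ξ = 0 := by
  simp [bandKernel, min_eq_right h]

lemma hasCompactSupport_bandKernel : HasCompactSupport bandKernel := by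
  refine HasCompactSupport.intro (isCompact_Icc (a := (-1 : ℝ)) (b := 1)) fun ξ hξ => ?_
  refine bandKernel_of_one_le_abs ?_
  by_contra! h
  exact hξ (abs_le.mp h.le)

lemma integral_bandKernel_mul_cos {t : ℝ} (h₁ : Real.pi + t ≠ 0) (h₂ : Real.pi - t ≠ 0) :
    ∫ ξ in (0 : ℝ)..1, bandKernel ξ * Real.cos (t * ξ) =
      (1 + Real.cos t) * (3 * Real.pi ^ 2 - t ^ 2) / (Real.pi ^ 2 - t ^ 2) ^ 2 := by
  have hpi := Real.pi_ne_zero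
  let P : ℝ → ℝ → ℝ := fun a ξ =>
    ((1 - ξ) * (Real.sin (a * ξ) / a) - Real.cos (a * ξ) / a ^ 2) / 2 -
      Real.cos (a * ξ) / a / Real.pi
  have hP : ∀ a : ℝ, a ≠ 0 → ∀ ξ : ℝ, HasDerivAt (P a)
      ((1 - ξ) * Real.cos (a * ξ) / 2 + Real.sin (a * ξ) / Real.pi) ξ := by
    intro a ha ξ
    have h0 : HasDerivAt (fun ξ : ℝ => a * ξ) a ξ := by
      simpa using (hasDerivAt_id ξ).const_mul a
    have h1 : HasDerivAt (fun ξ : ℝ => 1 - ξ) (-1) ξ := by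
      simpa using (hasDerivAt_id ξ).const_sub 1
    convert! (((h1.mul (h0.sin.div_const a)).sub (h0.cos.div_const (a ^ 2))).div_const 2).sub
      ((h0.cos.div_const a).div_const Real.pi) using 1
    field_simp
    ring
  have hd : ∀ ξ ∈ Set.uIcc (0 : ℝ) 1, HasDerivAt (fun ξ => P (Real.pi + t) ξ + P (Real.pi - t) ξ)
      (bandKernel ξ * Real.cos (t * ξ)) ξ := by
    intro ξ hξ
    rw [Set.uIcc_of_le zero_le_one] at hξ
    convert! (hP _ h₁ ξ).add (hP _ h₂ ξ) using 1
    rw [bandKernel, abs_of_nonneg hξ.1, min_eq_left hξ.2, add_mul Real.pi, sub_mul Real.pi, Real.cos_add,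
      Real.cos_sub, Real.sin_add, Real.sin_sub]
    ring
  rw [intervalIntegral.integral_eq_sub_of_hasDerivAt hd
    ((continuous_bandKernel.mul (by fun_prop)).intervalIntegrable _ _)]
  have h₃ : Real.pi ^ 2 - t ^ 2 ≠ 0 := by
    rw [sq_sub_sq]
    exact mul_ne_zero h₁ h₂
  have c₁ : Real.cos (Real.pi + t) = - Real.cos t := by rw [Real.cos_add]; simp
  simp only [P, mul_one, mul_zero, Real.cos_zero, Real.sin_zero, c₁, Real.cos_pi_sub, sub_self,
    zero_mul, zero_div]
  rw [sq_sub_sq, mul_pow]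
  field_simp
  ring

lemma fourier_ofReal_bandKernel (x : ℝ) : 𝓕 (fun ξ => (bandKernel ξ : ℂ)) x =
    ((2 * ∫ ξ in (0 : ℝ)..1, bandKernel ξ * Real.cos (2 * Real.pi * x * ξ) : ℝ) : ℂ) := by
  have hc : Continuous fun v : ℝ => Complex.exp (↑(-2 * Real.pi * v * x) * Complex.I) •
      (bandKernel v : ℂ) := by
    have := continuous_bandKernel
    fun_prop
  have hi : ∀ a b : ℝ, IntervalIntegrable (fun v : ℝ =>
      Complex.exp (↑(-2 * Real.pi * v * x) * Complex.I) • (bandKernel v : ℂ)) volume a b :=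
    fun a b => hc.intervalIntegrable a b
  rw [Real.fourier_real_eq_integral_exp_smul,
    ← intervalIntegral.integral_eq_integral_of_support_subset (a := -1) (b := 1),
    ← intervalIntegral.integral_add_adjacent_intervals (hi (-1) 0) (hi 0 1)]
  · have := intervalIntegral.integral_comp_neg (a := 0) (b := 1) (fun v : ℝ =>
      Complex.exp (↑(-2 * Real.pi * v * x) * Complex.I) • (bandKernel v : ℂ))
    rw [neg_zero] at this
    rw [← this, ← intervalIntegral.integral_add ?_ (hi 0 1), ← intervalIntegral.integral_const_mul,
      ← intervalIntegral.integral_ofReal]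
    · refine intervalIntegral.integral_congr fun v _ => ?_
      simp only [bandKernel_neg, smul_eq_mul]
      push_cast
      rw [Complex.cos]
      ring_nf
    · exact (hc.comp continuous_neg).intervalIntegrable 0 1
  · intro v hv
    by_contra h
    apply hv
    have : 1 ≤ |v| := by
      by_contra! h'
      rw [abs_lt] at h'
      exact h ⟨h'.1, h'.2.le⟩
    simp [bandKernel_of_one_le_abs this]

lemma fourier_bandKernel_of_one_le_abs {x : ℝ} (hx : 1 ≤ |x|) :
    ∃ r : ℝ, 𝓕 (fun ξ => (bandKernel ξ : ℂ)) x = r ∧ r ≤ 0 ∧ -r ≤ 8 / (1 + x ^ 2) := by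
  have hx2 : 1 ≤ x ^ 2 := by
    rw [← sq_abs]; nlinarith
  have hpi := Real.pi_pos
  have hpi3 := Real.pi_gt_three
  have h9 : 9 ≤ Real.pi ^ 2 := by nlinarith
  have h₃ : 0 < (2 * Real.pi * x) ^ 2 - Real.pi ^ 2 := by nlinarith
  have hne : (Real.pi + 2 * Real.pi * x) * (Real.pi - 2 * Real.pi * x) ≠ 0 := by
    rw [← sq_sub_sq]; linarith
  refine ⟨_, fourier_ofReal_bandKernel x, ?_, ?_⟩ <;>
    rw [integral_bandKernel_mul_cos (left_ne_zero_of_mul hne) (right_ne_zero_of_mul hne)]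
  · have h₁ := Real.neg_one_le_cos (2 * Real.pi * x)
    have : (1 + Real.cos (2 * Real.pi * x)) * (3 * Real.pi ^ 2 - (2 * Real.pi * x) ^ 2) ≤ 0 :=
      mul_nonpos_of_nonneg_of_nonpos (by linarith) (by nlinarith)
    have := div_nonpos_of_nonpos_of_nonneg this
      (sq_nonneg (Real.pi ^ 2 - (2 * Real.pi * x) ^ 2))
    linarith
  · have h₁ := Real.neg_one_le_cos (2 * Real.pi * x)
    have h₂ := Real.cos_le_one (2 * Real.pi * x)
    generalize Real.cos (2 * Real.pi * x) = c at *
    have hD : 1 + x ^ 2 ≤ (2 * Real.pi * x) ^ 2 - Real.pi ^ 2 := by nlinarith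
    have hN : (2 * Real.pi * x) ^ 2 - 3 * Real.pi ^ 2 ≤ (2 * Real.pi * x) ^ 2 - Real.pi ^ 2 := by
      nlinarith
    have hN0 : 0 ≤ (2 * Real.pi * x) ^ 2 - 3 * Real.pi ^ 2 := by nlinarith
    generalize (2 * Real.pi * x) ^ 2 = T at *
    calc -(2 * ((1 + c) * (3 * Real.pi ^ 2 - T) / (Real.pi ^ 2 - T) ^ 2))
        = 2 * ((1 + c) * (T - 3 * Real.pi ^ 2)) / (T - Real.pi ^ 2) ^ 2 := by
          rw [← neg_sq (Real.pi ^ 2 - T), neg_sub]; ring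
      _ ≤ 2 * (2 * (T - Real.pi ^ 2)) / (T - Real.pi ^ 2) ^ 2 := by
          gcongr; linarith
      _ = 4 / (T - Real.pi ^ 2) := by field_simp; norm_num
      _ ≤ 8 / (1 + x ^ 2) := by gcongr; norm_num

lemma integrable_fourier_bandKernel : Integrable (𝓕 (fun ξ => (bandKernel ξ : ℂ))) := by
  have hki : Integrable (fun ξ => (bandKernel ξ : ℂ)) :=
    (continuous_bandKernel.integrable_of_hasCompactSupport hasCompactSupport_bandKernel).ofReal
  have hc : Continuous (𝓕 (fun ξ => (bandKernel ξ : ℂ))) :=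
    VectorFourier.fourierIntegral_continuous Real.continuous_fourierChar continuous_inner hki
  obtain ⟨M, hM⟩ := (isCompact_Icc (a := (-1 : ℝ)) (b := 1)).exists_bound_of_continuousOn
    hc.continuousOn
  refine Integrable.mono' (integrable_inv_one_add_sq.const_mul (2 * |M| + 8))
    hc.aestronglyMeasurable (Eventually.of_forall fun x => ?_)
  rw [← div_eq_mul_inv]
  rcases le_total 1 |x| with hx | hx
  · obtain ⟨r, hr, hr0, hr8⟩ := fourier_bandKernel_of_one_le_abs hx
    rw [hr, Complex.norm_real, Real.norm_eq_abs, abs_of_nonpos hr0]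
    refine hr8.trans ?_
    gcongr
    linarith [abs_nonneg M]
  · refine (hM x (abs_le.mp hx)).trans ?_
    have hx2 : x ^ 2 ≤ 1 := by rw [← sq_abs]; nlinarith [abs_nonneg x]
    rw [le_div_iff₀ (by positivity)]
    nlinarith [abs_nonneg M, le_abs_self M, sq_nonneg x]

/-- For each `δ > 0` there is a band-limited function with positive integral which is nonpositive
outside `(-δ, δ)`. -/
lemma exists_bandlimited_nonpos_outside {δ : ℝ} (hδ : 0 < δ) :
    ∃ k : ℝ → ℂ, Continuous k ∧ HasCompactSupport k ∧ Integrable (𝓕 k) ∧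
      (∀ x, δ ≤ |x| → (𝓕 k x).re ≤ 0) ∧ 0 < (∫ x, 𝓕 k x).re := by
  have hscale : ∀ x, 𝓕 (fun ξ => (bandKernel (δ * ξ) : ℂ)) x =
      (δ⁻¹ : ℂ) * 𝓕 (fun ξ => (bandKernel ξ : ℂ)) (x / δ) := by
    intro x
    rw [Real.fourier_real_eq_integral_exp_smul, Real.fourier_real_eq_integral_exp_smul]
    have := Measure.integral_comp_mul_left (fun v : ℝ =>
      Complex.exp (↑(-2 * Real.pi * v * (x / δ)) * Complex.I) • (bandKernel v : ℂ)) δ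
    rw [abs_of_pos (inv_pos.mpr hδ)] at this
    rw [← Complex.ofReal_inv, ← Complex.real_smul, ← this]
    congr with v
    congr 4
    field_simp
  have hcont : Continuous fun ξ => (bandKernel (δ * ξ) : ℂ) := by
    have := continuous_bandKernel
    fun_prop
  have hsupp : HasCompactSupport fun ξ => (bandKernel (δ * ξ) : ℂ) := by
    have := (hasCompactSupport_bandKernel.comp_homeomorph
      (Homeomorph.mulLeft₀ δ hδ.ne')).comp_left (g := ((↑) : ℝ → ℂ)) Complex.ofReal_zero
    exact this
  have hinteg : Integrable (𝓕 (fun ξ => (bandKernel (δ * ξ) : ℂ))) := by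
    rw [funext hscale]
    exact (integrable_fourier_bandKernel.comp_div hδ.ne').const_mul _
  refine ⟨_, hcont, hsupp, hinteg, fun x hx => ?_, ?_⟩
  · obtain ⟨r, hr, hr0, -⟩ := fourier_bandKernel_of_one_le_abs (x := x / δ)
      (by rw [abs_div, abs_of_pos hδ]; exact (one_le_div hδ).mpr hx)
    rw [hscale, hr, ← Complex.ofReal_inv, ← Complex.ofReal_mul, Complex.ofReal_re]
    exact mul_nonpos_of_nonneg_of_nonpos (inv_pos.mpr hδ).le hr0
  · have := congrFun (hcont.fourierInv_fourier_eq
      (hcont.integrable_of_hasCompactSupport hsupp) hinteg) 0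
    rw [Real.fourierInv_eq] at this
    simp [bandKernel_zero] at this
    rw [this]
    simp

/-- Summing translates of a Fourier transform against the coefficients of a Dirichlet series. -/
lemma hasSum_term_mul_fourier_log_sub {a : ℕ → ℂ} {k : ℝ → ℂ} (hk : Integrable k) {σ : ℝ}
    (ha : LSeriesSummable a σ) (u : ℝ) :
    HasSum (fun n : ℕ => LSeries.term a σ n * 𝓕 k (Real.log n - u))
      (𝓕 (fun ξ : ℝ => LSeries a (σ + 2 * Real.pi * ξ * Complex.I) * k ξ) (-u)) := by
  have hterm : ∀ (n : ℕ) (ξ : ℝ),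
      Complex.exp (↑(-2 * Real.pi * ξ * (-u)) * Complex.I) *
        LSeries.term a (σ + 2 * Real.pi * ξ * Complex.I) n =
      LSeries.term a σ n *
        Complex.exp (↑(-2 * Real.pi * ξ * (Real.log n - u)) * Complex.I) := by
    intro n ξ
    rcases eq_or_ne n 0 with rfl | hn
    · simp
    have hn' : (n : ℂ) ≠ 0 := Nat.cast_ne_zero.mpr hn
    have hexp : Complex.exp (↑(-2 * Real.pi * ξ * (Real.log n - u)) * Complex.I) =
        Complex.exp (↑(-2 * Real.pi * ξ * (-u)) * Complex.I) *
          Complex.exp (-(Real.log n * (2 * Real.pi * ξ * Complex.I))) := by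
      rw [← Complex.exp_add]
      congr 1
      push_cast
      ring
    rw [LSeries.term_of_ne_zero hn, LSeries.term_of_ne_zero hn, Complex.cpow_add _ _ hn',
      Complex.cpow_def_of_ne_zero hn' (2 * Real.pi * ξ * Complex.I), ← Complex.natCast_log,
      hexp, div_eq_mul_inv, mul_inv, ← Complex.exp_neg, div_eq_mul_inv]
    ring
  have hinteg : ∀ (w : ℝ) (c : ℂ), Integrable fun ξ : ℝ =>
      c * (Complex.exp (↑(-2 * Real.pi * ξ * w) * Complex.I) * k ξ) := by
    intro w c
    refine (hk.bdd_mul (c := 1) (Continuous.aestronglyMeasurable (by fun_prop))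
      (Eventually.of_forall fun ξ => ?_)).const_mul c
    exact (Complex.norm_exp_ofReal_mul_I _).le
  have key := hasSum_integral_of_summable_integral_norm (μ := volume)
    (F := fun (n : ℕ) (ξ : ℝ) => LSeries.term a σ n *
      (Complex.exp (↑(-2 * Real.pi * ξ * (Real.log n - u)) * Complex.I) * k ξ))
    (fun n => hinteg _ _) (by
      simp only [norm_mul, Complex.norm_exp_ofReal_mul_I, one_mul, integral_const_mul]
      exact ha.norm.mul_right _)
  convert! key using 1
  · ext n
    rw [integral_const_mul, Real.fourier_real_eq_integral_exp_smul]
    rfl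
  · rw [Real.fourier_real_eq_integral_exp_smul]
    congr with ξ
    simp_rw [← mul_assoc, ← hterm]
    rw [tsum_mul_right, tsum_mul_left, smul_eq_mul, ← mul_assoc]
    rfl

/-- Laplace transform of a Fourier transform. -/
lemma integral_exp_mul_fourier {k : ℝ → ℂ} (hk : Integrable k) {σ : ℝ} (hσ : 1 < σ) (u : ℝ) :
    ∫ t in Set.Ioi (-u), Complex.exp (↑(-(σ - 1) * (t + u))) * 𝓕 k t =
      𝓕 (fun ξ : ℝ => 1 / (σ + 2 * Real.pi * ξ * Complex.I - 1) * k ξ) (-u) := by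
  have hexp : IntegrableOn (fun t : ℝ => Complex.exp (↑(-(σ - 1) * (t + u)))) (Set.Ioi (-u)) := by
    have := (integrableOn_exp_mul_complex_Ioi (a := ((-(σ - 1) : ℝ) : ℂ))
      (by rw [Complex.ofReal_re]; linarith) (-u)).mul_const (Complex.exp (↑(-(σ - 1) * u)))
    refine this.congr (Eventually.of_forall fun t => ?_)
    simp only
    rw [← Complex.exp_add]
    push_cast
    ring_nf
  simp_rw [Real.fourier_real_eq_integral_exp_smul, ← integral_const_mul, smul_eq_mul]
  rw [integral_integral_swap]
  · congr with ξ
    have ha : (-(σ - 1 : ℂ) - 2 * Real.pi * ξ * Complex.I).re < 0 := by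
      simpa using hσ
    have h := integral_exp_mul_complex_Ioi ha (-u)
    have hne : (σ : ℂ) + 2 * Real.pi * ξ * Complex.I - 1 ≠ 0 := by
      intro h0
      rw [show -(σ - 1 : ℂ) - 2 * Real.pi * ξ * Complex.I =
        -((σ : ℂ) + 2 * Real.pi * ξ * Complex.I - 1) by ring, h0] at ha
      simp at ha
    have h2 : ∀ t : ℝ, Complex.exp (↑(-(σ - 1) * (t + u))) *
        (Complex.exp (↑(-2 * Real.pi * ξ * t) * Complex.I) * k ξ) =
        Complex.exp ((-(σ - 1 : ℂ) - 2 * Real.pi * ξ * Complex.I) * t) *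
          (Complex.exp (-(σ - 1 : ℂ) * u) * k ξ) := by
      intro t
      rw [← mul_assoc, ← mul_assoc, ← Complex.exp_add, ← Complex.exp_add]
      congr 2
      push_cast
      ring
    simp_rw [h2]
    rw [integral_mul_const, h,
      show -(σ - 1 : ℂ) - 2 * Real.pi * ξ * Complex.I =
        -((σ : ℂ) + 2 * Real.pi * ξ * Complex.I - 1) by ring, neg_div_neg_eq, div_mul_eq_mul_div,
      ← mul_assoc, ← Complex.exp_add, ← mul_assoc, mul_one_div, div_mul_eq_mul_div]
    congr 4
    push_cast
    ring
  · have hprod := hexp.mul_prod hk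
    refine (hprod.bdd_mul (c := 1)
      (f := fun z : ℝ × ℝ => Complex.exp (↑(-2 * Real.pi * z.2 * z.1) * Complex.I))
      (Continuous.aestronglyMeasurable (by fun_prop))
      (Eventually.of_forall fun z => (Complex.norm_exp_ofReal_mul_I _).le)).congr
      (Eventually.of_forall fun z => ?_)
    simp only [Function.uncurry]
    ring

/-- If a Dirichlet series with nonnegative coefficients has a simple pole of residue `1` at `s = 1`
and is otherwise continuous up to the line `re s = 1`, then it has nonzero coefficients `a n` with
`log n` in every sufficiently far interval of fixed length. -/
theorem eventually_exists_ne_zero_abs_log_sub_lt {a : ℕ → ℝ} (ha : ∀ n, 0 ≤ a n)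
    (hs : ∀ σ : ℝ, 1 < σ → LSeriesSummable (fun n => (a n : ℂ)) σ) {G : ℂ → ℂ}
    (hG : ContinuousOn G {s | 1 ≤ s.re})
    (hGa : ∀ s : ℂ, 1 < s.re → LSeries (fun n => (a n : ℂ)) s = G s + 1 / (s - 1))
    {δ : ℝ} (hδ : 0 < δ) :
    ∀ᶠ u : ℝ in atTop, ∃ n : ℕ, n ≠ 0 ∧ a n ≠ 0 ∧ |Real.log n - u| < δ := by
  obtain ⟨k, hk, hks, hFk, hneg, hpos⟩ := exists_bandlimited_nonpos_outside hδ
  have hki : Integrable k := hk.integrable_of_hasCompactSupport hks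
  let line : ℝ → ℝ → ℂ := fun σ ξ => σ + 2 * Real.pi * ξ * Complex.I
  have hre : ∀ σ ξ, (line σ ξ).re = σ := fun σ ξ => by simp [line]
  have hline : Continuous fun p : ℝ × ℝ => line p.1 p.2 := by fun_prop
  have hGline : ContinuousOn (fun p : ℝ × ℝ => G (line p.1 p.2)) (Set.Ici 1 ×ˢ Set.univ) :=
    hG.comp hline.continuousOn fun p hp => by simpa [hre] using hp.1
  have hGσ : ∀ σ, 1 ≤ σ → Continuous fun ξ => G (line σ ξ) := fun σ hσ => by
    rw [← continuousOn_univ]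
    exact hGline.comp (f := fun ξ : ℝ => (σ, ξ)) (by fun_prop) fun ξ _ => ⟨hσ, trivial⟩
  have hGk : ∀ σ, 1 ≤ σ → Integrable fun ξ => G (line σ ξ) * k ξ := fun σ hσ =>
    ((hGσ σ hσ).mul hk).integrable_of_hasCompactSupport hks.mul_left
  have hlim : ∀ u : ℝ, (∀ n : ℕ, n ≠ 0 → a n ≠ 0 → δ ≤ |Real.log n - u|) →
      (∫ t in Set.Ioi (-u), 𝓕 k t).re + (𝓕 (fun ξ => G (line 1 ξ) * k ξ) (-u)).re ≤ 0 := by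
    intro u hu
    have hle : ∀ σ : ℝ, 1 < σ →
        ((∫ t in Set.Ioi (-u), Complex.exp (↑(-(σ - 1) * (t + u))) * 𝓕 k t) +
          𝓕 (fun ξ => G (line σ ξ) * k ξ) (-u)).re ≤ 0 := by
      intro σ hσ
      have hsum := hasSum_term_mul_fourier_log_sub hki (hs σ hσ) u
      have hne : ∀ ξ, line σ ξ - 1 ≠ 0 := fun ξ h => by
        have := congrArg Complex.re h
        simp [hre] at this
        linarith
      have hpole : Integrable fun ξ => 1 / (line σ ξ - 1) * k ξ := by
        refine (Continuous.mul (continuous_const.div₀ ?_ hne) hk).integrable_of_hasCompactSupport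
          hks.mul_left
        exact (hline.comp (by fun_prop : Continuous fun ξ : ℝ => (σ, ξ))).sub continuous_const
      have heq : 𝓕 (fun ξ => LSeries (fun n => (a n : ℂ)) (line σ ξ) * k ξ) (-u) =
          (∫ t in Set.Ioi (-u), Complex.exp (↑(-(σ - 1) * (t + u))) * 𝓕 k t) +
          𝓕 (fun ξ => G (line σ ξ) * k ξ) (-u) := by
        have hadd : 𝓕 ((fun ξ => 1 / (line σ ξ - 1) * k ξ) + fun ξ => G (line σ ξ) * k ξ) =
            𝓕 (fun ξ => 1 / (line σ ξ - 1) * k ξ) + 𝓕 (fun ξ => G (line σ ξ) * k ξ) :=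
          VectorFourier.fourierIntegral_add Real.continuous_fourierChar continuous_inner hpole
            (hGk σ hσ.le)
        rw [integral_exp_mul_fourier hki hσ, ← Pi.add_apply, ← hadd]
        refine congrArg (fun f : ℝ → ℂ => 𝓕 f (-u)) (funext fun ξ => ?_)
        rw [hGa _ (by rwa [hre])]
        simp only [Pi.add_apply, line]
        ring
      rw [← heq]
      refine (Complex.hasSum_re hsum).nonpos fun n => ?_
      rcases eq_or_ne n 0 with rfl | hn
      · simp
      rcases eq_or_ne (a n) 0 with h0 | h0
      · simp [LSeries.term_of_ne_zero hn, h0]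
      rw [LSeries.term_of_ne_zero hn, ← Complex.ofReal_natCast,
        ← Complex.ofReal_cpow n.cast_nonneg, ← Complex.ofReal_div, Complex.re_ofReal_mul]
      exact mul_nonpos_of_nonneg_of_nonpos (div_nonneg (ha n) (by positivity))
        (hneg _ (hu n hn h0))
    have h1 : Tendsto (fun σ : ℝ => ∫ t in Set.Ioi (-u),
        Complex.exp (↑(-(σ - 1) * (t + u))) * 𝓕 k t) (𝓝[>] 1)
        (𝓝 (∫ t in Set.Ioi (-u), 𝓕 k t)) := by
      refine tendsto_integral_filter_of_dominated_convergence (fun t => ‖𝓕 k t‖) ?_ ?_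
        hFk.norm.integrableOn ?_
      · refine Eventually.of_forall fun σ => AEStronglyMeasurable.mul
          (Continuous.aestronglyMeasurable (by fun_prop)) hFk.integrableOn.1
      · filter_upwards [self_mem_nhdsWithin] with σ hσ
        filter_upwards [ae_restrict_mem measurableSet_Ioi] with t ht
        rw [norm_mul, Complex.norm_exp_ofReal]
        refine mul_le_of_le_one_left (norm_nonneg _) (Real.exp_le_one_iff.mpr ?_)
        have := Set.mem_Ioi.mp hσ
        have := Set.mem_Ioi.mp ht
        nlinarith
      · refine Eventually.of_forall fun t => tendsto_nhdsWithin_of_tendsto_nhds ?_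
        have : Continuous fun σ : ℝ => Complex.exp (↑(-(σ - 1) * (t + u))) * 𝓕 k t := by
          fun_prop
        simpa using this.tendsto 1
    have h2 : Tendsto (fun σ : ℝ => 𝓕 (fun ξ => G (line σ ξ) * k ξ) (-u)) (𝓝[>] 1)
        (𝓝 (𝓕 (fun ξ => G (line 1 ξ) * k ξ) (-u))) := by
      obtain ⟨M, hM⟩ := ((isCompact_Icc (a := (1 : ℝ)) (b := 2)).prod
        hks.isCompact).exists_bound_of_continuousOn
        (hGline.mono (Set.prod_mono Set.Icc_subset_Ici_self (Set.subset_univ _)))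
      simp_rw [Real.fourier_real_eq_integral_exp_smul]
      refine tendsto_integral_filter_of_dominated_convergence (fun ξ => M * ‖k ξ‖) ?_ ?_
        (hki.norm.const_mul M) ?_
      · filter_upwards [self_mem_nhdsWithin] with σ hσ
        exact (Continuous.smul (f := fun ξ : ℝ => Complex.exp (↑(-2 * Real.pi * ξ * (-u)) * Complex.I))
          (by fun_prop)
          ((hGσ σ (le_of_lt hσ)).mul hk)).aestronglyMeasurable
      · filter_upwards [Ioo_mem_nhdsGT (one_lt_two : (1 : ℝ) < 2)] with σ hσ
        refine Eventually.of_forall fun ξ => ?_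
        rw [norm_smul, Complex.norm_exp_ofReal_mul_I, one_mul, norm_mul]
        by_cases hξ : ξ ∈ tsupport k
        · exact mul_le_mul_of_nonneg_right (hM (σ, ξ) ⟨⟨hσ.1.le, hσ.2.le⟩, hξ⟩) (norm_nonneg _)
        · simp [image_eq_zero_of_notMem_tsupport hξ]
      · refine Eventually.of_forall fun ξ => ((?_ : Tendsto _ _ _).mul_const _).const_smul _
        have h := (hGline (1, ξ) ⟨Set.self_mem_Ici, trivial⟩).tendsto
        refine h.comp (f := fun σ : ℝ => (σ, ξ)) (tendsto_nhdsWithin_iff.mpr ⟨?_, ?_⟩)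
        · exact tendsto_nhdsWithin_of_tendsto_nhds
            (Continuous.tendsto' (by fun_prop) _ _ rfl)
        · filter_upwards [self_mem_nhdsWithin] with σ hσ
          exact ⟨Set.Ioi_subset_Ici_self hσ, trivial⟩
    rw [← Complex.add_re]
    exact le_of_tendsto ((Complex.continuous_re.tendsto _).comp (h1.add h2))
      (by filter_upwards [self_mem_nhdsWithin] with σ hσ using hle σ hσ)
  have h3 : Tendsto (fun u : ℝ => (∫ t in Set.Ioi (-u), 𝓕 k t).re +
      (𝓕 (fun ξ => G (line 1 ξ) * k ξ) (-u)).re) atTop (𝓝 ((∫ x, 𝓕 k x).re + (0 : ℂ).re)) := by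
    refine Tendsto.add ((Complex.continuous_re.tendsto _).comp ?_)
      ((Complex.continuous_re.tendsto _).comp ?_)
    · exact (aecover_Ioi tendsto_neg_atTop_atBot).integral_tendsto_of_countably_generated hFk
    · exact (Real.zero_at_infty_fourier _).comp
        (tendsto_neg_atTop_atBot.mono_right atBot_le_cocompact)
  rw [Complex.zero_re, add_zero] at h3
  filter_upwards [h3.eventually (lt_mem_nhds hpos)] with u hu
  by_contra! hcon
  exact (hlim u hcon).not_gt hu

end Tauberian

open ArithmeticFunction.vonMangoldt in
/-- The logarithms of the primes eventually meet every interval of fixed length. -/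
theorem eventually_exists_prime_abs_log_sub_lt {δ : ℝ} (hδ : 0 < δ) :
    ∀ᶠ u : ℝ in atTop, ∃ p : ℕ, p.Prime ∧ |Real.log p - u| < δ := by
  let r : ℕ → ℝ := residueClass (1 : ZMod 1)
  let b : ℕ → ℝ := fun n => if n.Prime then r n else 0
  let c : ℕ → ℝ := fun n => if n.Prime then 0 else r n
  have hr : ∀ n, 0 ≤ r n := residueClass_nonneg 1
  have hb : ∀ n, 0 ≤ b n := fun n => by
    simp only [b]
    split_ifs
    exacts [hr n, le_rfl]
  have hc : ∀ n, 0 ≤ c n := fun n => by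
    simp only [c]
    split_ifs
    exacts [le_rfl, hr n]
  have hcsum : Summable fun n : ℕ => c n / n := summable_residueClass_non_primes_div 1
  have hcle : ∀ (n : ℕ) (s : ℂ), 1 ≤ s.re →
      ‖LSeries.term (fun n => (c n : ℂ)) s n‖ ≤ c n / n := by
    intro n s hs
    refine (LSeries.norm_term_le_of_re_le_re (s := 1) _ (by simpa using hs) n).trans_eq ?_
    rcases eq_or_ne n 0 with rfl | hn
    · simp
    · simp [LSeries.term_of_ne_zero hn, abs_of_nonneg (hc n)]
  have hcS : ∀ s : ℂ, 1 ≤ s.re → LSeriesSummable (fun n => (c n : ℂ)) s := fun s hs =>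
    hcsum.of_norm_bounded fun n => hcle n s hs
  have hccont : ContinuousOn (LSeries fun n => (c n : ℂ)) {s | 1 ≤ s.re} := by
    refine continuousOn_tsum (fun n => ?_) hcsum fun n s hs => hcle n s hs
    rcases eq_or_ne n 0 with rfl | hn
    · simpa using continuousOn_const
    · simp_rw [LSeries.term_of_ne_zero hn]
      have hn' : (n : ℂ) ≠ 0 := Nat.cast_ne_zero.mpr hn
      refine Continuous.continuousOn (continuous_const.div₀
        (continuous_id.const_cpow (Or.inl hn')) fun s => ?_)
      simp [Complex.cpow_eq_zero_iff, hn]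
  have hrS : ∀ s : ℂ, 1 < s.re → LSeriesSummable (fun n => (r n : ℂ)) s := fun s hs =>
    LSeriesSummable_of_abscissaOfAbsConv_lt_re
      ((abscissaOfAbsConv_residueClass_le_one 1).trans_lt (mod_cast hs))
  have hbeq : (fun n => (b n : ℂ)) = (fun n => (r n : ℂ)) - fun n => (c n : ℂ) := by
    ext n
    simp only [b, c, Pi.sub_apply]
    split_ifs <;> simp
  have hbS : ∀ σ : ℝ, 1 < σ → LSeriesSummable (fun n => (b n : ℂ)) σ := fun σ hσ => by
    rw [hbeq]
    exact (hrS σ (by simpa using hσ)).sub (hcS σ (by simpa using hσ.le))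
  have key := eventually_exists_ne_zero_abs_log_sub_lt hb hbS
    (G := fun s => LFunctionResidueClassAux (1 : ZMod 1) s - LSeries (fun n => (c n : ℂ)) s)
    ((continuousOn_LFunctionResidueClassAux 1).sub hccont) (fun s hs => by
      rw [hbeq, LSeries_sub (hrS s hs) (hcS s hs.le),
        eqOn_LFunctionResidueClassAux isUnit_one hs]
      simp only [r, Nat.totient_one, Nat.cast_one, inv_one]
      ring) hδ
  filter_upwards [key] with u ⟨n, _, hn, hlt⟩
  refine ⟨n, ?_, hlt⟩
  by_contra h
  exact hn (if_neg h)

lemma le_leastPrime (x : ℝ) : x ≤ leastPrime x := by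
  obtain ⟨p, hp, hpp⟩ := Nat.exists_infinite_primes ⌈x⌉₊
  exact (Nat.sInf_mem (s := {p : ℕ | p.Prime ∧ x ≤ (p : ℝ)}) ⟨p, hpp, Nat.ceil_le.mp hp⟩).2

lemma leastPrime_le {x : ℝ} {p : ℕ} (hp : p.Prime) (hx : x ≤ p) : leastPrime x ≤ p :=
  Nat.sInf_le ⟨hp, hx⟩

/-- For every `c > 1` and all large `x` there is a prime in `[x, c * x]`. -/
theorem eventually_leastPrime_le_mul {c : ℝ} (hc : 1 < c) :
    ∀ᶠ x : ℝ in atTop, (leastPrime x : ℝ) ≤ c * x := by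
  have hδ : 0 < Real.log c / 2 := half_pos (Real.log_pos hc)
  have h := (tendsto_atTop_add_const_right atTop (Real.log c / 2) Real.tendsto_log_atTop).eventually
    (eventually_exists_prime_abs_log_sub_lt hδ)
  filter_upwards [h, eventually_gt_atTop 0] with x ⟨p, hp, hlt⟩ hx
  have hp0 : (0 : ℝ) < p := Nat.cast_pos.mpr hp.pos
  rw [abs_lt] at hlt
  have h1 : x ≤ p := (Real.log_le_log_iff hx hp0).mp (by linarith)
  have h2 : (p : ℝ) ≤ c * x := by
    rw [← Real.log_le_log_iff hp0 (by positivity), Real.log_mul (by positivity) hx.ne']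
    linarith
  exact (Nat.cast_le.mpr (leastPrime_le hp h1)).trans h2

theorem leastPrime_gap_div_tendsto_zero (y : ℝ) (hy : 0 < y) (N : ℝ → ℝ)
    (hN : ∀ X : ℝ, 0 < X → X ≤ N X) :
    Tendsto (fun X : ℝ => ((leastPrime (y * X) : ℝ) - y * X) / N X) atTop (𝓝 0) := by
  rw [Metric.tendsto_nhds]
  intro ε hε
  have hc : 1 < 1 + ε / (2 * y) := by
    have : 0 < ε / (2 * y) := by positivity
    linarith
  filter_upwards [(tendsto_id.const_mul_atTop hy).eventually (eventually_leastPrime_le_mul hc),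
    eventually_gt_atTop 0] with X hX hX0
  have hNX := hN X hX0
  have hN0 := hX0.trans_le hNX
  have hge := le_leastPrime (y * X)
  rw [Real.dist_0_eq_abs, abs_of_nonneg (div_nonneg (sub_nonneg.mpr hge) hN0.le), div_lt_iff₀ hN0]
  have heq : (1 + ε / (2 * y)) * (y * X) = y * X + ε / 2 * X := by
    field_simp
  simp only [id] at hX
  nlinarith
end

section
/- Assume the Riemann hypothesis. Fix η > 0 and δ ∈ (1/2, 1), and let f : ℝ → ℂ be continuous. Then lim_{X → ∞} (log X / X^δ) · Σ_{p prime, ηX ≤ p ≤ ηX + X^δ} f(p/X) = f(η). -/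
open Filter Topology Finset

/-- The Riemann hypothesis: every zero of the Riemann zeta function with real part
strictly between `0` and `1` has real part `1/2`. -/
def RiemannHypothesis' : Prop :=
  ∀ s : ℂ, riemannZeta s = 0 → 0 < s.re → s.re < 1 → s.re = 1 / 2

/-- The fractional part function, cut off to `(1, ∞)`. -/
noncomputable def fractTail : ℝ → ℂ :=
  (Set.Ioi 1).indicator fun t : ℝ => ((Int.fract t : ℝ) : ℂ)

lemma norm_fractTail_le (t : ℝ) : ‖fractTail t‖ ≤ (Set.Ioi (1 : ℝ)).indicator (fun _ => 1) t := by
  rw [fractTail, norm_indicator_eq_indicator_norm]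
  refine Set.indicator_le_indicator ?_
  rw [Complex.norm_real, Real.norm_eq_abs, abs_of_nonneg (Int.fract_nonneg t)]
  exact (Int.fract_lt_one t).le

lemma norm_fractTail_le_one (t : ℝ) : ‖fractTail t‖ ≤ 1 :=
  (norm_fractTail_le t).trans (Set.indicator_le_self' (by simp) t)

open MeasureTheory in
/-- The Mellin transform of the fractional part beyond `1`, in closed form on `Re s > 1`. -/
lemma mul_mellin_fract_of_one_lt_re {s : ℂ} (hs : 1 < s.re) :
    s * (s - 1) * mellin fractTail (-s) =
      s - riemannZeta₁ s := by
  have hs1 : s ≠ 1 := by rintro rfl; simp at hs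
  have hs1' : s - 1 ≠ 0 := sub_ne_zero.mpr hs1
  have hzeta : riemannZeta s = s * ∫ t in Set.Ioi (1 : ℝ), (⌊t⌋₊ : ℂ) * t ^ (-(s + 1)) := by
    rw [← LSeries_one_eq_riemannZeta hs,
      LSeries_eq_mul_integral' (f := 1) (r := 1) zero_le_one hs]
    · simp
    · simpa using Asymptotics.isBigO_refl _ _
  have hpow : ∫ t in Set.Ioi (1 : ℝ), (t : ℂ) ^ (-s) = 1 / (s - 1) := by
    rw [integral_Ioi_cpow_of_lt (by simpa using hs) zero_lt_one]
    rw [show -s + 1 = -(s - 1) by ring]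
    simp only [Complex.ofReal_one, Complex.one_cpow, neg_div_neg_eq]
  have hint : IntegrableOn (fun t : ℝ => (t : ℂ) ^ (-s)) (Set.Ioi 1) :=
    integrableOn_Ioi_cpow_of_lt (by simpa using hs) zero_lt_one
  have hcpow : ∀ t ∈ Set.Ioi (1 : ℝ), (t : ℂ) * (t : ℂ) ^ (-(s + 1)) = (t : ℂ) ^ (-s) := by
    intro t ht
    have ht0 : (t : ℂ) ≠ 0 := by
      exact_mod_cast (zero_lt_one.trans (Set.mem_Ioi.mp ht)).ne'
    rw [show -s = 1 + -(s + 1) by ring, Complex.cpow_add _ _ ht0, Complex.cpow_one]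
  have hint2 : IntegrableOn (fun t : ℝ => (⌊t⌋₊ : ℂ) * (t : ℂ) ^ (-(s + 1))) (Set.Ioi 1) := by
    refine Integrable.mono hint ?_ ?_
    · refine AEStronglyMeasurable.mul ?_ ?_
      · exact (measurable_from_nat.comp Nat.measurable_floor).aestronglyMeasurable
      · refine ContinuousOn.aestronglyMeasurable ?_ measurableSet_Ioi
        intro t ht
        have ht' : (0 : ℝ) < t := zero_lt_one.trans (Set.mem_Ioi.mp ht)
        exact (Complex.continuousAt_ofReal_cpow_const _ _ (Or.inr ht'.ne')).continuousWithinAt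
    · refine (ae_restrict_iff' measurableSet_Ioi).mpr (ae_of_all _ fun t ht => ?_)
      have ht' : (0 : ℝ) < t := zero_lt_one.trans (Set.mem_Ioi.mp ht)
      rw [← hcpow t ht, norm_mul, norm_mul]
      gcongr
      simp only [Complex.norm_natCast, Complex.norm_real, Real.norm_eq_abs, abs_of_pos ht']
      exact Nat.floor_le ht'.le
  have hmellin : mellin fractTail (-s) =
      1 / (s - 1) - ∫ t in Set.Ioi (1 : ℝ), (⌊t⌋₊ : ℂ) * t ^ (-(s + 1)) := by
    rw [← hpow, ← integral_sub hint hint2, mellin]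
    have : ∀ t : ℝ, (t : ℂ) ^ (-s - 1) •
        fractTail t =
        (Set.Ioi (1 : ℝ)).indicator
          (fun t : ℝ => (t : ℂ) ^ (-s) - (⌊t⌋₊ : ℂ) * (t : ℂ) ^ (-(s + 1))) t := by
      intro t
      rw [fractTail]
      by_cases ht : t ∈ Set.Ioi (1 : ℝ)
      · rw [Set.indicator_of_mem ht, Set.indicator_of_mem ht, ← hcpow t ht, ← sub_mul,
          smul_eq_mul, show -s - 1 = -(s + 1) by ring, mul_comm]
        congr 1
        have h0 : (0 : ℝ) ≤ t := zero_le_one.trans (Set.mem_Ioi.mp ht).le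
        have : Int.fract t = t - (⌊t⌋₊ : ℝ) := by
          rw [natCast_floor_eq_intCast_floor h0]
          rfl
        rw [this]; push_cast; rfl
      · simp [Set.indicator_of_notMem ht]
    simp_rw [this]
    rw [setIntegral_indicator measurableSet_Ioi,
      Set.inter_eq_self_of_subset_right (Set.Ioi_subset_Ioi zero_le_one)]
  have hZ := riemannZeta_eq_inv_sub_mul hs1
  rw [hmellin]
  have : riemannZeta₁ s = (s - 1) * riemannZeta s := by rw [hZ]; field_simp
  rw [this, hzeta]
  field_simp

open MeasureTheory in
lemma locallyIntegrableOn_fractTail : LocallyIntegrableOn fractTail (Set.Ioi 0) := by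
  refine LocallyIntegrable.locallyIntegrableOn ?_ _
  refine (locallyIntegrable_const (1 : ℝ)).mono ?_ (ae_of_all _ fun t => ?_)
  · exact ((Complex.measurable_ofReal.comp measurable_fract).indicator
      measurableSet_Ioi).aestronglyMeasurable
  · simpa using norm_fractTail_le_one t

lemma differentiableAt_mellin_fractTail_neg {s : ℂ} (hs : 0 < s.re) :
    DifferentiableAt ℂ (fun s => mellin fractTail (-s)) s := by
  have h : DifferentiableAt ℂ (mellin fractTail) (-s) := by
    refine mellin_differentiableAt_of_isBigO_rpow (a := 0) (b := -s.re - 1)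
      locallyIntegrableOn_fractTail ?_ (by simpa using hs) ?_ (by simp)
    · refine Asymptotics.IsBigO.of_bound 1 (Eventually.of_forall fun t => ?_)
      simpa using norm_fractTail_le_one t
    · refine Asymptotics.IsBigO.of_bound 1 ?_
      filter_upwards [mem_nhdsWithin_of_mem_nhds (Iio_mem_nhds (zero_lt_one' ℝ))] with t ht
      have : fractTail t = 0 := Set.indicator_of_notMem (by simpa using (Set.mem_Iio.mp ht).le) _
      rw [this, norm_zero]
      positivity
  exact h.comp s differentiableAt_id.neg

lemma riemannZeta₁_eq_sub_mul_mellin {s : ℂ} (hs : 0 < s.re) :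
    riemannZeta₁ s = s - s * (s - 1) * mellin fractTail (-s) := by
  have hopen : IsOpen {s : ℂ | 0 < s.re} := isOpen_lt continuous_const Complex.continuous_re
  have hconv : IsPreconnected {s : ℂ | 0 < s.re} := (convex_halfSpace_re_gt 0).isPreconnected
  have h1 : AnalyticOnNhd ℂ riemannZeta₁ {s : ℂ | 0 < s.re} :=
    differentiable_riemannZeta₁.differentiableOn.analyticOnNhd hopen
  have h2 : AnalyticOnNhd ℂ (fun s => s - s * (s - 1) * mellin fractTail (-s))
      {s : ℂ | 0 < s.re} := by
    refine DifferentiableOn.analyticOnNhd (fun z hz => ?_) hopen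
    have := differentiableAt_mellin_fractTail_neg hz
    exact DifferentiableAt.differentiableWithinAt (by fun_prop)
  refine h1.eqOn_of_preconnected_of_eventuallyEq h2 hconv (z₀ := 2) (by simp) ?_ hs
  filter_upwards [(isOpen_lt continuous_const Complex.continuous_re).mem_nhds
    (show (1 : ℝ) < (2 : ℂ).re by simp)] with z hz
  rw [mul_mellin_fract_of_one_lt_re hz]
  ring

open MeasureTheory in
lemma norm_mellin_fractTail_le {s : ℂ} (hs : 0 < s.re) :
    ‖mellin fractTail (-s)‖ ≤ 1 / s.re := by
  have hI : ∫ t in Set.Ioi (1 : ℝ), t ^ (-s.re - 1) = 1 / s.re := by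
    rw [integral_Ioi_rpow_of_lt (by linarith) zero_lt_one]
    simp
  have hint : IntegrableOn (fun t : ℝ => t ^ (-s.re - 1)) (Set.Ioi 1) :=
    integrableOn_Ioi_rpow_of_lt (by linarith) zero_lt_one
  rw [← hI, mellin, ← Set.inter_eq_self_of_subset_right (Set.Ioi_subset_Ioi (zero_le_one' ℝ)),
    ← setIntegral_indicator measurableSet_Ioi]
  refine norm_integral_le_of_norm_le ?_ ?_
  · exact (hint.integrable_indicator measurableSet_Ioi).integrableOn
  · refine (ae_restrict_iff' measurableSet_Ioi).mpr (ae_of_all _ fun t ht => ?_)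
    rw [norm_smul, Complex.norm_cpow_eq_rpow_re_of_pos ht]
    by_cases h1 : t ∈ Set.Ioi (1 : ℝ)
    · rw [Set.indicator_of_mem h1]
      have := norm_fractTail_le_one t
      simpa using mul_le_of_le_one_right (Real.rpow_nonneg (le_of_lt ht) _) this
    · rw [Set.indicator_of_notMem h1]
      simp [fractTail, Set.indicator_of_notMem h1]

lemma norm_riemannZeta₁_le {s : ℂ} (hs : 1 / 2 ≤ s.re) :
    ‖riemannZeta₁ s‖ ≤ 3 * (1 + ‖s‖) ^ 2 := by
  have h0 : 0 < s.re := by linarith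
  have hm : ‖mellin fractTail (-s)‖ ≤ 2 := by
    refine (norm_mellin_fractTail_le h0).trans ?_
    rw [div_le_iff₀ h0]
    linarith
  rw [riemannZeta₁_eq_sub_mul_mellin h0]
  have h1 : ‖s - 1‖ ≤ ‖s‖ + 1 := by simpa using norm_sub_le s 1
  calc _ ≤ ‖s‖ + ‖s * (s - 1) * mellin fractTail (-s)‖ := norm_sub_le _ _
    _ = ‖s‖ + ‖s‖ * ‖s - 1‖ * ‖mellin fractTail (-s)‖ := by rw [norm_mul, norm_mul]
    _ ≤ ‖s‖ + ‖s‖ * (‖s‖ + 1) * 2 := by gcongr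
    _ ≤ _ := by nlinarith [norm_nonneg s]

/-- A Borel–Carathéodory bound for the logarithmic derivative of a nonvanishing function. -/
lemma norm_logDeriv_le_of_norm_le_exp_mul {f : ℂ → ℂ} {c : ℂ} {R r M : ℝ} (hM : 0 < M)
    (hr : 0 ≤ r) (hrR : r < R) (hf : DifferentiableOn ℂ f (Metric.ball c R))
    (hf0 : ∀ z ∈ Metric.ball c R, f z ≠ 0)
    (hfM : ∀ z ∈ Metric.ball c R, ‖f z‖ ≤ Real.exp M * ‖f c‖) {z : ℂ}
    (hz : z ∈ Metric.closedBall c r) :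
    ‖logDeriv f z‖ ≤ 8 * M * R / (R - r) ^ 2 := by
  have hR : 0 < R := hr.trans_lt hrR
  have hlog : DifferentiableOn ℂ (logDeriv f) (Metric.ball c R) :=
    (hf.deriv Metric.isOpen_ball).div hf hf0
  obtain ⟨g, hgc, hg⟩ := hlog.isExactOn_ball.with_val_at c 0
  have hc : c ∈ Metric.ball c R := Metric.mem_ball_self hR
  have hexp : ∀ w ∈ Metric.ball c R, f w = f c * Complex.exp (g w) := by
    have hder : ∀ w ∈ Metric.ball c R,
        HasDerivAt (fun w => f w * Complex.exp (-g w)) 0 w := by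
      intro w hw
      have h1 := (hf.differentiableAt (Metric.isOpen_ball.mem_nhds hw)).hasDerivAt
      refine (h1.fun_mul ((hg w hw).fun_neg.cexp)).congr_deriv ?_
      have := hf0 w hw
      rw [logDeriv_apply]
      field_simp
      ring
    intro w hw
    have h := Metric.isOpen_ball.is_const_of_deriv_eq_zero
      (convex_ball c R).isPreconnected
      (fun w hw => (hder w hw).differentiableAt.differentiableWithinAt)
      (fun w hw => (hder w hw).deriv) hw hc
    simp only [hgc, neg_zero, Complex.exp_zero, mul_one] at h
    rw [← h, mul_assoc, ← Complex.exp_add]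
    simp
  have hre : ∀ w ∈ Metric.ball c R, (g w).re ≤ M := by
    intro w hw
    have h := hfM w hw
    rw [hexp w hw, norm_mul, Complex.norm_exp, mul_comm] at h
    exact Real.exp_le_exp.mp (le_of_mul_le_mul_right h (norm_pos_iff.mpr (hf0 c hc)))
  have hgb : ∀ w ∈ Metric.ball c R, ‖g w‖ ≤ 2 * M * dist w c / (R - dist w c) := by
    intro w hw
    have hmaps : ∀ u ∈ Metric.ball (0 : ℂ) R, u + c ∈ Metric.ball c R := by
      intro u hu
      simpa [dist_eq_norm] using hu
    have := Complex.borelCaratheodory_zero (f := fun u => g (u + c)) (z := w - c) hM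
      (fun u hu => ((hg _ (hmaps u hu)).differentiableAt.comp u
        (differentiableAt_id.add_const c)).differentiableWithinAt)
      (fun u hu => hre _ (hmaps u hu)) hR (by simpa [dist_eq_norm] using hw) (by simpa using hgc)
    simpa [dist_eq_norm] using this
  have hd : 0 < (R - r) / 2 := by linarith
  have hzc : dist z c ≤ r := hz
  have hsub : ∀ w ∈ Metric.closedBall z ((R - r) / 2), dist w c ≤ (R + r) / 2 := by
    intro w hw
    have := dist_triangle w z c
    have hw' : dist w z ≤ (R - r) / 2 := hw
    linarith
  have hsub' : ∀ w ∈ Metric.closedBall z ((R - r) / 2), w ∈ Metric.ball c R := fun w hw =>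
    (hsub w hw).trans_lt (by linarith)
  have hdiff : DiffContOnCl ℂ g (Metric.ball z ((R - r) / 2)) := by
    refine DifferentiableOn.diffContOnCl fun w hw => ?_
    rw [closure_ball _ hd.ne'] at hw
    exact (hg w (hsub' w hw)).differentiableAt.differentiableWithinAt
  have hbound : ∀ w ∈ Metric.sphere z ((R - r) / 2), ‖g w‖ ≤ 4 * M * R / (R - r) := by
    intro w hw
    have hw' := Metric.sphere_subset_closedBall hw
    refine (hgb w (hsub' w hw')).trans ?_
    have h1 := hsub w hw'
    have h2 : 0 < R - dist w c := by linarith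
    rw [div_le_div_iff₀ h2 (by linarith)]
    have h3 : (0 : ℝ) ≤ dist w c := dist_nonneg
    have h4 : 2 * M * dist w c * (R - r) ≤ 2 * M * R * (R - r) := by
      have : dist w c ≤ R := by linarith
      have : 0 ≤ R - r := by linarith
      gcongr
    have h5 : 4 * M * R * ((R - r) / 2) ≤ 4 * M * R * (R - dist w c) := by
      gcongr
      linarith
    linarith
  have := Complex.norm_deriv_le_of_forall_mem_sphere_norm_le hd hdiff hbound
  rw [(hg z (hsub' z (Metric.mem_closedBall_self hd.le))).deriv] at this
  refine this.trans_eq ?_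
  have : R - r ≠ 0 := by linarith
  field_simp
  ring

lemma riemannZeta₁_eq_mul {s : ℂ} (hs : s ≠ 1) : riemannZeta₁ s = (s - 1) * riemannZeta s := by
  have : s - 1 ≠ 0 := sub_ne_zero.mpr hs
  rw [riemannZeta_eq_inv_sub_mul hs]
  field_simp

lemma RiemannHypothesis'.riemannZeta₁_ne_zero (hRH : RiemannHypothesis') {s : ℂ}
    (hs : 1 / 2 < s.re) : riemannZeta₁ s ≠ 0 := by
  by_cases h1 : s = 1
  · simp [h1]
  rw [riemannZeta₁_eq_mul h1]
  refine mul_ne_zero (sub_ne_zero.mpr h1) fun h => ?_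
  by_cases h2 : s.re < 1
  · linarith [hRH s h (by linarith) h2]
  · exact riemannZeta_ne_zero_of_one_le_re (not_lt.mp h2) h

lemma exists_le_norm_riemannZeta_of_re_eq_two :
    ∃ K : ℝ, 0 < K ∧ ∀ s : ℂ, s.re = 2 → 1 ≤ K * ‖riemannZeta s‖ := by
  set K := ∑' n, ‖LSeries.term (fun n => (ArithmeticFunction.moebius n : ℂ)) 2 n‖ with hK
  refine ⟨K + 1, ?_, fun s hs => ?_⟩
  · have : 0 ≤ K := tsum_nonneg fun n => norm_nonneg _
    linarith
  · have h1 : 1 < s.re := by rw [hs]; norm_num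
    have hsum : LSeriesSummable (fun n => (ArithmeticFunction.moebius n : ℂ)) s :=
      ArithmeticFunction.LSeriesSummable_moebius_iff.mpr h1
    have hle : ‖LSeries (fun n => (ArithmeticFunction.moebius n : ℂ)) s‖ ≤ K := by
      refine (norm_tsum_le_tsum_norm hsum.norm).trans_eq ?_
      simp_rw [hK, LSeries.norm_term_eq, hs]
      simp
    have hmul := ArithmeticFunction.LSeries_zeta_mul_Lseries_moebius h1
    rw [ArithmeticFunction.LSeries_zeta_eq_riemannZeta h1] at hmul
    have : ‖riemannZeta s‖ * ‖LSeries (fun n => (ArithmeticFunction.moebius n : ℂ)) s‖ = 1 := by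
      rw [← norm_mul, hmul, norm_one]
    rw [← this, mul_comm]
    gcongr
    linarith

lemma RiemannHypothesis'.exists_norm_logDeriv_riemannZeta₁_le (hRH : RiemannHypothesis')
    {σ ε : ℝ} (hσ : 1 / 2 < σ) (hε : 0 < ε) :
    ∃ C : ℝ, 0 < C ∧ ∀ s : ℂ, σ ≤ s.re → s.re ≤ 2 →
      ‖logDeriv riemannZeta₁ s‖ ≤ C * (1 + |s.im|) ^ ε := by
  obtain ⟨K, hK, hK'⟩ := exists_le_norm_riemannZeta_of_re_eq_two
  set A : ℝ := 1 + |Real.log (75 * K)| + 2 / ε with hA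
  have hA1 : 0 < A := by positivity
  have hmain : ∀ s : ℂ, σ ≤ s.re → s.re ≤ 2 →
      ‖logDeriv riemannZeta₁ s‖ ≤ 8 * (A * (1 + |s.im|) ^ ε) * (3 / 2) / (σ - 1 / 2) ^ 2 := by
    intro s hs1 hs2
    set y : ℝ := 1 + |s.im| with hy
    have hy1 : 1 ≤ y := by simp [hy]
    set c : ℂ := ⟨2, s.im⟩ with hc
    have hM : 0 < A * y ^ ε := by positivity
    have hball : ∀ z ∈ Metric.ball c (3 / 2), 1 / 2 < z.re ∧ ‖z‖ ≤ 4 * y := by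
      intro z hz
      rw [Metric.mem_ball, dist_eq_norm] at hz
      have hre : |(z - c).re| < 3 / 2 := (Complex.abs_re_le_norm _).trans_lt hz
      have hcn : ‖c‖ ≤ 2 + |s.im| :=
        (Complex.norm_le_abs_re_add_abs_im c).trans_eq (by simp [hc])
      have hzn : ‖z‖ ≤ ‖z - c‖ + ‖c‖ := by simpa using norm_add_le (z - c) c
      refine ⟨?_, by linarith [abs_nonneg s.im]⟩
      have := (abs_lt.mp hre).1
      simp only [Complex.sub_re, hc] at this
      linarith
    have hlow : 1 ≤ K * ‖riemannZeta₁ c‖ := by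
      have hc1 : c ≠ 1 := by
        intro h
        have := congrArg Complex.re h
        simp [hc] at this
      rw [riemannZeta₁_eq_mul hc1, norm_mul]
      have h1 : 1 ≤ ‖c - 1‖ := by
        refine le_trans ?_ (Complex.abs_re_le_norm _)
        simp [hc]
        norm_num
      calc 1 ≤ K * ‖riemannZeta c‖ := hK' c rfl
        _ ≤ K * (‖c - 1‖ * ‖riemannZeta c‖) := by
          gcongr
          exact le_mul_of_one_le_left (norm_nonneg _) h1
    have hup : ∀ z ∈ Metric.ball c (3 / 2),
        ‖riemannZeta₁ z‖ ≤ Real.exp (A * y ^ ε) * ‖riemannZeta₁ c‖ := by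
      intro z hz
      obtain ⟨h1, h2⟩ := hball z hz
      have h3 : ‖riemannZeta₁ z‖ ≤ 75 * y ^ 2 := by
        refine (norm_riemannZeta₁_le h1.le).trans ?_
        have : (1 + ‖z‖) ^ 2 ≤ (5 * y) ^ 2 := by
          gcongr
          linarith
        linarith [this]
      have h4 : 75 * K * y ^ 2 ≤ Real.exp (A * y ^ ε) := by
        rw [← Real.log_le_iff_le_exp (by positivity), Real.log_mul (by positivity) (by positivity),
          Real.log_pow]
        have h5 := Real.log_le_rpow_div (zero_le_one.trans hy1) hε
        have h6 : 1 ≤ y ^ ε := Real.one_le_rpow hy1 hε.le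
        have h7 : |Real.log (75 * K)| ≤ |Real.log (75 * K)| * y ^ ε :=
          le_mul_of_one_le_right (abs_nonneg _) h6
        have h8 := le_abs_self (Real.log (75 * K))
        have h9 : A * y ^ ε = y ^ ε + |Real.log (75 * K)| * y ^ ε + 2 * (y ^ ε / ε) := by
          rw [hA]; ring
        rw [h9]
        push_cast
        linarith
      calc ‖riemannZeta₁ z‖ ≤ 75 * y ^ 2 * 1 := by linarith
        _ ≤ 75 * y ^ 2 * (K * ‖riemannZeta₁ c‖) := by gcongr
        _ = 75 * K * y ^ 2 * ‖riemannZeta₁ c‖ := by ring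
        _ ≤ _ := by gcongr
    have hmem : s ∈ Metric.closedBall c (2 - σ) := by
      have : s - c = ((s.re - 2 : ℝ) : ℂ) := by
        apply Complex.ext <;> simp [hc]
      rw [Metric.mem_closedBall, dist_eq_norm, this, Complex.norm_real, Real.norm_eq_abs, abs_le]
      constructor <;> linarith
    have := norm_logDeriv_le_of_norm_le_exp_mul hM (by linarith) (by linarith)
      differentiable_riemannZeta₁.differentiableOn
      (fun z hz => hRH.riemannZeta₁_ne_zero (hball z hz).1) hup hmem
    convert this using 3
    ring
  refine ⟨8 * A * (3 / 2) / (σ - 1 / 2) ^ 2, ?_, fun s hs1 hs2 => ?_⟩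
  · have : 0 < σ - 1 / 2 := by linarith
    positivity
  · refine (hmain s hs1 hs2).trans_eq (by ring)

/-- The weight `1 / (s (s + 1))` of the first Riesz mean. -/
noncomputable def rieszWeight (s : ℂ) : ℂ := 1 / (s * (s + 1))

lemma norm_rieszWeight_le {s : ℂ} (hs : 1 / 2 ≤ s.re) :
    ‖rieszWeight s‖ ≤ 8 * (1 + |s.im|) ^ (-2 : ℝ) := by
  have h1 : ‖s‖ ≤ ‖s + 1‖ := by
    rw [Complex.norm_def, Complex.norm_def]
    refine Real.sqrt_le_sqrt ?_
    simp only [Complex.normSq_apply, Complex.add_re, Complex.one_re, Complex.add_im,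
      Complex.one_im, add_zero]
    nlinarith
  have h2 : (1 + |s.im|) ^ 2 ≤ 8 * (‖s‖ * ‖s + 1‖) := by
    have h3 : ‖s‖ ^ 2 = s.re * s.re + s.im * s.im := by
      rw [Complex.sq_norm, Complex.normSq_apply]
    have h4 : ‖s‖ * ‖s‖ ≤ ‖s‖ * ‖s + 1‖ := by gcongr
    nlinarith [sq_nonneg (1 - |s.im|), sq_abs s.im]
  have h5 : (0 : ℝ) < (1 + |s.im|) ^ 2 := by positivity
  have h6 : 0 < ‖s‖ * ‖s + 1‖ := by linarith
  rw [rieszWeight, norm_div, norm_one, norm_mul, Real.rpow_neg (by positivity),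
    ← div_eq_mul_inv, div_le_div_iff₀ h6 (by positivity)]
  simpa using h2

lemma integrable_one_add_abs_rpow {r : ℝ} (hr : 1 < r) :
    MeasureTheory.Integrable fun t : ℝ => (1 + |t|) ^ (-r) := by
  simpa using integrable_one_add_norm (E := ℝ) (μ := MeasureTheory.volume) (r := r) (by simpa)

lemma continuous_rieszWeight_vertical :
    Continuous fun t : ℝ => rieszWeight (2 + t * Complex.I) := by
  unfold rieszWeight
  refine continuous_const.div (by fun_prop) fun t h => ?_
  rcases mul_eq_zero.mp h with h | h
  all_goals
    have := congrArg Complex.re h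
    norm_num at this

lemma verticalIntegrable_rieszWeight : Complex.VerticalIntegrable rieszWeight 2 := by
  refine ((integrable_one_add_abs_rpow one_lt_two).const_mul 8).mono'
    ?_ (MeasureTheory.ae_of_all _ fun t => ?_)
  · simpa using continuous_rieszWeight_vertical.aestronglyMeasurable
  · refine (norm_rieszWeight_le (by norm_num)).trans_eq ?_
    simp

lemma verticalIntegrable_rieszWeight_div :
    Complex.VerticalIntegrable (fun s => rieszWeight s / (s - 1)) 2 := by
  refine verticalIntegrable_rieszWeight.mono ?_ (MeasureTheory.ae_of_all _ fun t => ?_)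
  · refine Continuous.aestronglyMeasurable (Continuous.div ?_ (by fun_prop) fun t h => ?_)
    · simpa using continuous_rieszWeight_vertical
    · have := congrArg Complex.re h
      norm_num at this
  · rw [norm_div]
    refine div_le_self (norm_nonneg _) ?_
    refine le_trans ?_ (Complex.abs_re_le_norm _)
    norm_num

/-- The Mellin inversion formula for `max (1 - x) 0`. -/
lemma mellinInv_rieszWeight {x : ℝ} (hx : 0 < x) :
    mellinInv 2 rieszWeight x = ((max (1 - x) 0 : ℝ) : ℂ) := by
  set k : ℝ → ℂ := fun x => (Set.Ioc (0 : ℝ) 1).indicator (fun _ => 1) x -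
    (Set.Ioc (0 : ℝ) 1).indicator (fun t : ℝ => (t : ℂ) ^ (1 : ℂ)) x with hk
  have hkx : ∀ x : ℝ, 0 < x → k x = ((max (1 - x) 0 : ℝ) : ℂ) := by
    intro x hx
    by_cases h1 : x ≤ 1
    · have : x ∈ Set.Ioc (0 : ℝ) 1 := ⟨hx, h1⟩
      simp [hk, this, max_eq_left (sub_nonneg.mpr h1)]
    · have : x ∉ Set.Ioc (0 : ℝ) 1 := fun h => h1 h.2
      simp [hk, this, max_eq_right (sub_nonpos.mpr (not_le.mp h1).le)]
  have hmel : ∀ s : ℂ, 0 < s.re → HasMellin k s (rieszWeight s) := by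
    intro s hs
    have h1 := hasMellin_one_Ioc hs
    have h2 := hasMellin_cpow_Ioc 1 (s := s) (by simp; linarith)
    have h3 := hasMellin_sub h1.1 h2.1
    refine ⟨h3.1, h3.2.trans ?_⟩
    rw [h1.2, h2.2, rieszWeight]
    have hs0 : s ≠ 0 := by rintro rfl; simp at hs
    have hs1 : s + 1 ≠ 0 := by
      intro h
      have := congrArg Complex.re h
      simp at this
      linarith
    field_simp
    ring
  have hline : ∀ t : ℝ, mellin k ((2 : ℝ) + t * Complex.I) =
      rieszWeight ((2 : ℝ) + t * Complex.I) := fun t => (hmel _ (by simp)).2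
  have hcont : ContinuousAt k x := by
    have : k =ᶠ[𝓝 x] fun x => ((max (1 - x) 0 : ℝ) : ℂ) := by
      filter_upwards [Ioi_mem_nhds hx] with y hy using hkx y hy
    refine ContinuousAt.congr ?_ this.symm
    fun_prop
  have := mellinInv_mellin_eq 2 k hx (hmel _ (by simp)).1
    (by simpa only [Complex.VerticalIntegrable, hline] using verticalIntegrable_rieszWeight) hcont
  rw [← hkx x hx, ← this]
  simp only [mellinInv, hline]

/-- The Mellin inversion formula for `max (1 - x) 0 ^ 2 / (2 x)`. -/
lemma mellinInv_rieszWeight_div {x : ℝ} (hx : 0 < x) :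
    mellinInv 2 (fun s => rieszWeight s / (s - 1)) x =
      ((max (1 - x) 0 ^ 2 / (2 * x) : ℝ) : ℂ) := by
  set k : ℝ → ℂ := fun x => (1 / 2 : ℂ) • ((Set.Ioc (0 : ℝ) 1).indicator
    (fun t : ℝ => (t : ℂ) ^ (-1 : ℂ)) x +
    (Set.Ioc (0 : ℝ) 1).indicator (fun t : ℝ => (t : ℂ) ^ (1 : ℂ)) x) -
    (Set.Ioc (0 : ℝ) 1).indicator (fun _ => 1) x with hk
  have hkx : ∀ x : ℝ, 0 < x → k x = ((max (1 - x) 0 ^ 2 / (2 * x) : ℝ) : ℂ) := by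
    intro x hx
    by_cases h1 : x ≤ 1
    · have : x ∈ Set.Ioc (0 : ℝ) 1 := ⟨hx, h1⟩
      have hx0 : (x : ℂ) ≠ 0 := by exact_mod_cast hx.ne'
      simp only [hk, this, Set.indicator_of_mem, max_eq_left (sub_nonneg.mpr h1),
        Complex.cpow_neg_one, Complex.cpow_one, smul_eq_mul]
      push_cast
      field_simp
      ring
    · have : x ∉ Set.Ioc (0 : ℝ) 1 := fun h => h1 h.2
      simp [hk, this, max_eq_right (sub_nonpos.mpr (not_le.mp h1).le)]
  have hmel : ∀ s : ℂ, 1 < s.re → HasMellin k s (rieszWeight s / (s - 1)) := by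
    intro s hs
    have h1 := hasMellin_one_Ioc (s := s) (by linarith)
    have h2 := hasMellin_cpow_Ioc 1 (s := s) (by simp; linarith)
    have h3 := hasMellin_cpow_Ioc (-1) (s := s) (by simp; linarith)
    have h4 := hasMellin_add h3.1 h2.1
    have h5 := hasMellin_const_smul h4.1 (1 / 2 : ℂ)
    have h6 := hasMellin_sub h5.1 h1.1
    refine ⟨h6.1, h6.2.trans ?_⟩
    rw [h5.2, h4.2, h1.2, h2.2, h3.2, rieszWeight]
    have hs0 : s ≠ 0 := by rintro rfl; simp at hs; linarith
    have hs2 : s - 1 ≠ 0 := by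
      intro h
      have := congrArg Complex.re h
      simp at this
      linarith
    have hs1 : s + 1 ≠ 0 := by
      intro h
      have := congrArg Complex.re h
      simp at this
      linarith
    rw [← sub_eq_add_neg, smul_eq_mul]
    field_simp
    ring
  have hline : ∀ t : ℝ, mellin k ((2 : ℝ) + t * Complex.I) =
      rieszWeight ((2 : ℝ) + t * Complex.I) / ((2 : ℝ) + t * Complex.I - 1) :=
    fun t => (hmel _ (by simp)).2
  have hcont : ContinuousAt k x := by
    have : k =ᶠ[𝓝 x] fun x => ((max (1 - x) 0 ^ 2 / (2 * x) : ℝ) : ℂ) := by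
      filter_upwards [Ioi_mem_nhds hx] with y hy using hkx y hy
    refine ContinuousAt.congr ?_ this.symm
    refine Complex.continuous_ofReal.continuousAt.comp ?_
    exact ContinuousAt.div (by fun_prop) (by fun_prop) (by positivity)
  have := mellinInv_mellin_eq 2 k hx (hmel _ (by simp)).1
    (by simpa only [Complex.VerticalIntegrable, hline] using verticalIntegrable_rieszWeight_div)
    hcont
  rw [← hkx x hx, ← this]
  simp only [mellinInv, hline]

/-- The sum of `Λ n * (y - n)` over `n ≤ y`. -/
noncomputable def psiOne (y : ℝ) : ℝ :=
  ∑ n ∈ Ioc 0 ⌊y⌋₊, ArithmeticFunction.vonMangoldt n * (y - n)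

lemma norm_ofReal_cpow_two_line {x : ℝ} (hx : 0 < x) (t : ℝ) :
    ‖(x : ℂ) ^ (-((2 : ℝ) + t * Complex.I : ℂ))‖ = x ^ (-2 : ℝ) := by
  rw [Complex.norm_cpow_eq_rpow_re_of_pos hx]
  simp

lemma continuous_ofReal_cpow_two_line {x : ℝ} (hx : 0 < x) :
    Continuous fun t : ℝ => (x : ℂ) ^ (-((2 : ℝ) + t * Complex.I : ℂ)) := by
  have hx0 : (x : ℂ) ≠ 0 := by exact_mod_cast hx.ne'
  exact Continuous.const_cpow (by fun_prop) (Or.inl hx0)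

open MeasureTheory in
lemma integrable_cpow_mul_of_verticalIntegrable {x : ℝ} (hx : 0 < x) {g : ℂ → ℂ}
    (hg : Complex.VerticalIntegrable g 2) :
    Integrable fun t : ℝ =>
      (x : ℂ) ^ (-((2 : ℝ) + t * Complex.I : ℂ)) * g ((2 : ℝ) + t * Complex.I) := by
  refine Integrable.bdd_mul (c := x ^ (-2 : ℝ)) hg
    (continuous_ofReal_cpow_two_line hx).aestronglyMeasurable (ae_of_all _ fun t => ?_)
  rw [norm_ofReal_cpow_two_line hx]

lemma div_natCast_cpow_neg {y : ℝ} (hy : 0 < y) (n : ℕ) (s : ℂ) :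
    (((n / y : ℝ) : ℂ)) ^ (-s) = (y : ℂ) ^ s / (n : ℂ) ^ s := by
  have hn0 : (0 : ℝ) ≤ n := n.cast_nonneg
  rw [Complex.cpow_neg, div_eq_mul_inv (n : ℝ) y, Complex.ofReal_mul,
    Complex.mul_cpow_ofReal_nonneg hn0 (by positivity), Complex.ofReal_inv,
    Complex.inv_cpow _ _ (by rw [Complex.arg_ofReal_of_nonneg hy.le]; exact Real.pi_ne_zero.symm)]
  simp [div_eq_mul_inv, mul_comm]

open MeasureTheory ArithmeticFunction in
/-- Perron's formula for the first Riesz mean of the von Mangoldt function. -/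
lemma integral_LSeries_vonMangoldt_mul_rieszWeight {y : ℝ} (hy : 0 < y) :
    (1 / (2 * Real.pi) : ℂ) * ∫ t : ℝ, (y : ℂ) ^ ((2 : ℝ) + t * Complex.I : ℂ) *
      (LSeries (fun n => (vonMangoldt n : ℂ)) ((2 : ℝ) + t * Complex.I) *
        rieszWeight ((2 : ℝ) + t * Complex.I)) = ((psiOne y / y : ℝ) : ℂ) := by
  set F : ℕ → ℝ → ℂ := fun n t => (vonMangoldt n : ℂ) *
    ((((n / y : ℝ) : ℂ)) ^ (-((2 : ℝ) + t * Complex.I : ℂ)) *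
      rieszWeight ((2 : ℝ) + t * Complex.I)) with hF
  have hF0 : F 0 = 0 := by
    funext t
    simp [hF]
  have hint : ∀ n, Integrable (F n) := by
    intro n
    rcases Nat.eq_zero_or_pos n with rfl | hn
    · rw [hF0]
      exact integrable_zero _ _ _
    · exact (integrable_cpow_mul_of_verticalIntegrable (by positivity)
        verticalIntegrable_rieszWeight).const_mul _
  have hnorm : ∀ n, ∫ t, ‖F n t‖ = ‖LSeries.term (fun n => (vonMangoldt n : ℂ)) 2 n‖ *
      (y ^ 2 * ∫ t : ℝ, ‖rieszWeight ((2 : ℝ) + t * Complex.I)‖) := by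
    intro n
    rcases Nat.eq_zero_or_pos n with rfl | hn
    · simp [hF0]
    · have hny : 0 < n / y := by positivity
      simp only [hF, norm_mul, norm_ofReal_cpow_two_line hny]
      rw [integral_const_mul, integral_const_mul, LSeries.norm_term_eq, if_neg hn.ne']
      simp only [Complex.re_ofNat, Real.rpow_ofNat]
      rw [Real.rpow_neg hny.le, Real.rpow_ofNat]
      generalize ∫ t : ℝ, ‖rieszWeight ((2 : ℝ) + t * Complex.I)‖ = J
      field_simp
  have hsum := hasSum_integral_of_summable_integral_norm hint (by
    simp_rw [hnorm]
    exact (LSeriesSummable_vonMangoldt (s := 2) (by simp)).norm.mul_right _)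
  have hterm : ∀ n, (1 / (2 * Real.pi) : ℂ) * ∫ t, F n t =
      ((vonMangoldt n * max (1 - n / y) 0 : ℝ) : ℂ) := by
    intro n
    rcases Nat.eq_zero_or_pos n with rfl | hn
    · simp [hF0]
    · have h := mellinInv_rieszWeight (x := n / y) (by positivity)
      rw [mellinInv] at h
      simp only [hF]
      rw [integral_const_mul, Complex.ofReal_mul, ← h, Complex.real_smul]
      simp only [smul_eq_mul]
      push_cast
      ring
  have htsum : ∀ t : ℝ, ∑' n, F n t = (y : ℂ) ^ ((2 : ℝ) + t * Complex.I : ℂ) *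
      (LSeries (fun n => (vonMangoldt n : ℂ)) ((2 : ℝ) + t * Complex.I) *
        rieszWeight ((2 : ℝ) + t * Complex.I)) := by
    intro t
    rw [LSeries, ← tsum_mul_right, ← tsum_mul_left]
    refine tsum_congr fun n => ?_
    rcases Nat.eq_zero_or_pos n with rfl | hn
    · simp [hF]
    · rw [LSeries.term_of_ne_zero hn.ne']
      simp only [hF]
      rw [div_natCast_cpow_neg hy]
      ring
  have h1 := hsum.mul_left (1 / (2 * Real.pi) : ℂ)
  simp_rw [hterm, htsum] at h1
  refine h1.unique ?_
  have hfin : ∑ n ∈ Ioc 0 ⌊y⌋₊, ((vonMangoldt n * max (1 - n / y) 0 : ℝ) : ℂ) =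
      ((psiOne y / y : ℝ) : ℂ) := by
    rw [← Complex.ofReal_sum, psiOne, sum_div]
    congr 1
    refine sum_congr rfl fun n hn => ?_
    have hny : (n : ℝ) ≤ y := (Nat.le_floor_iff hy.le).mp (mem_Ioc.mp hn).2
    rw [max_eq_left (by rw [sub_nonneg, div_le_one hy]; exact hny)]
    field_simp
  rw [← hfin]
  refine hasSum_sum_of_ne_finset_zero fun n hn => ?_
  rcases Nat.eq_zero_or_pos n with rfl | hn0
  · simp
  · have hny : y < n := by
      by_contra h
      exact hn (mem_Ioc.mpr ⟨hn0, Nat.le_floor (not_lt.mp h)⟩)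
    rw [max_eq_right (by rw [sub_nonpos, one_le_div hy]; exact hny.le)]
    simp

open MeasureTheory ArithmeticFunction in
lemma integrable_cpow_mul_LSeries_vonMangoldt {y : ℝ} (hy : 0 < y) :
    Integrable fun t : ℝ => (y : ℂ) ^ ((2 : ℝ) + t * Complex.I : ℂ) *
      (LSeries (fun n => (vonMangoldt n : ℂ)) ((2 : ℝ) + t * Complex.I) *
        rieszWeight ((2 : ℝ) + t * Complex.I)) := by
  set L : ℝ → ℂ := fun t => LSeries (fun n => (vonMangoldt n : ℂ)) ((2 : ℝ) + t * Complex.I)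
  have hy0 : (y : ℂ) ≠ 0 := by exact_mod_cast hy.ne'
  have hcont : Continuous L := by
    have habs := (LSeriesSummable_vonMangoldt (s := 3 / 2) (by norm_num)).abscissaOfAbsConv_le
    refine (LSeries_differentiableOn _).continuousOn.comp_continuous (by fun_prop) fun t => ?_
    refine habs.trans_lt ?_
    norm_cast
    norm_num
  have hbound : ∀ t, ‖L t‖ ≤ ∑' n, ‖LSeries.term (fun n => (vonMangoldt n : ℂ)) 2 n‖ := by
    intro t
    refine (norm_tsum_le_tsum_norm (LSeriesSummable_vonMangoldt (by simp)).norm).trans_eq ?_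
    simp_rw [LSeries.norm_term_eq]
    simp
  refine Integrable.bdd_mul (c := y ^ (2 : ℝ)) (Integrable.bdd_mul verticalIntegrable_rieszWeight
    hcont.aestronglyMeasurable (ae_of_all _ hbound)) ?_ (ae_of_all _ fun t => ?_)
  · exact (Continuous.const_cpow (by fun_prop) (Or.inl hy0)).aestronglyMeasurable
  · rw [Complex.norm_cpow_eq_rpow_re_of_pos hy]
    simp

lemma neg_logDeriv_riemannZeta₁_eq {s : ℂ} (hs : 1 < s.re) :
    -logDeriv riemannZeta₁ s =
      LSeries (fun n => (ArithmeticFunction.vonMangoldt n : ℂ)) s - 1 / (s - 1) := by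
  have hs1 : s ≠ 1 := by rintro rfl; simp at hs
  have hs1' : s - 1 ≠ 0 := sub_ne_zero.mpr hs1
  have heq : riemannZeta₁ =ᶠ[𝓝 s] fun z => (z - 1) * riemannZeta z := by
    filter_upwards [isOpen_ne.mem_nhds hs1] with z hz using riemannZeta₁_eq_mul hz
  have hz0 : riemannZeta s ≠ 0 := riemannZeta_ne_zero_of_one_lt_re hs
  rw [ArithmeticFunction.LSeries_vonMangoldt_eq_deriv_riemannZeta_div hs, logDeriv_apply,
    heq.deriv_eq, heq.eq_of_nhds,
    deriv_fun_mul (by fun_prop) (differentiableAt_riemannZeta hs1)]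
  simp only [deriv_sub_const, deriv_id'']
  field_simp
  ring

/-- The integrand of the explicit formula for `psiOne`. -/
noncomputable def perronIntegrand (y : ℝ) (s : ℂ) : ℂ :=
  -logDeriv riemannZeta₁ s * ((y : ℂ) ^ (s + 1) * rieszWeight s)

open MeasureTheory in
lemma integral_perronIntegrand {y : ℝ} (hy : 1 ≤ y) :
    ∫ t : ℝ, perronIntegrand y ((2 : ℝ) + t * Complex.I) =
      (2 * Real.pi) * ((psiOne y - (y - 1) ^ 2 / 2 : ℝ) : ℂ) := by
  have hy0 : 0 < y := by linarith
  have hyc : (y : ℂ) ≠ 0 := by exact_mod_cast hy0.ne'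
  have hpi : (Real.pi : ℂ) ≠ 0 := by exact_mod_cast Real.pi_ne_zero
  have h1 := integral_LSeries_vonMangoldt_mul_rieszWeight hy0
  have h2 := mellinInv_rieszWeight_div (x := y⁻¹) (by positivity)
  have hinv : ∀ s : ℂ, ((y⁻¹ : ℝ) : ℂ) ^ (-s) = (y : ℂ) ^ s := by
    intro s
    rw [Complex.ofReal_inv, Complex.cpow_neg,
      Complex.inv_cpow _ _ (by
        rw [Complex.arg_ofReal_of_nonneg hy0.le]; exact Real.pi_ne_zero.symm),
      inv_inv]
  have hint2 := integrable_cpow_mul_of_verticalIntegrable (x := y⁻¹) (by positivity)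
    verticalIntegrable_rieszWeight_div
  rw [mellinInv] at h2
  simp_rw [hinv] at h2 hint2
  have hint1 : Integrable fun t : ℝ => (y : ℂ) ^ ((2 : ℝ) + t * Complex.I : ℂ) *
      (LSeries (fun n => (ArithmeticFunction.vonMangoldt n : ℂ)) ((2 : ℝ) + t * Complex.I) *
        rieszWeight ((2 : ℝ) + t * Complex.I)) := by
    exact integrable_cpow_mul_LSeries_vonMangoldt hy0
  have heq : ∀ t : ℝ, perronIntegrand y ((2 : ℝ) + t * Complex.I) =
      y * ((y : ℂ) ^ ((2 : ℝ) + t * Complex.I : ℂ) *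
      (LSeries (fun n => (ArithmeticFunction.vonMangoldt n : ℂ)) ((2 : ℝ) + t * Complex.I) *
        rieszWeight ((2 : ℝ) + t * Complex.I)) - (y : ℂ) ^ ((2 : ℝ) + t * Complex.I : ℂ) *
        (rieszWeight ((2 : ℝ) + t * Complex.I) / ((2 : ℝ) + t * Complex.I - 1))) := by
    intro t
    rw [perronIntegrand, neg_logDeriv_riemannZeta₁_eq (by simp), Complex.cpow_add _ _ hyc,
      Complex.cpow_one]
    ring
  simp_rw [heq]
  rw [integral_const_mul, integral_sub hint1 hint2]
  have h1' : ∫ t : ℝ, (y : ℂ) ^ ((2 : ℝ) + t * Complex.I : ℂ) *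
      (LSeries (fun n => (ArithmeticFunction.vonMangoldt n : ℂ)) ((2 : ℝ) + t * Complex.I) *
        rieszWeight ((2 : ℝ) + t * Complex.I)) =
      2 * Real.pi * ((psiOne y / y : ℝ) : ℂ) := by
    rw [← h1, ← mul_assoc, mul_one_div_cancel (by simp), one_mul]
  rw [Complex.real_smul] at h2
  simp only [smul_eq_mul] at h2
  rw [h1']
  have h3 : ∀ I c : ℂ, ((1 / (2 * Real.pi) : ℝ) : ℂ) * I = c → I = 2 * Real.pi * c := by
    intro I c h
    rw [← h]; push_cast; field_simp
  rw [h3 _ _ h2, max_eq_left (by rw [sub_nonneg]; exact inv_le_one_of_one_le₀ hy)]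
  push_cast
  field_simp

open MeasureTheory in
/-- Moving a vertical line of integration through a strip. -/
lemma integral_vertical_line_eq {g : ℂ → ℂ} {a b C r : ℝ} (hab : a ≤ b) (hr : 1 < r)
    (hg : DifferentiableOn ℂ g {s | a ≤ s.re ∧ s.re ≤ b})
    (hC : ∀ s : ℂ, a ≤ s.re → s.re ≤ b → ‖g s‖ ≤ C * (1 + |s.im|) ^ (-r)) :
    ∫ t : ℝ, g (a + t * Complex.I) = ∫ t : ℝ, g (b + t * Complex.I) := by
  have hint : ∀ c, a ≤ c → c ≤ b → Integrable fun t : ℝ => g (c + t * Complex.I) := by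
    intro c hac hcb
    refine ((integrable_one_add_abs_rpow hr).const_mul C).mono' ?_ (ae_of_all _ fun t => ?_)
    · refine (hg.continuousOn.comp_continuous (by fun_prop) fun t => ?_).aestronglyMeasurable
      simp [hac, hcb]
    · simpa using hC (c + t * Complex.I) (by simpa) (by simpa)
  have hlim : ∀ c, a ≤ c → c ≤ b → Tendsto (fun T : ℝ => ∫ t in (-T)..T, g (c + t * Complex.I))
      atTop (𝓝 (∫ t : ℝ, g (c + t * Complex.I))) := fun c hac hcb =>
    intervalIntegral_tendsto_integral (hint c hac hcb) tendsto_neg_atTop_atBot tendsto_id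
  have hdiff := (hlim b hab le_rfl).sub (hlim a le_rfl hab)
  have hzero : Tendsto (fun T : ℝ => (∫ t in (-T)..T, g (b + t * Complex.I)) -
      ∫ t in (-T)..T, g (a + t * Complex.I)) atTop (𝓝 0) := by
    have hbound : Tendsto (fun T : ℝ => 2 * (C * (1 + T) ^ (-r) * |b - a|)) atTop (𝓝 0) := by
      have h1 : Tendsto (fun T : ℝ => (1 + T) ^ (-r)) atTop (𝓝 0) :=
        (tendsto_rpow_neg_atTop (by linarith)).comp (tendsto_atTop_add_const_left _ 1 tendsto_id)
      simpa using ((h1.const_mul C).mul_const |b - a|).const_mul 2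
    refine squeeze_zero_norm' ?_ hbound
    filter_upwards [eventually_ge_atTop 0] with T hT
    have hrect := Complex.integral_boundary_rect_eq_zero_of_differentiableOn g
      (⟨a, -T⟩ : ℂ) (⟨b, T⟩ : ℂ) (hg.mono fun s hs => by
        have := hs.1
        simpa [Set.uIcc_of_le hab] using this)
    have hside : ∀ τ : ℝ, |τ| = T →
        ‖∫ x in a..b, g (x + τ * Complex.I)‖ ≤ C * (1 + T) ^ (-r) * |b - a| := by
      intro τ hτ
      refine intervalIntegral.norm_integral_le_of_norm_le_const fun x hx => ?_
      rw [Set.uIoc_of_le hab] at hx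
      simpa [hτ] using hC (x + τ * Complex.I) (by simpa using hx.1.le) (by simpa using hx.2)
    have h1 := hside (-T) (by rw [abs_neg, abs_of_nonneg hT])
    have h2 := hside T (abs_of_nonneg hT)
    simp only [smul_eq_mul] at hrect
    have h3 : Complex.I * ((∫ t in (-T)..T, g (b + t * Complex.I)) -
        ∫ t in (-T)..T, g (a + t * Complex.I)) =
        (∫ x in a..b, g (x + T * Complex.I)) - ∫ x in a..b, g (x + (-T : ℝ) * Complex.I) := by
      linear_combination hrect
    have h4 := congrArg norm h3
    rw [norm_mul, Complex.norm_I, one_mul] at h4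
    rw [h4]
    refine (norm_sub_le _ _).trans ?_
    linarith
  have := tendsto_nhds_unique hdiff hzero
  exact (sub_eq_zero.mp this).symm

lemma RiemannHypothesis'.differentiableOn_perronIntegrand (hRH : RiemannHypothesis') {y a : ℝ}
    (hy : 0 < y) (ha : 1 / 2 < a) :
    DifferentiableOn ℂ (perronIntegrand y) {s | a ≤ s.re ∧ s.re ≤ 2} := by
  intro s hs
  have hre : 1 / 2 < s.re := ha.trans_le hs.1
  have hyc : (y : ℂ) ≠ 0 := by exact_mod_cast hy.ne'
  have hs0 : s ≠ 0 := by rintro rfl; simp at hre; linarith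
  have hs1 : s + 1 ≠ 0 := by
    intro h
    have := congrArg Complex.re h
    simp at this
    linarith
  have hlog : DifferentiableAt ℂ (logDeriv riemannZeta₁) s :=
    ((differentiable_riemannZeta₁.contDiff (n := 2)).differentiable_deriv_two s).div
      (differentiable_riemannZeta₁ s) (hRH.riemannZeta₁_ne_zero hre)
  have hw : DifferentiableAt ℂ rieszWeight s := by
    unfold rieszWeight
    exact (differentiableAt_const _).div (by fun_prop) (mul_ne_zero hs0 hs1)
  have hpow : DifferentiableAt ℂ (fun z : ℂ => (y : ℂ) ^ (z + 1)) s :=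
    DifferentiableAt.const_cpow (by fun_prop) (Or.inl hyc)
  exact (hlog.neg.mul (hpow.mul hw)).differentiableWithinAt

lemma norm_cpow_add_one_sub_le_mul {x H : ℝ} (hx : 0 < x) (hH : 0 ≤ H) (hHx : H ≤ x) {s : ℂ}
    (hs : 0 ≤ s.re) (hs1 : s.re ≤ 1) :
    ‖((x + H : ℝ) : ℂ) ^ (s + 1) - (x : ℂ) ^ (s + 1)‖ ≤ 8 * ((1 + |s.im|) * H * x ^ s.re) := by
  have hs' : s + 1 ≠ 0 := by
    intro h
    have := congrArg Complex.re h
    simp at this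
    linarith
  have hder : ∀ u ∈ Set.Icc x (x + H), HasDerivWithinAt (fun u : ℝ => (u : ℂ) ^ (s + 1))
      ((s + 1) * (u : ℂ) ^ s) (Set.Icc x (x + H)) u := by
    intro u hu
    have hu0 : 0 < u := hx.trans_le hu.1
    simpa using (hasDerivAt_ofReal_cpow_const hu0.ne' hs').hasDerivWithinAt
  have hbound : ∀ u ∈ Set.Ico x (x + H), ‖(s + 1) * (u : ℂ) ^ s‖ ≤
      8 * ((1 + |s.im|) * x ^ s.re) := by
    intro u hu
    have hu0 : 0 < u := hx.trans_le hu.1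
    rw [norm_mul, Complex.norm_cpow_eq_rpow_re_of_pos hu0]
    have h1 : ‖s + 1‖ ≤ 2 * (1 + |s.im|) := by
      refine (Complex.norm_le_abs_re_add_abs_im _).trans ?_
      simp only [Complex.add_re, Complex.one_re, Complex.add_im, Complex.one_im, add_zero]
      rw [abs_of_nonneg (by linarith)]
      linarith [abs_nonneg s.im]
    have h2 : u ^ s.re ≤ 2 * x ^ s.re := by
      calc u ^ s.re ≤ (2 * x) ^ s.re := by
            gcongr
            linarith [hu.2]
        _ = 2 ^ s.re * x ^ s.re := Real.mul_rpow (by norm_num) hx.le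
        _ ≤ 2 ^ (1 : ℝ) * x ^ s.re := by gcongr; norm_num
        _ = 2 * x ^ s.re := by rw [Real.rpow_one]
    calc ‖s + 1‖ * u ^ s.re ≤ 2 * (1 + |s.im|) * (2 * x ^ s.re) := by gcongr
      _ ≤ 8 * ((1 + |s.im|) * x ^ s.re) := by
        have : 0 ≤ (1 + |s.im|) * x ^ s.re := by positivity
        linarith
  have := norm_image_sub_le_of_norm_deriv_le_segment' hder hbound (x + H)
    (Set.right_mem_Icc.mpr (by linarith))
  refine this.trans_eq ?_
  ring

lemma norm_cpow_add_one_sub_le {x H : ℝ} (hx : 0 < x) (hH : 0 ≤ H) (hHx : H ≤ x) {s : ℂ}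
    (hs : 0 ≤ s.re) (hs1 : s.re ≤ 1) :
    ‖((x + H : ℝ) : ℂ) ^ (s + 1) - (x : ℂ) ^ (s + 1)‖ ≤ 8 * x ^ (s.re + 1) := by
  refine (norm_sub_le _ _).trans ?_
  rw [Complex.norm_cpow_eq_rpow_re_of_pos (by linarith), Complex.norm_cpow_eq_rpow_re_of_pos hx]
  simp only [Complex.add_re, Complex.one_re]
  have h2 : (x + H) ^ (s.re + 1) ≤ 4 * x ^ (s.re + 1) := by
    calc (x + H) ^ (s.re + 1) ≤ (2 * x) ^ (s.re + 1) := by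
          gcongr
          linarith
      _ = 2 ^ (s.re + 1) * x ^ (s.re + 1) := Real.mul_rpow (by norm_num) hx.le
      _ ≤ 2 ^ (2 : ℝ) * x ^ (s.re + 1) := by gcongr <;> linarith
      _ = 4 * x ^ (s.re + 1) := by norm_num
  have : 0 ≤ x ^ (s.re + 1) := by positivity
  linarith

lemma le_rpow_mul_rpow {D A B θ : ℝ} (hD : 0 ≤ D) (hA : D ≤ A) (hB : D ≤ B) (hθ : 0 ≤ θ)
    (hθ1 : θ ≤ 1) : D ≤ A ^ (1 - θ) * B ^ θ := by
  calc D = D ^ (1 - θ) * D ^ θ := by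
        rw [← Real.rpow_add_of_nonneg hD (by linarith) hθ]
        simp
    _ ≤ A ^ (1 - θ) * B ^ θ := by
        have := hD.trans hA
        gcongr

lemma norm_cpow_add_one_sub_le_interpolated {x H θ : ℝ} (hx : 0 < x) (hH : 1 ≤ H) (hHx : H ≤ x)
    (hθ : 0 ≤ θ) (hθ1 : θ ≤ 1) {s : ℂ} (hs : 0 ≤ s.re) (hs1 : s.re ≤ 1) :
    ‖((x + H : ℝ) : ℂ) ^ (s + 1) - (x : ℂ) ^ (s + 1)‖ ≤
      8 * (H * x ^ (s.re + θ) * (1 + |s.im|) ^ (1 - θ)) := by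
  have hH0 : 0 ≤ H := by linarith
  have ht : 0 < 1 + |s.im| := by positivity
  refine (le_rpow_mul_rpow (norm_nonneg _) (norm_cpow_add_one_sub_le_mul hx hH0 hHx hs hs1)
    (norm_cpow_add_one_sub_le hx hH0 hHx hs hs1) hθ hθ1).trans ?_
  have hxs : 0 < x ^ s.re := by positivity
  rw [Real.mul_rpow (by norm_num) (by positivity),
    Real.mul_rpow (y := x ^ s.re) (by positivity) hxs.le,
    Real.mul_rpow (x := 8) (y := x ^ (s.re + 1)) (by norm_num) (by positivity),
    Real.mul_rpow ht.le hH0, ← Real.rpow_mul hx.le, ← Real.rpow_mul hx.le]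
  have h8 : (8 : ℝ) ^ (1 - θ) * 8 ^ θ = 8 := by
    rw [← Real.rpow_add (by norm_num)]; simp
  have hxx : x ^ (s.re * (1 - θ)) * x ^ ((s.re + 1) * θ) = x ^ (s.re + θ) := by
    rw [← Real.rpow_add hx]; ring_nf
  have hHH : H ^ (1 - θ) ≤ H := Real.rpow_le_self_of_one_le hH (by linarith)
  calc _ = (8 ^ (1 - θ) * 8 ^ θ) * (H ^ (1 - θ) *
        (x ^ (s.re * (1 - θ)) * x ^ ((s.re + 1) * θ)) * (1 + |s.im|) ^ (1 - θ)) := by ring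
    _ ≤ _ := by
      rw [h8, hxx]
      gcongr

open MeasureTheory in
lemma RiemannHypothesis'.exists_abs_psiOne_sub_le (hRH : RiemannHypothesis') {σ θ : ℝ}
    (hσ : 1 / 2 < σ) (hσ1 : σ ≤ 1) (hθ : 0 < θ) (hθ1 : θ ≤ 1) :
    ∃ C : ℝ, ∀ x H : ℝ, 1 ≤ H → H ≤ x →
      |(psiOne (x + H) - (x + H - 1) ^ 2 / 2) - (psiOne x - (x - 1) ^ 2 / 2)| ≤
        C * (H * x ^ (σ + θ)) := by
  obtain ⟨C, hC0, hC⟩ := hRH.exists_norm_logDeriv_riemannZeta₁_le hσ (half_pos hθ)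
  have hweight : ∀ s : ℂ, σ ≤ s.re → s.re ≤ 2 → ‖logDeriv riemannZeta₁ s‖ * ‖rieszWeight s‖ ≤
      8 * C * (1 + |s.im|) ^ (-(2 - θ / 2)) := by
    intro s h1 h2
    have hpos : 0 < 1 + |s.im| := by positivity
    calc _ ≤ C * (1 + |s.im|) ^ (θ / 2) * (8 * (1 + |s.im|) ^ (-2 : ℝ)) :=
          mul_le_mul (hC s h1 h2) (norm_rieszWeight_le (hσ.le.trans h1)) (norm_nonneg _)
            (by positivity)
      _ = 8 * C * ((1 + |s.im|) ^ (θ / 2) * (1 + |s.im|) ^ (-2 : ℝ)) := by ring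
      _ = _ := by rw [← Real.rpow_add hpos]; ring_nf
  have hbound : ∀ y : ℝ, 1 ≤ y → ∀ s : ℂ, σ ≤ s.re → s.re ≤ 2 →
      ‖perronIntegrand y s‖ ≤ y ^ (3 : ℝ) * (8 * C) * (1 + |s.im|) ^ (-(2 - θ / 2)) := by
    intro y hy s h1 h2
    rw [perronIntegrand, norm_mul, norm_mul, norm_neg,
      Complex.norm_cpow_eq_rpow_re_of_pos (by linarith)]
    calc _ = y ^ (s + 1).re * (‖logDeriv riemannZeta₁ s‖ * ‖rieszWeight s‖) := by ring
      _ ≤ y ^ (3 : ℝ) * (8 * C * (1 + |s.im|) ^ (-(2 - θ / 2))) := by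
        refine mul_le_mul (Real.rpow_le_rpow_of_exponent_le hy ?_) (hweight s h1 h2)
          (by positivity) (by positivity)
        simp only [Complex.add_re, Complex.one_re]
        linarith
      _ = _ := by ring
  have hr : 1 < 2 - θ / 2 := by linarith
  have hline : ∀ y : ℝ, 1 ≤ y → ∫ t : ℝ, perronIntegrand y (σ + t * Complex.I) =
      (2 * Real.pi) * ((psiOne y - (y - 1) ^ 2 / 2 : ℝ) : ℂ) := by
    intro y hy
    rw [← integral_perronIntegrand hy]
    exact integral_vertical_line_eq (by linarith) hr
      (hRH.differentiableOn_perronIntegrand (by linarith) hσ) (hbound y hy)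
  have hint : ∀ y : ℝ, 1 ≤ y → Integrable fun t : ℝ => perronIntegrand y (σ + t * Complex.I) := by
    intro y hy
    refine ((integrable_one_add_abs_rpow hr).const_mul (y ^ (3 : ℝ) * (8 * C))).mono' ?_
      (ae_of_all _ fun t => ?_)
    · refine ((hRH.differentiableOn_perronIntegrand (by linarith) hσ).continuousOn.comp_continuous
        (by fun_prop) fun t => ?_).aestronglyMeasurable
      simp
      linarith
    · simpa using hbound y hy (σ + t * Complex.I) (by simp) (by simp; linarith)
  set J : ℝ := ∫ t : ℝ, (1 + |t|) ^ (-(1 + θ / 2)) with hJ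
  refine ⟨64 * C * J, fun x H hH hHx => ?_⟩
  have hx : 1 ≤ x := hH.trans hHx
  have hx0 : 0 < x := by linarith
  have hdiff := integral_sub (hint (x + H) (by linarith)) (hint x hx)
  rw [hline _ (by linarith), hline x hx, ← mul_sub, ← Complex.ofReal_sub] at hdiff
  have hpt : ∀ t : ℝ, ‖perronIntegrand (x + H) (σ + t * Complex.I) -
      perronIntegrand x (σ + t * Complex.I)‖ ≤
      64 * C * (H * x ^ (σ + θ)) * (1 + |t|) ^ (-(1 + θ / 2)) := by
    intro t
    set s : ℂ := σ + t * Complex.I with hs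
    have hre : s.re = σ := by simp [hs]
    have him : s.im = t := by simp [hs]
    have hpos : 0 < 1 + |t| := by positivity
    have h1 := norm_cpow_add_one_sub_le_interpolated hx0 hH hHx hθ.le hθ1 (s := s)
      (by linarith) (by linarith)
    have h2 := hweight s hre.ge (by linarith)
    rw [hre, him] at h1
    rw [him] at h2
    calc _ = ‖((x + H : ℝ) : ℂ) ^ (s + 1) - (x : ℂ) ^ (s + 1)‖ *
          (‖logDeriv riemannZeta₁ s‖ * ‖rieszWeight s‖) := by
          rw [← norm_mul, ← norm_mul, ← norm_neg, perronIntegrand, perronIntegrand]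
          congr 1
          ring
      _ ≤ 8 * (H * x ^ (σ + θ) * (1 + |t|) ^ (1 - θ)) *
          (8 * C * (1 + |t|) ^ (-(2 - θ / 2))) := by
          gcongr
      _ = 64 * C * (H * x ^ (σ + θ)) *
          ((1 + |t|) ^ (1 - θ) * (1 + |t|) ^ (-(2 - θ / 2))) := by ring
      _ = _ := by rw [← Real.rpow_add hpos]; ring_nf
  have hnorm := norm_integral_le_of_norm_le
    ((integrable_one_add_abs_rpow (r := 1 + θ / 2) (by linarith)).const_mul
      (64 * C * (H * x ^ (σ + θ)))) (ae_of_all _ hpt)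
  rw [hdiff, integral_const_mul, norm_mul, Complex.norm_real, ← hJ, Real.norm_eq_abs] at hnorm
  have h2pi : 1 ≤ ‖(2 * Real.pi : ℂ)‖ := by
    rw [norm_mul, Complex.norm_real, Real.norm_of_nonneg Real.pi_pos.le, Complex.norm_ofNat]
    linarith [Real.pi_gt_three]
  calc _ ≤ ‖(2 * Real.pi : ℂ)‖ * _ := le_mul_of_one_le_left (abs_nonneg _) h2pi
    _ ≤ _ := hnorm
    _ = _ := by ring

lemma mul_psi_le_psiOne_sub {x H : ℝ} (hx : 0 ≤ x) (hH : 0 ≤ H) :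
    H * Chebyshev.psi x ≤ psiOne (x + H) - psiOne x := by
  have hsub : Ioc 0 ⌊x⌋₊ ⊆ Ioc 0 ⌊x + H⌋₊ := Ioc_subset_Ioc_right (Nat.floor_mono (by linarith))
  have h1 : ∑ n ∈ Ioc 0 ⌊x⌋₊, ArithmeticFunction.vonMangoldt n * (x + H - n) ≤
      psiOne (x + H) := by
    refine sum_le_sum_of_subset_of_nonneg hsub fun n hn _ => ?_
    have : (n : ℝ) ≤ x + H := (Nat.le_floor_iff (by linarith)).mp (mem_Ioc.mp hn).2
    exact mul_nonneg ArithmeticFunction.vonMangoldt_nonneg (by linarith)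
  have h2 : ∑ n ∈ Ioc 0 ⌊x⌋₊, ArithmeticFunction.vonMangoldt n * (x + H - n) =
      psiOne x + H * Chebyshev.psi x := by
    rw [psiOne, Chebyshev.psi, mul_sum, ← sum_add_distrib]
    exact sum_congr rfl fun n _ => by ring
  linarith

lemma psiOne_sub_le_mul_psi {x H : ℝ} (hx : 0 ≤ x) (hH : 0 ≤ H) :
    psiOne (x + H) - psiOne x ≤ H * Chebyshev.psi (x + H) := by
  have hsub : Ioc 0 ⌊x⌋₊ ⊆ Ioc 0 ⌊x + H⌋₊ := Ioc_subset_Ioc_right (Nat.floor_mono (by linarith))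
  have h1 : ∑ n ∈ Ioc 0 ⌊x + H⌋₊, ArithmeticFunction.vonMangoldt n * (x - n) ≤ psiOne x := by
    rw [psiOne, ← sum_sdiff hsub]
    refine add_le_of_nonpos_left (sum_nonpos fun n hn => ?_)
    rw [Finset.mem_sdiff, mem_Ioc, mem_Ioc] at hn
    have hn' : ⌊x⌋₊ < n := by
      by_contra h
      exact hn.2 ⟨hn.1.1, not_lt.mp h⟩
    have : x < n := (Nat.floor_lt hx).mp hn'
    exact mul_nonpos_of_nonneg_of_nonpos ArithmeticFunction.vonMangoldt_nonneg (by linarith)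
  have h2 : ∑ n ∈ Ioc 0 ⌊x + H⌋₊, ArithmeticFunction.vonMangoldt n * (x - n) +
      H * Chebyshev.psi (x + H) = psiOne (x + H) := by
    rw [psiOne, Chebyshev.psi, mul_sum, ← sum_add_distrib]
    exact sum_congr rfl fun n _ => by ring
  linarith

/-- Under the Riemann hypothesis, `ψ x = x + O(x ^ κ)` for every `κ > 1 / 2`. -/
lemma RiemannHypothesis'.exists_abs_psi_sub_le (hRH : RiemannHypothesis') {κ : ℝ}
    (hκ : 1 / 2 < κ) (hκ1 : κ ≤ 1) :
    ∃ C : ℝ, ∀ x : ℝ, 4 ≤ x → |Chebyshev.psi x - x| ≤ C * x ^ κ := by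
  obtain ⟨C, hC⟩ := hRH.exists_abs_psiOne_sub_le (σ := 1 / 2 + (κ - 1 / 2) / 2)
    (θ := (κ - 1 / 2) / 2) (by linarith) (by linarith) (by linarith) (by linarith)
  have hexp : 1 / 2 + (κ - 1 / 2) / 2 + (κ - 1 / 2) / 2 = κ := by ring
  rw [hexp] at hC
  refine ⟨|C| + 2, fun x hx => ?_⟩
  have hx0 : 0 ≤ x := by linarith
  set H : ℝ := √x with hH
  have hH2 : 2 ≤ H := Real.le_sqrt_of_sq_le (by linarith)
  have hHsq : H * H = x := Real.mul_self_sqrt hx0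
  have hHx : H ≤ x - H := by nlinarith
  have hHκ : H ≤ x ^ κ := by
    rw [hH, Real.sqrt_eq_rpow]
    exact Real.rpow_le_rpow_of_exponent_le (by linarith) hκ.le
  have hup := (abs_le.mp (hC x H (by linarith) (by linarith))).2
  have hlow := (abs_le.mp (hC (x - H) H (by linarith) hHx)).1
  have hup' := mul_psi_le_psiOne_sub hx0 (H := H) (by linarith)
  have hlow' := psiOne_sub_le_mul_psi (x := x - H) (H := H) (by linarith) (by linarith)
  have hxH : 0 ≤ x - H := by linarith
  have hmono : C * (H * (x - H) ^ κ) ≤ H * (|C| * x ^ κ) := by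
    calc C * (H * (x - H) ^ κ) ≤ |C| * (H * x ^ κ) := by
          gcongr
          · exact le_abs_self C
          · linarith
      _ = _ := by ring
  have hCx : C * (H * x ^ κ) ≤ H * (|C| * x ^ κ) := by
    calc C * (H * x ^ κ) ≤ |C| * (H * x ^ κ) := by
          gcongr
          exact le_abs_self C
      _ = _ := by ring
  rw [sub_add_cancel] at hlow hlow'
  have hHpos : 0 < H := by linarith
  rw [abs_le]
  constructor
  · have : H * (x - 1 - H / 2 - |C| * x ^ κ) ≤ H * Chebyshev.psi x := by nlinarith
    have := le_of_mul_le_mul_left this hHpos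
    linarith
  · have : H * Chebyshev.psi x ≤ H * (x - 1 + H / 2 + |C| * x ^ κ) := by nlinarith
    have := le_of_mul_le_mul_left this hHpos
    linarith

/-- Under the Riemann hypothesis, `θ x = x + O(x ^ κ)` for every `κ > 1 / 2`. -/
lemma RiemannHypothesis'.exists_abs_theta_sub_le (hRH : RiemannHypothesis') {κ : ℝ}
    (hκ : 1 / 2 < κ) (hκ1 : κ ≤ 1) :
    ∃ C : ℝ, 0 ≤ C ∧ ∀ x : ℝ, 4 ≤ x → |Chebyshev.theta x - x| ≤ C * x ^ κ := by
  obtain ⟨C, hC⟩ := hRH.exists_abs_psi_sub_le hκ hκ1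
  obtain ⟨B, hB⟩ := Chebyshev.psi_sub_theta_le_mul_sqrt
  refine ⟨|C| + |B|, by positivity, fun x hx => ?_⟩
  have h1 := abs_le.mp (hC x hx)
  have h2 := hB x
  have h3 := Chebyshev.theta_le_psi x
  have hsqrt : √x ≤ x ^ κ := by
    rw [Real.sqrt_eq_rpow]
    exact Real.rpow_le_rpow_of_exponent_le (by linarith) hκ.le
  have h4 : B * √x ≤ |B| * x ^ κ := by
    gcongr
    exact le_abs_self B
  have h5 : C * x ^ κ ≤ |C| * x ^ κ := by
    gcongr
    exact le_abs_self C
  have h6 : 0 ≤ |B| * x ^ κ := by positivity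
  rw [abs_le]
  constructor <;> linarith

/-- The primes between `a` and `b`. -/
noncomputable def primesBetween (a b : ℝ) : Finset ℕ :=
  (Finset.range (Nat.floor b + 1)).filter (fun p : ℕ => p.Prime ∧ a ≤ (p : ℝ) ∧ (p : ℝ) ≤ b)

lemma mem_primesBetween {a b : ℝ} {p : ℕ} :
    p ∈ primesBetween a b ↔ p.Prime ∧ a ≤ (p : ℝ) ∧ (p : ℝ) ≤ b := by
  rw [primesBetween, mem_filter, mem_range, Nat.lt_succ_iff, and_iff_right_iff_imp]
  exact fun h => Nat.le_floor h.2.2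

lemma theta_add_sum_log {x y : ℝ} (hxy : x ≤ y) :
    Chebyshev.theta x + ∑ p ∈ (Ioc ⌊x⌋₊ ⌊y⌋₊).filter Nat.Prime, Real.log p =
      Chebyshev.theta y := by
  rw [Chebyshev.theta, Chebyshev.theta, ← sum_union, ← filter_union,
    Ioc_union_Ioc_eq_Ioc (Nat.zero_le _) (Nat.floor_mono hxy)]
  exact disjoint_filter_filter (Ioc_disjoint_Ioc_of_le le_rfl)

lemma theta_sub_le_sum_log {a b : ℝ} (ha : 1 ≤ a) (hab : a ≤ b) :
    Chebyshev.theta b - Chebyshev.theta a ≤ ∑ p ∈ primesBetween a b, Real.log p := by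
  rw [← theta_add_sum_log hab, add_sub_cancel_left]
  refine sum_le_sum_of_subset_of_nonneg (fun p hp => ?_) fun p _ _ => Real.log_natCast_nonneg p
  rw [mem_filter, mem_Ioc] at hp
  exact mem_primesBetween.mpr ⟨hp.2, ((Nat.floor_lt (by linarith)).mp hp.1.1).le,
    (Nat.le_floor_iff (by linarith)).mp hp.1.2⟩

lemma sum_log_le_theta_sub {a b : ℝ} (ha : 1 ≤ a) (hab : a ≤ b) :
    ∑ p ∈ primesBetween a b, Real.log p ≤ Chebyshev.theta b - Chebyshev.theta (a - 1) := by
  rw [← theta_add_sum_log (x := a - 1) (y := b) (by linarith), add_sub_cancel_left]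
  refine sum_le_sum_of_subset_of_nonneg (fun p hp => ?_) fun p _ _ => Real.log_natCast_nonneg p
  rw [mem_primesBetween] at hp
  rw [mem_filter, mem_Ioc]
  exact ⟨⟨(Nat.floor_lt (by linarith)).mpr (by linarith), Nat.le_floor hp.2.2⟩, hp.1⟩

/-- Under the Riemann hypothesis, the primes in the short interval `[ηX, ηX + X ^ δ]` have the
expected logarithmic density. -/
lemma RiemannHypothesis'.tendsto_sum_log_div (hRH : RiemannHypothesis') {η δ : ℝ} (hη : 0 < η)
    (hδ : δ ∈ Set.Ioo (1 / 2 : ℝ) 1) :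
    Tendsto (fun X : ℝ => (∑ p ∈ primesBetween (η * X) (η * X + X ^ δ), Real.log p) / X ^ δ)
      atTop (𝓝 1) := by
  obtain ⟨κ, hκ, hκδ⟩ := exists_between hδ.1
  have hκ0 : 0 < κ := by linarith
  obtain ⟨C, hC0, hC⟩ := hRH.exists_abs_theta_sub_le hκ (hκδ.le.trans hδ.2.le)
  set M : ℝ := 2 * C * (η + 1) ^ κ + 1 with hM
  have hlim : Tendsto (fun X : ℝ => M * X ^ (κ - δ)) atTop (𝓝 0) := by
    have := (tendsto_rpow_neg_atTop (y := δ - κ) (by linarith)).const_mul M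
    simpa using this
  rw [← tendsto_sub_nhds_zero_iff]
  refine squeeze_zero_norm' ?_ hlim
  filter_upwards [eventually_ge_atTop 1, eventually_ge_atTop (5 / η)] with X hX hXη
  have hX0 : 0 < X := by linarith
  have ha : 5 ≤ η * X := by
    rw [div_le_iff₀ hη] at hXη
    linarith
  have hXδ : 0 < X ^ δ := by positivity
  have hXδ' : X ^ δ ≤ X := Real.rpow_le_self_of_one_le hX hδ.2.le
  have hκ1 : 1 ≤ X ^ κ := Real.one_le_rpow hX hκ0.le
  have hb : ∀ y, 4 ≤ y → y ≤ η * X + X ^ δ →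
      |Chebyshev.theta y - y| ≤ C * (η + 1) ^ κ * X ^ κ := by
    intro y hy hyb
    refine (hC y hy).trans ?_
    rw [mul_assoc, ← Real.mul_rpow (by linarith) hX0.le]
    gcongr
    linarith
  have hlow := theta_sub_le_sum_log (a := η * X) (b := η * X + X ^ δ) (by linarith) (by linarith)
  have hup := sum_log_le_theta_sub (a := η * X) (b := η * X + X ^ δ) (by linarith) (by linarith)
  have h1 := abs_le.mp (hb (η * X + X ^ δ) (by linarith) le_rfl)
  have h2 := abs_le.mp (hb (η * X) (by linarith) (by linarith))
  have h3 := abs_le.mp (hb (η * X - 1) (by linarith) (by linarith))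
  generalize (∑ p ∈ primesBetween (η * X) (η * X + X ^ δ), Real.log p) = S at hlow hup ⊢
  have hS : |S - X ^ δ| ≤ M * X ^ κ := by
    have hMX : M * X ^ κ = 2 * (C * (η + 1) ^ κ * X ^ κ) + X ^ κ := by rw [hM]; ring
    rw [abs_le, hMX]
    constructor <;> linarith
  rw [Real.norm_eq_abs, Real.rpow_sub hX0, ← mul_div_assoc, div_sub_one hXδ.ne', abs_div,
    abs_of_pos hXδ]
  gcongr

/-- For `p` in the short interval `[ηX, ηX + X ^ δ]`, the quantity `f (p / X) * log X / log p` is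
uniformly close to `f η`. -/
lemma eventually_norm_log_div_mul_sub_le {f : ℝ → ℂ} (hf : Continuous f) {η δ ε : ℝ} (hη : 0 < η)
    (hδ : δ < 1) (hε : 0 < ε) :
    ∀ᶠ X : ℝ in atTop, ∀ p : ℝ, η * X ≤ p → p ≤ η * X + X ^ δ →
      0 < Real.log p ∧ ‖((Real.log X / Real.log p : ℝ) : ℂ) * f (p / X) - f η‖ ≤ ε := by
  set G : ℝ × ℝ → ℂ := fun w => (((1 + Real.log w.1 * w.2)⁻¹ : ℝ) : ℂ) * f w.1 with hG
  have hcont : ContinuousAt G (η, 0) := by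
    refine ContinuousAt.mul (Complex.continuous_ofReal.continuousAt.comp ?_)
      (hf.continuousAt.comp continuousAt_fst)
    refine ContinuousAt.inv₀ (continuousAt_const.add (ContinuousAt.mul ?_ continuousAt_snd))
      (by simp)
    exact continuousAt_fst.log hη.ne'
  obtain ⟨r, hr, hGr⟩ := Metric.continuousAt_iff.mp hcont ε hε
  have hpow : Tendsto (fun X : ℝ => X ^ (δ - 1)) atTop (𝓝 0) := by
    simpa using tendsto_rpow_neg_atTop (y := 1 - δ) (by linarith)
  have hlog : Tendsto (fun X : ℝ => (Real.log X)⁻¹) atTop (𝓝 0) :=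
    tendsto_inv_atTop_zero.comp Real.tendsto_log_atTop
  filter_upwards [hpow.eventually_lt_const hr, hlog.eventually_lt_const hr,
    eventually_gt_atTop 1, eventually_gt_atTop (1 / η)] with X h1 h2 hX hXη p hp1 hp2
  have hX0 : 0 < X := by linarith
  have hp : 1 < p := by
    rw [div_lt_iff₀ hη] at hXη
    linarith
  have hlogX : 0 < Real.log X := Real.log_pos hX
  have hlogp : 0 < Real.log p := Real.log_pos hp
  refine ⟨hlogp, ?_⟩
  have hu1 : η ≤ p / X := (le_div_iff₀ hX0).mpr hp1
  have hu2 : p / X ≤ η + X ^ (δ - 1) := by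
    rw [div_le_iff₀ hX0, add_mul, ← Real.rpow_add_one hX0.ne', sub_add_cancel]
    exact hp2
  have hdist : dist (p / X, (Real.log X)⁻¹) (η, (0 : ℝ)) < r := by
    rw [Prod.dist_eq, max_lt_iff, Real.dist_eq, Real.dist_eq, sub_zero,
      abs_of_nonneg (sub_nonneg.mpr hu1), abs_of_pos (inv_pos.mpr hlogX)]
    exact ⟨by linarith, h2⟩
  have h := (hGr hdist).le
  rw [dist_eq_norm] at h
  have hinv : (1 + Real.log (p / X) * (Real.log X)⁻¹)⁻¹ = Real.log X / Real.log p := by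
    rw [Real.log_div (by linarith) hX0.ne', sub_mul, mul_inv_cancel₀ hlogX.ne', add_sub_cancel,
      ← div_eq_mul_inv, inv_div]
  simp only [hG, hinv] at h
  simpa using h

theorem prime_average_of_continuous (hRH : RiemannHypothesis') (η δ : ℝ)
    (hη : 0 < η) (hδ : δ ∈ Set.Ioo (1 / 2 : ℝ) 1) (f : ℝ → ℂ) (hf : Continuous f) :
    Tendsto
      (fun X : ℝ => (Complex.ofReal (Real.log X / X ^ δ)) *
        ∑ p ∈ (Finset.range (Nat.floor (η * X + X ^ δ) + 1)).filter
            (fun p : ℕ => p.Prime ∧ η * X ≤ (p : ℝ) ∧ (p : ℝ) ≤ η * X + X ^ δ),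
          f ((p : ℝ) / X))
      atTop (𝓝 (f η)) := by
  change Tendsto (fun X : ℝ => (Complex.ofReal (Real.log X / X ^ δ)) *
    ∑ p ∈ primesBetween (η * X) (η * X + X ^ δ), f ((p : ℝ) / X)) atTop (𝓝 (f η))
  set S : ℝ → ℝ := fun X => ∑ p ∈ primesBetween (η * X) (η * X + X ^ δ), Real.log p with hS
  have hSlim : Tendsto (fun X : ℝ => S X / X ^ δ) atTop (𝓝 1) := hRH.tendsto_sum_log_div hη hδ
  have hmain : Tendsto (fun X : ℝ => ((S X / X ^ δ : ℝ) : ℂ) * f η) atTop (𝓝 (f η)) := by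
    simpa using ((Complex.continuous_ofReal.tendsto 1).comp hSlim).mul_const (f η)
  refine hmain.congr_dist ?_
  rw [Metric.tendsto_nhds]
  intro ε hε
  filter_upwards [hSlim.eventually_lt_const one_lt_two, eventually_gt_atTop 0,
    eventually_norm_log_div_mul_sub_le hf hη hδ.2 (ε := ε / 3) (by positivity)] with X h2 hX hclose
  have hXδ : 0 < X ^ δ := by positivity
  rw [dist_zero_right, Real.norm_of_nonneg dist_nonneg, dist_comm, dist_eq_norm]
  have hrw : Complex.ofReal (Real.log X / X ^ δ) *
      ∑ p ∈ primesBetween (η * X) (η * X + X ^ δ), f ((p : ℝ) / X) -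
      ((S X / X ^ δ : ℝ) : ℂ) * f η =
      ((X ^ δ : ℝ) : ℂ)⁻¹ * ∑ p ∈ primesBetween (η * X) (η * X + X ^ δ), (Real.log p : ℂ) *
        (((Real.log X / Real.log p : ℝ) : ℂ) * f (p / X) - f η) := by
    rw [hS, sum_div, Complex.ofReal_sum, sum_mul, mul_sum, mul_sum, ← sum_sub_distrib]
    refine sum_congr rfl fun p hp => ?_
    rw [mem_primesBetween] at hp
    have hlogp : (Real.log p : ℂ) ≠ 0 := by exact_mod_cast (hclose p hp.2.1 hp.2.2).1.ne'
    have hXc : ((X ^ δ : ℝ) : ℂ) ≠ 0 := by exact_mod_cast hXδ.ne'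
    push_cast at hXc hlogp ⊢
    field_simp
  rw [hrw, norm_mul, norm_inv, Complex.norm_real, Real.norm_of_nonneg hXδ.le]
  have hsum : ‖∑ p ∈ primesBetween (η * X) (η * X + X ^ δ), (Real.log p : ℂ) *
      (((Real.log X / Real.log p : ℝ) : ℂ) * f (p / X) - f η)‖ ≤ S X * (ε / 3) := by
    rw [hS, sum_mul]
    refine norm_sum_le_of_le _ fun p hp => ?_
    rw [mem_primesBetween] at hp
    obtain ⟨hlogp, hle⟩ := hclose p hp.2.1 hp.2.2
    rw [norm_mul, Complex.norm_real, Real.norm_of_nonneg hlogp.le]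
    gcongr
  calc _ ≤ (X ^ δ)⁻¹ * (S X * (ε / 3)) := by gcongr
    _ = S X / X ^ δ * (ε / 3) := by ring
    _ < ε := by nlinarith
end

section
/- Let Φ : ℝ → ℝ be a smooth compactly supported function with Φ ≥ 0 and Φ not identically zero, and set β = sup{|x| : Φ(x) > 0}. Let p be an odd prime, X > 0, and 0 < A ≤ √(βX). Then (1/X) · Σ_{d ∈ ℤ, d odd} (Σ_{a ∈ ℕ, a ≤ A, a² ∣ |d|} μ(a)) · Φ(d/X) · (d/p) · √p = (1/2) · (2/p) · Σ_{0 < a ≤ A, a odd, p ∤ a} (μ(a)/a²) · Σ_{k ∈ ℤ} (−1)^k · (k/p) · Φ̃(kX/(2a²p)). -/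
open Filter Topology Finset

/-- The transform `Φ̃(ξ) = ∫ (cos(2πξx) + sin(2πξx)) Φ(x) dx`. -/
noncomputable def cosSinTransform (Φ : ℝ → ℝ) (ξ : ℝ) : ℝ :=
  ∫ x : ℝ, (Real.cos (2 * Real.pi * ξ * x) + Real.sin (2 * Real.pi * ξ * x)) * Φ x

/-! ### The sign of the quadratic Gauss sum -/

/-- The additive character `x ↦ exp (2πix)`. -/
noncomputable def expTwoPi (x : ℝ) : ℂ := Complex.exp ((2 * Real.pi * x : ℝ) * Complex.I)

lemma expTwoPi_add (x y : ℝ) : expTwoPi (x + y) = expTwoPi x * expTwoPi y := by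
  simp only [expTwoPi, ← Complex.exp_add]
  congr 1
  push_cast
  ring

lemma norm_expTwoPi (x : ℝ) : ‖expTwoPi x‖ = 1 := Complex.norm_exp_ofReal_mul_I _

lemma expTwoPi_re (x : ℝ) : (expTwoPi x).re = Real.cos (2 * Real.pi * x) :=
  Complex.exp_ofReal_mul_I_re _

lemma expTwoPi_im (x : ℝ) : (expTwoPi x).im = Real.sin (2 * Real.pi * x) :=
  Complex.exp_ofReal_mul_I_im _

lemma expTwoPi_intCast (n : ℤ) : expTwoPi n = 1 := by
  rw [expTwoPi, Complex.exp_eq_one_iff]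
  exact ⟨n, by push_cast; ring⟩

lemma expTwoPi_add_intCast (x : ℝ) (n : ℤ) : expTwoPi (x + n) = expTwoPi x := by
  rw [expTwoPi_add, expTwoPi_intCast, mul_one]

/-- Bound by summation by parts for sums of increments with decreasing weights. -/
lemma norm_sum_antitone_mul_sub_le (b : ℕ → ℝ) (v : ℕ → ℂ) (n : ℕ)
    (hb : ∀ i < n, b (i + 1) ≤ b i) (hb0 : 0 ≤ b n) (hv : ∀ i, ‖v i‖ ≤ 1) :
    ‖∑ i ∈ range (n + 1), (b i : ℂ) * (v (i + 1) - v i)‖ ≤ 2 * b 0 := by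
  have key : ∀ m ≤ n, ‖∑ i ∈ range (m + 1), (b i : ℂ) * (v (i + 1) - v i) - b m * v (m + 1)‖
      ≤ 2 * b 0 - b m := by
    have hpos : 0 ≤ b 0 := by
      have : ∀ m ≤ n, b m ≤ b 0 := by
        intro m
        induction m with
        | zero => intro _; exact le_rfl
        | succ m ih => intro hm; exact (hb m (by omega)).trans (ih (by omega))
      exact hb0.trans (this n le_rfl)
    intro m
    induction m with
    | zero =>
      intro _
      have : ∑ i ∈ range (0 + 1), (b i : ℂ) * (v (i + 1) - v i) - b 0 * v (0 + 1)
          = -(b 0 * v 0) := by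
        simp; ring
      rw [this, norm_neg, norm_mul, Complex.norm_real, Real.norm_of_nonneg hpos]
      nlinarith [hv 0]
    | succ m ih =>
      intro hm
      have h1 := ih (by omega)
      have h2 := hb m (by omega)
      rw [sum_range_succ]
      have : ∑ i ∈ range (m + 1), (b i : ℂ) * (v (i + 1) - v i)
            + b (m + 1) * (v (m + 1 + 1) - v (m + 1)) - b (m + 1) * v (m + 1 + 1)
          = (∑ i ∈ range (m + 1), (b i : ℂ) * (v (i + 1) - v i) - b m * v (m + 1))
            + ((b m - b (m + 1) : ℝ) : ℂ) * v (m + 1) := by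
        push_cast; ring
      rw [this]
      refine (norm_add_le _ _).trans ?_
      have h3 : ‖((b m - b (m + 1) : ℝ) : ℂ) * v (m + 1)‖ ≤ b m - b (m + 1) := by
        rw [norm_mul, Complex.norm_real, Real.norm_of_nonneg (by linarith)]
        nlinarith [hv (m + 1)]
      linarith
  have h := key n le_rfl
  have h2 : ‖(b n : ℂ) * v (n + 1)‖ ≤ b n := by
    rw [norm_mul, Complex.norm_real, Real.norm_of_nonneg hb0]
    nlinarith [hv (n + 1)]
  have h3 := norm_add_le
    (∑ i ∈ range (n + 1), (b i : ℂ) * (v (i + 1) - v i) - b n * v (n + 1)) (b n * v (n + 1))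
  rw [sub_add_cancel] at h3
  linarith

/-- The sum of `exp (2πi l² / (8p))` over odd `l` with `-p < l ≤ p`, where `p = 2h + 1`. -/
noncomputable def oddGaussSum (h : ℕ) : ℂ :=
  2 * ∑ j ∈ range h, expTwoPi ((2 * j + 1) ^ 2 / (8 * (2 * h + 1)))
    + expTwoPi ((2 * h + 1) / 8)

lemma expTwoPi_sub_expTwoPi (p x : ℝ) (hp : p ≠ 0) :
    expTwoPi ((x + 1) ^ 2 / (2 * p)) - expTwoPi (x ^ 2 / (2 * p))
      = expTwoPi ((2 * x + 1) ^ 2 / (8 * p)) * expTwoPi (1 / (8 * p)) * (2 * Complex.I)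
        * (Real.sin (Real.pi * (2 * x + 1) / (2 * p)) : ℂ) := by
  have h1 : (x + 1) ^ 2 / (2 * p)
      = (2 * x + 1) ^ 2 / (8 * p) + 1 / (8 * p) + (2 * x + 1) / (4 * p) := by
    field_simp; ring
  have h2 : x ^ 2 / (2 * p)
      = (2 * x + 1) ^ 2 / (8 * p) + 1 / (8 * p) + -((2 * x + 1) / (4 * p)) := by
    field_simp; ring
  have h3 : expTwoPi ((2 * x + 1) / (4 * p)) - expTwoPi (-((2 * x + 1) / (4 * p)))
      = 2 * Complex.I * (Real.sin (Real.pi * (2 * x + 1) / (2 * p)) : ℂ) := by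
    have h4 : Real.pi * (2 * x + 1) / (2 * p) = 2 * Real.pi * ((2 * x + 1) / (4 * p)) := by
      field_simp; ring
    rw [h4]
    apply Complex.ext <;>
    simp only [Complex.sub_re, Complex.sub_im, expTwoPi_re, expTwoPi_im, mul_neg, Real.cos_neg,
      Real.sin_neg, Complex.mul_re, Complex.mul_im, Complex.ofReal_re, Complex.ofReal_im,
      Complex.I_re, Complex.I_im, Complex.re_ofNat, Complex.im_ofNat] <;> ring
  rw [h1, h2, expTwoPi_add _ ((2 * x + 1) / (4 * p)), expTwoPi_add _ (-((2 * x + 1) / (4 * p))),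
    ← mul_sub, h3, expTwoPi_add]
  ring

lemma one_le_cos_add_sin {x : ℝ} (h0 : 0 ≤ x) (h1 : x ≤ Real.pi / 2) :
    1 ≤ Real.cos x + Real.sin x := by
  have hc := Real.cos_nonneg_of_mem_Icc (x := x) ⟨by linarith [Real.pi_pos], h1⟩
  have hs := Real.sin_nonneg_of_nonneg_of_le_pi h0 (by linarith [Real.pi_pos])
  nlinarith [Real.sin_sq_add_cos_sq x, Real.cos_le_one x, Real.sin_le_one x]

/-- The terms of `oddGaussSum` from index `K` on, bounded by summation by parts. -/
lemma norm_oddGaussSum_tail_le {h K : ℕ} (hK : K ≤ h) :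
    ‖2 * ∑ j ∈ Ico K h, expTwoPi ((2 * j + 1) ^ 2 / (8 * (2 * h + 1)))
      + expTwoPi ((2 * h + 1) / 8)‖ ≤ 2 * (2 * h + 1) / (2 * K + 1) := by
  set p : ℝ := 2 * h + 1 with hpdef
  have hp : 0 < p := by positivity
  obtain ⟨n, rfl⟩ := Nat.exists_eq_add_of_le hK
  have hsin : ∀ i ≤ n, ((2 * (K + i : ℕ) + 1 : ℝ)) / p
      ≤ Real.sin (Real.pi * (2 * (K + i : ℕ) + 1) / (2 * p)) := by
    intro i hi
    have hle : (2 * (K + i : ℕ) + 1 : ℝ) ≤ p := by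
      rw [hpdef]; gcongr
    have := Real.mul_le_sin (x := Real.pi * (2 * (K + i : ℕ) + 1) / (2 * p)) (by positivity) (by
      rw [div_le_div_iff₀ (by positivity) (by positivity)]
      nlinarith [Real.pi_pos])
    refine le_trans (le_of_eq ?_) this
    field_simp [Real.pi_ne_zero]
  have hsinpos : ∀ i ≤ n, 0 < Real.sin (Real.pi * (2 * (K + i : ℕ) + 1) / (2 * p)) :=
    fun i hi => lt_of_lt_of_le (by positivity) (hsin i hi)
  let b : ℕ → ℝ := fun i =>
    (if i < n then 1 else 1 / 2) / Real.sin (Real.pi * (2 * (K + i : ℕ) + 1) / (2 * p))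
  let v : ℕ → ℂ := fun i => expTwoPi ((K + i : ℕ) ^ 2 / (2 * p))
  have hb : ∀ i < n, b (i + 1) ≤ b i := by
    intro i hi
    have h1 : Real.sin (Real.pi * (2 * (K + i : ℕ) + 1) / (2 * p))
        ≤ Real.sin (Real.pi * (2 * (K + (i + 1) : ℕ) + 1) / (2 * p)) := by
      have hle : (2 * (K + (i + 1) : ℕ) + 1 : ℝ) ≤ p := by
        rw [hpdef]; gcongr; omega
      apply Real.sin_le_sin_of_le_of_le_pi_div_two
      · have : 0 ≤ Real.pi * (2 * (K + i : ℕ) + 1) / (2 * p) := by positivity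
        linarith [Real.pi_pos]
      · rw [div_le_div_iff₀ (by positivity) (by positivity)]
        nlinarith [Real.pi_pos]
      · gcongr
        omega
    simp only [b, if_pos hi]
    apply div_le_div₀ zero_le_one _ (hsinpos i hi.le) h1
    split_ifs <;> norm_num
  have hb0 : 0 ≤ b n := div_nonneg (by split_ifs <;> norm_num) (hsinpos n le_rfl).le
  have hbound := norm_sum_antitone_mul_sub_le b v n hb hb0 (fun i => (norm_expTwoPi _).le)
  have hsum : ∑ i ∈ range (n + 1), (b i : ℂ) * (v (i + 1) - v i)
      = expTwoPi (1 / (8 * p)) * Complex.I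
        * (2 * ∑ j ∈ Ico K (K + n), expTwoPi ((2 * j + 1) ^ 2 / (8 * p)) + expTwoPi (p / 8)) := by
    have hterm : ∀ i ≤ n, (b i : ℂ) * (v (i + 1) - v i)
        = expTwoPi (1 / (8 * p)) * Complex.I * ((if i < n then 2 else 1)
          * expTwoPi ((2 * (K + i : ℕ) + 1) ^ 2 / (8 * p))) := by
      intro i hi
      have h1 := expTwoPi_sub_expTwoPi p (K + i : ℕ) hp.ne'
      have h2 : v (i + 1) - v i = expTwoPi (((K + i : ℕ) + 1) ^ 2 / (2 * p))
          - expTwoPi ((K + i : ℕ) ^ 2 / (2 * p)) := by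
        simp only [v]
        push_cast
        ring_nf
      have h3 : (Real.sin (Real.pi * (2 * (K + i : ℕ) + 1) / (2 * p)) : ℂ) ≠ 0 :=
        Complex.ofReal_ne_zero.2 (hsinpos i hi).ne'
      rw [h2, h1]
      simp only [b]
      rw [Complex.ofReal_div]
      field_simp
      split_ifs <;> push_cast <;> ring
    rw [sum_range_succ, hterm n le_rfl,
      sum_congr rfl (fun i hi => hterm i (mem_range.1 hi).le), ← mul_sum, ← mul_add,
      sum_Ico_eq_sum_range, add_tsub_cancel_left]
    congr 2
    · rw [mul_sum]
      refine sum_congr rfl fun i hi => ?_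
      rw [if_pos (mem_range.1 hi)]
    · rw [if_neg (lt_irrefl n), one_mul]
      congr 1
      rw [hpdef]
      field_simp
  rw [hsum, norm_mul, norm_mul, norm_expTwoPi, Complex.norm_I, one_mul, one_mul] at hbound
  refine hbound.trans ?_
  have h0 : b 0 ≤ p / (2 * K + 1) := by
    have h1 := hsin 0 (Nat.zero_le n)
    simp only [b]
    calc _ ≤ 1 / ((2 * (K + 0 : ℕ) + 1 : ℝ) / p) := by
          apply div_le_div₀ zero_le_one _ (by positivity) h1
          split_ifs <;> norm_num
      _ = _ := by simp
  rw [mul_div_assoc]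
  linarith

lemma re_add_im_le_sqrt_two_mul_norm (z : ℂ) : |z.re + z.im| ≤ √2 * ‖z‖ := by
  rw [← Real.sqrt_sq (norm_nonneg z), ← Real.sqrt_mul zero_le_two, Complex.sq_norm,
    Complex.normSq_apply]
  apply Real.abs_le_sqrt
  nlinarith [sq_nonneg (z.re - z.im)]

lemma neg_sqrt_lt_oddGaussSum_re_add_im {h : ℕ} (hh : 1 ≤ h) :
    -√(2 * (2 * h + 1)) < (oddGaussSum h).re + (oddGaussSum h).im := by
  set p : ℝ := 2 * h + 1 with hpdef
  have hp3 : 3 ≤ p := by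
    have : (1 : ℝ) ≤ h := by exact_mod_cast hh
    linarith
  have hex : ∃ K : ℕ, 2 * p ≤ (2 * K + 1 : ℝ) ^ 2 := ⟨h, by rw [← hpdef]; nlinarith⟩
  classical
  set K := Nat.find hex with hKdef
  have hK : 2 * p ≤ (2 * K + 1 : ℝ) ^ 2 := Nat.find_spec hex
  have hKh : K ≤ h := Nat.find_min' hex (by rw [← hpdef]; nlinarith)
  have hlt : ∀ j < K, (2 * j + 1 : ℝ) ^ 2 < 2 * p := fun j hj => not_le.1 (Nat.find_min hex hj)
  have htail := norm_oddGaussSum_tail_le hKh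
  rw [← hpdef] at htail
  set T := 2 * ∑ j ∈ Ico K h, expTwoPi ((2 * j + 1) ^ 2 / (8 * p)) + expTwoPi (p / 8) with hT
  have hsplit : oddGaussSum h
      = 2 * ∑ j ∈ range K, expTwoPi ((2 * j + 1) ^ 2 / (8 * p)) + T := by
    rw [oddGaussSum, ← hpdef, ← sum_range_add_sum_Ico _ hKh, hT]
    ring
  have hmain : (2 * K : ℝ) ≤
      (2 * ∑ j ∈ range K, expTwoPi ((2 * j + 1) ^ 2 / (8 * p))).re
      + (2 * ∑ j ∈ range K, expTwoPi ((2 * j + 1) ^ 2 / (8 * p))).im := by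
    have : ∀ j ∈ range K, (1 : ℝ) ≤ Real.cos (2 * Real.pi * ((2 * j + 1) ^ 2 / (8 * p)))
        + Real.sin (2 * Real.pi * ((2 * j + 1) ^ 2 / (8 * p))) := by
      intro j hj
      apply one_le_cos_add_sin (by positivity)
      have : (2 * j + 1 : ℝ) ^ 2 / (8 * p) ≤ 1 / 4 := by
        rw [div_le_div_iff₀ (by positivity) (by positivity)]
        linarith [hlt j (mem_range.1 hj)]
      nlinarith [Real.pi_pos]
    have h2 := sum_le_sum this
    rw [sum_const, card_range, nsmul_eq_mul, mul_one, sum_add_distrib] at h2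
    simp only [Complex.mul_re, Complex.mul_im, Complex.re_ofNat, Complex.im_ofNat, zero_mul,
      sub_zero, add_zero, Complex.re_sum, Complex.im_sum, expTwoPi_re, expTwoPi_im]
    linarith
  have hT2 := abs_le.1 (re_add_im_le_sqrt_two_mul_norm T)
  set s := √(2 * p) with hs
  have hs2 : s ^ 2 = 2 * p := Real.sq_sqrt (by positivity)
  have hs0 : 0 ≤ s := Real.sqrt_nonneg _
  have hKs : s ≤ 2 * K + 1 := Real.sqrt_le_iff.2 ⟨by positivity, hK⟩
  have hspos : 0 < s := Real.sqrt_pos.2 (by positivity)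
  have hTs : ‖T‖ ≤ s := by
    refine htail.trans ?_
    rw [div_le_iff₀ (by positivity)]
    nlinarith
  have hr2 : √2 ≤ 1.42 := Real.sqrt_le_iff.2 ⟨by norm_num, by norm_num⟩
  have hs3 : 2.4 ≤ s := Real.le_sqrt_of_sq_le (by norm_num; linarith)
  have hnT : √2 * ‖T‖ ≤ 1.42 * s := by gcongr
  rw [hsplit, Complex.add_re, Complex.add_im]
  linarith

lemma stdAddChar_intCast_eq_expTwoPi (p : ℕ) [NeZero p] (j : ℤ) :
    ZMod.stdAddChar (j : ZMod p) = expTwoPi (j / p) := by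
  rw [ZMod.stdAddChar_coe, expTwoPi]
  congr 1
  push_cast
  ring

/-- The quadratic character of `ZMod p` with complex values. -/
noncomputable def complexQuadraticChar (p : ℕ) [Fact p.Prime] : MulChar (ZMod p) ℂ :=
  (quadraticChar (ZMod p)).ringHomComp (Int.castRingHom ℂ)

section GaussSum

variable (p : ℕ) [Fact p.Prime]

lemma complexQuadraticChar_intCast (k : ℤ) :
    complexQuadraticChar p (k : ZMod p) = (jacobiSym k p : ℂ) := by
  rw [← jacobiSym.legendreSym.to_jacobiSym]
  rfl

lemma complexQuadraticChar_isQuadratic : (complexQuadraticChar p).IsQuadratic :=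
  (quadraticChar_isQuadratic (ZMod p)).comp _

variable {p}

lemma complexQuadraticChar_ne_one (hp2 : p ≠ 2) : complexQuadraticChar p ≠ 1 := by
  rw [complexQuadraticChar, MulChar.ringHomComp_ne_one_iff (RingHom.injective_int _)]
  exact quadraticChar_ne_one ((ZMod.ringChar_zmod_n p).substr hp2)

lemma sum_addChar_mul_sq (hp2 : p ≠ 2) (c : (ZMod p)ˣ) :
    ∑ n : ZMod p, ZMod.stdAddChar ((c : ZMod p) * n ^ 2)
      = complexQuadraticChar p c * gaussSum (complexQuadraticChar p) ZMod.stdAddChar := by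
  have hinv := (complexQuadraticChar_isQuadratic p).inv
  have h1 := gaussSum_mulShift_eq (complexQuadraticChar p) ZMod.stdAddChar c
  rw [hinv] at h1
  rw [← h1, gaussSum]
  have hψ : (ZMod.stdAddChar (N := p)).mulShift c ≠ 1 :=
    ZMod.isPrimitive_stdAddChar p c.ne_zero
  have h0 := AddChar.sum_eq_zero_of_ne_one hψ
  rw [← add_zero (∑ a, _ * _), ← h0, ← sum_add_distrib,
    ← sum_fiberwise (s := univ) (g := fun n : ZMod p => n ^ 2)]
  refine sum_congr rfl fun a _ => ?_
  have hcard := quadraticChar_card_sqrts ((ZMod.ringChar_zmod_n p).substr hp2) a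
  have hcard' : ((#{x : ZMod p | x ^ 2 = a} : ℕ) : ℂ) = complexQuadraticChar p a + 1 := by
    have : ((#{x : ZMod p | x ^ 2 = a} : ℕ) : ℤ) = quadraticChar (ZMod p) a + 1 := by
      rw [← hcard]
      congr 2
      ext x
      simp
    have h := congrArg (Int.cast : ℤ → ℂ) this
    push_cast at h
    exact h
  rw [sum_congr rfl (g := fun _ => ZMod.stdAddChar ((c : ZMod p) * a))
    (fun n hn => by rw [(mem_filter.1 hn).2]), sum_const, nsmul_eq_mul, hcard',
    AddChar.mulShift_apply]
  ring

lemma sum_zmod_two_mul_add_one {h : ℕ} (hp : p = 2 * h + 1) (f : ZMod p → ℂ)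
    (hf : ∀ x, f (-x) = f x) :
    ∑ n : ZMod p, f n = 2 * ∑ j ∈ range h, f ((2 * j + 1 : ℤ) : ZMod p) + f 0 := by
  have hp0 : (2 * h + 1 : ZMod p) = 0 := by
    have : ((2 * h + 1 : ℕ) : ZMod p) = 0 := by rw [← hp, ZMod.natCast_self]
    exact_mod_cast this
  have h2 : (2 : ZMod p) ≠ 0 := by
    intro h2
    rw [h2, zero_mul, zero_add] at hp0
    exact one_ne_zero hp0
  have hrange : ∑ n : ZMod p, f n = ∑ i ∈ range p, f (2 * (i : ZMod p) + 1) := by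
    symm
    refine sum_bij (fun i _ => 2 * (i : ZMod p) + 1) (fun _ _ => mem_univ _) ?_ ?_
      (fun _ _ => rfl)
    · intro a ha b hb hab
      have hab' := mul_left_cancel₀ h2 (add_right_cancel hab)
      rw [ZMod.natCast_eq_natCast_iff] at hab'
      exact Nat.ModEq.eq_of_lt_of_lt hab' (mem_range.1 ha) (mem_range.1 hb)
    · intro b _
      refine ⟨((b - 1) / 2 : ZMod p).val, mem_range.2 (ZMod.val_lt _), ?_⟩
      rw [ZMod.natCast_zmod_val]
      field_simp
      ring
  have hsplit : range p = range (h + 1 + h) := by rw [hp]; congr 1; ring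
  rw [hrange, hsplit, sum_range_add, sum_range_succ, hp0]
  have hrefl : ∑ x ∈ range h, f (2 * ((h + 1 + x : ℕ) : ZMod p) + 1)
      = ∑ j ∈ range h, f (2 * (j : ZMod p) + 1) := by
    rw [← sum_range_reflect]
    refine sum_congr rfl fun j hj => ?_
    have hj' := mem_range.1 hj
    rw [← hf]
    congr 1
    have : h + 1 + (h - 1 - j) = 2 * h - j := by omega
    rw [this, Nat.cast_sub (by omega)]
    push_cast
    linear_combination (-2) * hp0
  rw [hrefl]
  push_cast
  ring

lemma sum_stdAddChar_eq_oddGaussSum {h : ℕ} (hp : p = 2 * h + 1) {c : ℤ}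
    (hc : 8 * c = 1 - (p : ℤ) ^ 2) :
    ∑ n : ZMod p, ZMod.stdAddChar ((c : ZMod p) * n ^ 2)
      = expTwoPi (-(p / 8)) * oddGaussSum h := by
  have hpR : (p : ℝ) = 2 * h + 1 := by rw [hp]; push_cast; ring
  have hp0 : (p : ℝ) ≠ 0 := by rw [hpR]; positivity
  have hcR : (c : ℝ) = (1 - (p : ℝ) ^ 2) / 8 := by
    have := congrArg (Int.cast : ℤ → ℝ) hc
    push_cast at this
    linarith
  rw [sum_zmod_two_mul_add_one hp (fun n => ZMod.stdAddChar ((c : ZMod p) * n ^ 2))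
    (fun x => by rw [neg_sq]), oddGaussSum, mul_add]
  congr 1
  · rw [mul_left_comm, mul_sum (range h) _ (expTwoPi _)]
    congr 1
    refine sum_congr rfl fun j _ => ?_
    obtain ⟨t, ht⟩ : ∃ t : ℤ, (j : ℤ) * (j + 1) = t + t := Int.even_mul_succ_self j
    have htR : (j : ℝ) * (j + 1) = t + t := by exact_mod_cast ht
    have h1 : ((c : ZMod p) * ((2 * j + 1 : ℤ) : ZMod p) ^ 2)
        = ((c * (2 * j + 1) ^ 2 : ℤ) : ZMod p) := by push_cast; ring
    rw [h1, stdAddChar_intCast_eq_expTwoPi, ← expTwoPi_add, ← expTwoPi_add_intCast _ (p * t)]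
    congr 1
    push_cast
    rw [hcR, ← hpR]
    field_simp
    linear_combination (-4 * (p : ℝ) ^ 2) * htR
  · rw [← expTwoPi_add, ← hpR, neg_add_cancel]
    simpa using (expTwoPi_intCast 0).symm

lemma re_eq_im_eq_sqrt_of_sq_eq_I_mul {w : ℂ} {q : ℝ} (hq : 0 ≤ q) (hw : w ^ 2 = Complex.I * q)
    (hpos : -√(2 * q) < w.re + w.im) : w.re = √(q / 2) ∧ w.im = √(q / 2) := by
  have hre := congrArg Complex.re hw
  have him := congrArg Complex.im hw
  simp only [pow_two, Complex.mul_re, Complex.mul_im, Complex.I_re, Complex.I_im,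
    Complex.ofReal_re, Complex.ofReal_im] at hre him
  have h1 : (w.re - w.im) * (w.re + w.im) = 0 := by linarith
  have hs : √(2 * q) ^ 2 = 2 * q := Real.sq_sqrt (by positivity)
  have hs0 := Real.sqrt_nonneg (2 * q)
  have hhalf : √(q / 2) = √(2 * q) / 2 := by
    rw [Real.sqrt_eq_iff_mul_self_eq (by positivity) (by positivity)]
    linarith
  have h2 : (w.re + w.im) ^ 2 = √(2 * q) ^ 2 := by
    rcases mul_eq_zero.1 h1 with h | h
    · nlinarith
    · have : w.im = -w.re := by linarith
      nlinarith
  rcases sq_eq_sq_iff_eq_or_eq_neg.1 h2 with h | h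
  · rcases mul_eq_zero.1 h1 with h3 | h3
    · constructor <;> linarith
    · rw [h3] at h
      constructor <;> nlinarith
  · linarith

/-- Gauss's determination of the sign of the quadratic Gauss sum, in real form. -/
theorem gaussSum_re_add_im (hp2 : p ≠ 2) :
    (gaussSum (complexQuadraticChar p) ZMod.stdAddChar).re
      + (gaussSum (complexQuadraticChar p) ZMod.stdAddChar).im = √p := by
  have hpp : p.Prime := Fact.out
  obtain ⟨h, hp⟩ := hpp.odd_of_ne_two hp2
  have hh : 1 ≤ h := by have := hpp.two_le; omega
  have hpR : (p : ℝ) = 2 * h + 1 := by rw [hp]; push_cast; ring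
  obtain ⟨t, ht⟩ : ∃ t : ℤ, (h : ℤ) * (h + 1) = t + t := Int.even_mul_succ_self h
  have hc : 8 * (-t) = 1 - (p : ℤ) ^ 2 := by
    rw [hp]
    push_cast
    linear_combination 4 * ht
  have hcz : (8 : ZMod p) * ((-t : ℤ) : ZMod p) = 1 := by
    have := congrArg (Int.cast : ℤ → ZMod p) hc
    push_cast at this ⊢
    rw [this, ZMod.natCast_self]
    ring
  have hunit : IsUnit ((-t : ℤ) : ZMod p) := IsUnit.of_mul_eq_one_right _ hcz
  have hjac := congrArg (complexQuadraticChar p) hcz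
  have h8 : (8 : ZMod p) = ((2 : ℤ) : ZMod p) ^ 3 := by norm_num
  rw [map_mul, map_one, h8, map_pow, complexQuadraticChar_intCast, jacobiSym.at_two ⟨h, hp⟩,
    ZMod.χ₈_nat_eq_if_mod_eight] at hjac
  have hsq : gaussSum (complexQuadraticChar p) ZMod.stdAddChar ^ 2
      = complexQuadraticChar p (-1) * (Fintype.card (ZMod p) : ℂ) :=
    gaussSum_sq (complexQuadraticChar_ne_one hp2) (complexQuadraticChar_isQuadratic p)
    (ZMod.isPrimitive_stdAddChar p)
  have hneg : complexQuadraticChar p (-1) = (jacobiSym (-1) p : ℂ) := by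
    rw [← complexQuadraticChar_intCast]
    norm_num
  rw [hneg, jacobiSym.at_neg_one ⟨h, hp⟩, ZMod.χ₄_nat_eq_if_mod_four, ZMod.card] at hsq
  have hτ := sum_addChar_mul_sq hp2 hunit.unit
  rw [IsUnit.unit_spec, sum_stdAddChar_eq_oddGaussSum hp hc] at hτ
  set τ := gaussSum (complexQuadraticChar p) ZMod.stdAddChar
  set χc := complexQuadraticChar p ((-t : ℤ) : ZMod p)
  set ω := expTwoPi (1 / 8)
  have hωre : ω.re = √2 / 2 := by
    rw [expTwoPi_re, ← Real.cos_pi_div_four]; congr 1; ring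
  have hωim : ω.im = √2 / 2 := by
    rw [expTwoPi_im, ← Real.sin_pi_div_four]; congr 1; ring
  have hs2 : √2 * √2 = 2 := Real.mul_self_sqrt zero_le_two
  have hω2 : ω ^ 2 = Complex.I := by
    apply Complex.ext
    · rw [pow_two, Complex.mul_re, hωre, hωim, Complex.I_re]; ring
    · rw [pow_two, Complex.mul_im, hωre, hωim, Complex.I_im]; linarith
  set E := expTwoPi (-(p / 8))
  have hE : E * ω ^ p = 1 := by
    have hpow : ∀ n : ℕ, ω ^ n = expTwoPi (n / 8) := by
      intro n
      induction n with
      | zero => simpa using (expTwoPi_intCast 0).symm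
      | succ n ih =>
        rw [pow_succ, ih, ← expTwoPi_add]
        congr 1
        push_cast
        ring
    rw [hpow, ← expTwoPi_add, neg_add_cancel]
    simpa using expTwoPi_intCast 0
  have hω8 : ω ^ 8 = 1 := by
    rw [show 8 = 2 * 4 from rfl, pow_mul, hω2, Complex.I_pow_four]
  have hI := Complex.I_sq
  rw [← Nat.mod_add_div p 8, pow_add, pow_mul, hω8, one_pow, mul_one] at hE
  have hpos := neg_sqrt_lt_oddGaussSum_re_add_im hh
  rw [← hpR] at hpos
  have hconcl : ∀ ε η : ℂ, χc = ε → ε ^ 2 = 1 → τ ^ 2 = η * p → η * ω ^ (2 * (p % 8)) = Complex.I →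
      τ = ε * (E * ω) * √p := by
    intro ε η hε hε2 hη hηω
    have hWsq : oddGaussSum h ^ 2 = Complex.I * (p : ℝ) := by
      have h1 : (E * oddGaussSum h) ^ 2 = η * p := by rw [hτ, mul_pow, hε, hε2, hη, one_mul]
      have h2 : oddGaussSum h ^ 2 = (E * oddGaussSum h) ^ 2 * ω ^ (2 * (p % 8)) := by
        rw [mul_comm 2, pow_mul, ← mul_pow, mul_right_comm, hE, one_mul]
      rw [h2, h1, ← hηω]
      push_cast
      ring
    obtain ⟨h1, h2⟩ := re_eq_im_eq_sqrt_of_sq_eq_I_mul (Nat.cast_nonneg p) hWsq hpos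
    have h3 : √((p : ℝ) / 2) = √2 / 2 * √p := by
      rw [Real.sqrt_div (Nat.cast_nonneg p)]
      field_simp
      linear_combination (-√(p : ℝ)) * hs2
    have hWω : oddGaussSum h = ω * √p := by
      apply Complex.ext
      · rw [Complex.re_mul_ofReal, hωre, h1, h3]
      · rw [Complex.im_mul_ofReal, hωim, h2, h3]
    calc τ = ε * (ε * τ) := by rw [← mul_assoc, ← pow_two, hε2, one_mul]
      _ = ε * (E * oddGaussSum h) := by rw [hτ, hε]
      _ = _ := by rw [hWω]; ring
  have h2 : p % 2 ≠ 0 := by omega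
  have hmod : p % 8 = 1 ∨ p % 8 = 3 ∨ p % 8 = 5 ∨ p % 8 = 7 := by omega
  rcases hmod with hm | hm | hm | hm
  · have h4 : p % 4 = 1 := by omega
    rw [hm, pow_one] at hE
    rw [hconcl 1 1 (by simpa [hm, h2] using hjac) (by norm_num) (by simpa [h4, h2] using hsq)
      (by rw [hm, mul_one, hω2, one_mul]), hE]
    simp
  · have h4 : p % 4 = 3 := by omega
    have hE' : -1 * (E * ω) = Complex.I := by
      rw [hm] at hE
      linear_combination Complex.I * hE - E * ω * Complex.I * hω2 - E * ω * hI
    rw [hconcl (-1) (-1) (by simp [hm, h2] at hjac; linear_combination -hjac) (by norm_num)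
      (by simpa [h4, h2] using hsq)
      (by rw [hm, pow_mul, hω2]; linear_combination (-Complex.I) * hI), hE']
    simp
  · have h4 : p % 4 = 1 := by omega
    have hE' : -1 * (E * ω) = 1 := by
      rw [hm] at hE
      linear_combination (-E * ω) * (ω ^ 2 + Complex.I) * hω2 + (-E * ω) * hI + hE
    rw [hconcl (-1) 1 (by simp [hm, h2] at hjac; linear_combination -hjac) (by norm_num)
      (by simpa [h4, h2] using hsq)
      (by rw [hm, pow_mul, hω2]; linear_combination (Complex.I ^ 3 - Complex.I) * hI), hE']
    simp
  · have h4 : p % 4 = 3 := by omega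
    have hE' : 1 * (E * ω) = Complex.I := by
      rw [hm] at hE
      have h6 : ω ^ 6 = -Complex.I := by
        rw [show 6 = 2 * 3 from rfl, pow_mul, hω2]
        linear_combination Complex.I * hI
      linear_combination Complex.I * hE - E * ω * Complex.I * h6 + E * ω * hI
    rw [hconcl 1 (-1) (by simpa [hm, h2] using hjac) (by norm_num) (by simpa [h4, h2] using hsq)
      (by
        rw [hm, pow_mul, hω2]
        linear_combination (-Complex.I ^ 5 + Complex.I ^ 3 - Complex.I) * hI), hE']
    simp

end GaussSum

/-! ### Poisson summation for the transform `Φ̃` -/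

section Poisson

open scoped FourierTransform

variable {Φ : ℝ → ℝ}

lemma integrable_mul_of_hasCompactSupport {g : ℝ → ℝ} (hg : Continuous g) (hΦ : Continuous Φ)
    (hΦs : HasCompactSupport Φ) : MeasureTheory.Integrable fun x => g x * Φ x :=
  (hg.mul hΦ).integrable_of_hasCompactSupport hΦs.mul_left

lemma fourier_ofReal_comp (hΦ : Continuous Φ) (hΦs : HasCompactSupport Φ) (ξ : ℝ) :
    𝓕 (fun x => (Φ x : ℂ)) ξ = ((∫ x, Real.cos (2 * Real.pi * ξ * x) * Φ x : ℝ) : ℂ)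
      - ((∫ x, Real.sin (2 * Real.pi * ξ * x) * Φ x : ℝ) : ℂ) * Complex.I := by
  have hc : MeasureTheory.Integrable fun x => ((Real.cos (2 * Real.pi * ξ * x) * Φ x : ℝ) : ℂ) :=
    (integrable_mul_of_hasCompactSupport (by fun_prop) hΦ hΦs).ofReal
  have hs : MeasureTheory.Integrable fun x => ((Real.sin (2 * Real.pi * ξ * x) * Φ x : ℝ) : ℂ) :=
    (integrable_mul_of_hasCompactSupport (by fun_prop) hΦ hΦs).ofReal
  rw [Real.fourier_real_eq_integral_exp_smul, ← integral_complex_ofReal,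
    ← integral_complex_ofReal, ← MeasureTheory.integral_mul_const,
    ← MeasureTheory.integral_sub hc (hs.mul_const _)]
  congr 1
  ext x
  have h : -2 * Real.pi * x * ξ = -(2 * Real.pi * ξ * x) := by ring
  rw [smul_eq_mul, h]
  apply Complex.ext <;>
  simp only [Complex.mul_re, Complex.mul_im, Complex.sub_re, Complex.sub_im,
    Complex.exp_ofReal_mul_I_re, Complex.exp_ofReal_mul_I_im, Real.cos_neg, Real.sin_neg,
    Complex.ofReal_re, Complex.ofReal_im, Complex.I_re, Complex.I_im] <;> ring

lemma cosSinTransform_eq_add (hΦ : Continuous Φ) (hΦs : HasCompactSupport Φ) (ξ : ℝ) :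
    cosSinTransform Φ ξ = (∫ x, Real.cos (2 * Real.pi * ξ * x) * Φ x)
      + ∫ x, Real.sin (2 * Real.pi * ξ * x) * Φ x := by
  rw [cosSinTransform, ← MeasureTheory.integral_add
    (integrable_mul_of_hasCompactSupport (by fun_prop) hΦ hΦs)
    (integrable_mul_of_hasCompactSupport (by fun_prop) hΦ hΦs)]
  simp only [add_mul]

lemma tsum_int_eq_zero_of_odd {f : ℤ → ℝ} (hf : ∀ k, f (-k) = -f k) : ∑' k, f k = 0 := by
  have h := (Equiv.neg ℤ).tsum_eq f
  simp only [Equiv.neg_apply, hf, tsum_neg] at h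
  linarith

lemma tsum_add_intCast_eq_tsum_cosSinTransform (hΦ : ContDiff ℝ (⊤ : ℕ∞) Φ)
    (hΦs : HasCompactSupport Φ) (x : ℝ) :
    (Summable fun k : ℤ => cosSinTransform Φ k) ∧
    ∑' n : ℤ, Φ (x + n) = ∑' k : ℤ, (Real.cos (2 * Real.pi * (k * x))
      + Real.sin (2 * Real.pi * (k * x))) * cosSinTransform Φ k := by
  have hcont := hΦ.continuous
  let f : SchwartzMap ℝ ℂ := HasCompactSupport.toSchwartzMap (f := fun x => (Φ x : ℂ))
    (hΦs.comp_left Complex.ofReal_zero) (Complex.ofRealCLM.contDiff.comp hΦ)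
  let C : ℤ → ℝ := fun k => ∫ x, Real.cos (2 * Real.pi * k * x) * Φ x
  let S : ℤ → ℝ := fun k => ∫ x, Real.sin (2 * Real.pi * k * x) * Φ x
  have hF : ∀ k : ℤ, (𝓕 f) (k : ℝ) = (C k : ℂ) - S k * Complex.I :=
    fun k => fourier_ofReal_comp hcont hΦs k
  have hT : ∀ k : ℤ, cosSinTransform Φ k = C k + S k :=
    fun k => cosSinTransform_eq_add hcont hΦs k
  have hsum : Summable fun k : ℤ => (C k : ℂ) - S k * Complex.I := by
    simp_rw [← hF]
    exact summable_of_isBigO (Real.summable_abs_int_rpow one_lt_two)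
      (((𝓕 f).isBigO_cocompact_rpow (-2)).comp_tendsto Int.tendsto_coe_cofinite)
  have hC : Summable C := by
    simpa using (Complex.reCLM.summable hsum)
  have hS : Summable S := by
    simpa using (Complex.imCLM.summable hsum).neg
  refine ⟨by simp_rw [hT]; exact hC.add hS, ?_⟩
  have hbdd : ∀ (a : ℤ → ℝ) (b : ℤ → ℝ), (∀ k, |a k| ≤ 1) → Summable b →
      Summable fun k => a k * b k := fun a b ha hb =>
    Summable.of_norm_bounded hb.norm fun k => by
      rw [norm_mul]
      exact mul_le_of_le_one_left (norm_nonneg _) (ha k)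
  have hcos : ∀ k : ℤ, |Real.cos (2 * Real.pi * (k * x))| ≤ 1 := fun _ => Real.abs_cos_le_one _
  have hsin : ∀ k : ℤ, |Real.sin (2 * Real.pi * (k * x))| ≤ 1 := fun _ => Real.abs_sin_le_one _
  have hodd : ∑' k : ℤ, (Real.sin (2 * Real.pi * (k * x)) * C k
      + Real.cos (2 * Real.pi * (k * x)) * S k) = 0 := by
    apply tsum_int_eq_zero_of_odd
    intro k
    have h1 : C (-k) = C k := by simp [C]
    have h2 : S (-k) = -S k := by simp [S, MeasureTheory.integral_neg]
    rw [h1, h2]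
    simp only [Int.cast_neg, neg_mul, mul_neg, Real.sin_neg, Real.cos_neg]
    ring
  have hP := congrArg Complex.re (SchwartzMap.tsum_eq_tsum_fourier f x)
  have hL : (∑' n : ℤ, f (x + n)).re = ∑' n : ℤ, Φ (x + n) := by
    have : ∀ n : ℤ, f (x + n) = ((Φ (x + n) : ℝ) : ℂ) := fun n => rfl
    simp_rw [this]
    rw [← Complex.ofReal_tsum, Complex.ofReal_re]
  have hterm : ∀ k : ℤ, (𝓕 f) (k : ℝ) * fourier k (x : UnitAddCircle)
      = ((C k : ℂ) - S k * Complex.I) * expTwoPi (k * x) := by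
    intro k
    rw [hF, fourier_coe_apply, expTwoPi]
    congr 2
    push_cast
    ring
  have hsum2 : Summable fun k : ℤ => ((C k : ℂ) - S k * Complex.I) * expTwoPi (k * x) :=
    Summable.of_norm_bounded hsum.norm fun k => by rw [norm_mul, norm_expTwoPi, mul_one]
  simp_rw [hterm] at hP
  rw [hL, Complex.re_tsum hsum2] at hP
  rw [hP, ← add_zero (∑' k : ℤ, _), ← hodd, ← Summable.tsum_add]
  · refine tsum_congr fun k => ?_
    rw [hT]
    simp only [Complex.mul_re, Complex.mul_im, Complex.sub_re, Complex.sub_im, expTwoPi_re,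
      expTwoPi_im, Complex.ofReal_re, Complex.ofReal_im, Complex.I_re, Complex.I_im]
    ring
  · exact (Complex.reCLM.summable hsum2)
  · exact (hbdd _ _ hsin hC).add (hbdd _ _ hcos hS)

lemma cosSinTransform_comp_mul_left (Φ : ℝ → ℝ) {s : ℝ} (hs : 0 < s) (ξ : ℝ) :
    cosSinTransform (fun x => Φ (s * x)) ξ = s⁻¹ * cosSinTransform Φ (ξ / s) := by
  have h := MeasureTheory.Measure.integral_comp_mul_left (fun x : ℝ =>
    (Real.cos (2 * Real.pi * (ξ / s) * x) + Real.sin (2 * Real.pi * (ξ / s) * x)) * Φ x) s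
  rw [abs_of_pos (inv_pos.2 hs), smul_eq_mul] at h
  rw [cosSinTransform, cosSinTransform, ← h]
  congr 1
  ext x
  have : 2 * Real.pi * (ξ / s) * (s * x) = 2 * Real.pi * ξ * x := by field_simp
  rw [this]

lemma tsum_mul_add_intCast_eq_tsum_cosSinTransform (hΦ : ContDiff ℝ (⊤ : ℕ∞) Φ)
    (hΦs : HasCompactSupport Φ) {s : ℝ} (hs : 0 < s) (x : ℝ) :
    (Summable fun k : ℤ => cosSinTransform Φ (k / s)) ∧
    ∑' n : ℤ, Φ (s * (x + n)) = s⁻¹ * ∑' k : ℤ, (Real.cos (2 * Real.pi * (k * x))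
      + Real.sin (2 * Real.pi * (k * x))) * cosSinTransform Φ (k / s) := by
  have h := tsum_add_intCast_eq_tsum_cosSinTransform (Φ := fun x => Φ (s * x))
    (hΦ.comp (contDiff_const.mul contDiff_id))
    (hΦs.comp_homeomorph (Homeomorph.mulLeft₀ s hs.ne')) x
  simp only [cosSinTransform_comp_mul_left Φ hs] at h
  refine ⟨(summable_mul_left_iff (inv_ne_zero hs.ne')).1 h.1, ?_⟩
  rw [h.2, ← tsum_mul_left]
  exact tsum_congr fun k => by ring

end Poisson

lemma tsum_int_eq_sum_tsum_residue (n : ℕ) [NeZero n] {f : ℤ → ℝ} (hf : Summable f) :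
    ∑' m, f m = ∑ r : Fin n, ∑' q : ℤ, f (q * n + r) := by
  have h := (Int.divModEquiv n).symm.tsum_eq f
  have hs : Summable fun x : ℤ × Fin n => f ((Int.divModEquiv n).symm x) :=
    (Int.divModEquiv n).symm.summable_iff.2 hf
  rw [← h, ← (Equiv.prodComm (Fin n) ℤ).tsum_eq]
  refine (Summable.tsum_prod ((Equiv.prodComm (Fin n) ℤ).summable_iff.2 hs)).trans ?_
  rw [tsum_fintype]
  rfl

lemma finite_support_mul_comp_div {Φ : ℝ → ℝ} (hΦs : HasCompactSupport Φ) {Y : ℝ} (hY : 0 < Y)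
    (c : ℤ → ℝ) : (Function.support fun m : ℤ => c m * Φ (m / Y)).Finite := by
  obtain ⟨R, hR⟩ := hΦs.isCompact.isBounded.subset_closedBall 0
  refine (Set.finite_Icc (-⌈R * Y⌉) ⌈R * Y⌉).subset fun m hm => ?_
  have hm1 : Φ (m / Y) ≠ 0 := right_ne_zero_of_mul hm
  have hm2 := hR (subset_tsupport _ hm1)
  rw [mem_closedBall_zero_iff, Real.norm_eq_abs, abs_div, abs_of_pos hY, div_le_iff₀ hY] at hm2
  have hm3 := abs_le.1 (hm2.trans (Int.le_ceil _))
  exact ⟨by exact_mod_cast hm3.1, by exact_mod_cast hm3.2⟩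

/-! ### The twisted Poisson formula and the main identity -/

lemma sum_jacobiSym_mul_cos_add_sin {p : ℕ} (hpp : p.Prime) (hp2 : p ≠ 2) (k : ℤ) :
    ∑ r : Fin p, (jacobiSym r p : ℝ) * (Real.cos (2 * Real.pi * (k * (r / p)))
      + Real.sin (2 * Real.pi * (k * (r / p)))) = jacobiSym k p * √p := by
  have : Fact p.Prime := ⟨hpp⟩
  have hsum : ∑ a : ZMod p, complexQuadraticChar p a * ZMod.stdAddChar ((k : ZMod p) * a)
      = complexQuadraticChar p k * gaussSum (complexQuadraticChar p) ZMod.stdAddChar := by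
    by_cases hk : (k : ZMod p) = 0
    · rw [hk, MulChar.map_zero, zero_mul]
      simp only [zero_mul, AddChar.map_zero_eq_one, mul_one]
      exact MulChar.sum_eq_zero_of_ne_one (complexQuadraticChar_ne_one hp2)
    · have h := gaussSum_mulShift_eq (complexQuadraticChar p) ZMod.stdAddChar (Units.mk0 _ hk)
      rw [(complexQuadraticChar_isQuadratic p).inv, Units.val_mk0] at h
      exact h
  have hbij : Function.Bijective fun r : Fin p => ((r : ℕ) : ZMod p) := by
    rw [Fintype.bijective_iff_injective_and_card]
    refine ⟨fun a b hab => Fin.ext ?_, by simp⟩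
    exact Nat.ModEq.eq_of_lt_of_lt ((ZMod.natCast_eq_natCast_iff _ _ _).1 hab) a.2 b.2
  have hfin : ∑ r : Fin p, ((jacobiSym r p : ℝ) : ℂ) * expTwoPi (k * (r / p))
      = ((jacobiSym k p : ℝ) : ℂ) * gaussSum (complexQuadraticChar p) ZMod.stdAddChar := by
    rw [Complex.ofReal_intCast, ← complexQuadraticChar_intCast, ← hsum]
    refine Fintype.sum_bijective _ hbij _ _ fun r => ?_
    have h1 : ((r : ℕ) : ZMod p) = ((r : ℤ) : ZMod p) := (Int.cast_natCast _).symm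
    rw [h1, complexQuadraticChar_intCast, Complex.ofReal_intCast, ← Int.cast_mul,
      stdAddChar_intCast_eq_expTwoPi]
    congr 2
    push_cast
    ring
  have hre := congrArg Complex.re hfin
  have him := congrArg Complex.im hfin
  simp only [Complex.re_sum, Complex.im_sum, Complex.re_ofReal_mul, Complex.im_ofReal_mul,
    expTwoPi_re, expTwoPi_im] at hre him
  rw [← gaussSum_re_add_im hp2, mul_add, ← hre, ← him, ← sum_add_distrib]
  exact sum_congr rfl fun r _ => mul_add _ _ _

lemma abs_jacobiSym_cast_le_one (k : ℤ) (n : ℕ) : |(jacobiSym k n : ℝ)| ≤ 1 := by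
  rcases jacobiSym.trichotomy k n with h | h | h <;> simp [h]

lemma summable_mul_cosSinTransform {Φ : ℝ → ℝ} (hΦ : ContDiff ℝ (⊤ : ℕ∞) Φ)
    (hΦs : HasCompactSupport Φ) {s : ℝ} (hs : 0 < s) {c : ℤ → ℝ} {C : ℝ}
    (hc : ∀ k, |c k| ≤ C) : Summable fun k : ℤ => c k * cosSinTransform Φ (k / s) := by
  have h := (tsum_mul_add_intCast_eq_tsum_cosSinTransform hΦ hΦs hs 0).1
  refine Summable.of_norm_bounded (h.norm.mul_left C) fun k => ?_
  rw [norm_mul]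
  exact mul_le_mul_of_nonneg_right (hc k) (norm_nonneg _)

lemma abs_cos_add_sin_le_two (x : ℝ) : |Real.cos x + Real.sin x| ≤ 2 :=
  (abs_add_le _ _).trans (by linarith [Real.abs_cos_le_one x, Real.abs_sin_le_one x])

theorem tsum_jacobiSym_mul_comp_div {Φ : ℝ → ℝ} (hΦ : ContDiff ℝ (⊤ : ℕ∞) Φ)
    (hΦs : HasCompactSupport Φ) {p : ℕ} (hpp : p.Prime) (hp2 : p ≠ 2) {Y : ℝ} (hY : 0 < Y) :
    ∑' m : ℤ, (jacobiSym m p : ℝ) * Φ (m / Y)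
      = Y / √p * ∑' k : ℤ, (jacobiSym k p : ℝ) * cosSinTransform Φ (k / (p / Y)) := by
  have : NeZero p := ⟨hpp.ne_zero⟩
  have hp0 : (0 : ℝ) < p := by exact_mod_cast hpp.pos
  have hs : 0 < p / Y := div_pos hp0 hY
  have hfs : Summable fun m : ℤ => (jacobiSym m p : ℝ) * Φ (m / Y) :=
    summable_of_hasFiniteSupport (finite_support_mul_comp_div hΦs hY _)
  have hterm : ∀ r : Fin p, ∑' q : ℤ, (jacobiSym (q * p + r) p : ℝ) * Φ ((q * p + r : ℤ) / Y)
      = ∑' k : ℤ, (p / Y)⁻¹ * ((jacobiSym r p : ℝ) * (Real.cos (2 * Real.pi * (k * (r / p)))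
        + Real.sin (2 * Real.pi * (k * (r / p)))) * cosSinTransform Φ (k / (p / Y))) := by
    intro r
    have h1 : ∀ q : ℤ, jacobiSym (q * p + r) p = jacobiSym r p := fun q => by
      rw [jacobiSym.mod_left, Int.mul_add_emod_self_right, ← jacobiSym.mod_left]
    have h2 : ∀ q : ℤ, ((q * p + r : ℤ) : ℝ) / Y = p / Y * (r / p + q) := fun q => by
      push_cast
      field_simp
      ring
    simp_rw [h1, h2]
    rw [tsum_mul_left, (tsum_mul_add_intCast_eq_tsum_cosSinTransform hΦ hΦs hs _).2,
      tsum_mul_left, mul_left_comm, ← tsum_mul_left]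
    simp_rw [mul_assoc]
  rw [tsum_int_eq_sum_tsum_residue p hfs, sum_congr rfl fun r _ => hterm r,
    ← Summable.tsum_finsetSum, ← tsum_mul_left]
  · refine tsum_congr fun k => ?_
    rw [← mul_sum, ← sum_mul, sum_jacobiSym_mul_cos_add_sin hpp hp2]
    have h3 : √(p : ℝ) ≠ 0 := (Real.sqrt_pos.2 hp0).ne'
    have h4 : (p / Y)⁻¹ * √p = Y / √p := by
      have := Real.mul_self_sqrt hp0.le
      field_simp
      rw [sq, this]
    rw [← h4]
    ring
  · intro r _
    refine Summable.mul_left _ (summable_mul_cosSinTransform hΦ hΦs hs (C := 1 * 2) fun k => ?_)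
    rw [abs_mul]
    exact mul_le_mul (abs_jacobiSym_cast_le_one _ _) (abs_cos_add_sin_le_two _) (abs_nonneg _)
      zero_le_one

lemma neg_one_zpow_two_mul_add (q r : ℤ) : (-1 : ℝ) ^ (q * 2 + r) = (-1) ^ r := by
  rw [zpow_add₀ (by norm_num), mul_comm, mul_comm q, zpow_mul]
  simp

theorem tsum_odd_jacobiSym_mul_comp_div {Φ : ℝ → ℝ} (hΦ : ContDiff ℝ (⊤ : ℕ∞) Φ)
    (hΦs : HasCompactSupport Φ) {p : ℕ} (hpp : p.Prime) (hp2 : p ≠ 2) {Y : ℝ} (hY : 0 < Y) :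
    ∑' q : ℤ, (jacobiSym (q * 2 + 1) p : ℝ) * Φ ((q * 2 + 1 : ℤ) / Y)
      = Y * jacobiSym 2 p / (2 * √p) * ∑' k : ℤ, (-1 : ℝ) ^ k * (jacobiSym k p : ℝ) *
          cosSinTransform Φ (k * Y / (2 * p)) := by
  have hp0 : (0 : ℝ) < p := by exact_mod_cast hpp.pos
  have hJ2 : (jacobiSym 2 p : ℝ) * jacobiSym 2 p = 1 := by
    have h := jacobiSym.sq_one (a := 2) (b := p)
      ((Nat.coprime_primes Nat.prime_two hpp).2 hp2.symm)
    rw [sq] at h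
    exact_mod_cast h
  let B : ℤ → ℝ := fun k => jacobiSym k p * cosSinTransform Φ (k * Y / (2 * p))
  have hB : Summable B := by
    have h := summable_mul_cosSinTransform hΦ hΦs (s := p / (Y / 2)) (by positivity)
      fun k => abs_jacobiSym_cast_le_one k p
    refine h.congr fun k => ?_
    simp only [B]
    congr 2
    field_simp
  have hE : Summable fun k : ℤ => (-1 : ℝ) ^ k * B k := by
    refine Summable.of_norm_bounded (f := fun k : ℤ => (-1 : ℝ) ^ k * B k) hB.norm fun k => ?_
    simp
  have hhalf : ∑' m : ℤ, (jacobiSym m p : ℝ) * Φ (m / (Y / 2)) = Y / 2 / √p * ∑' k, B k := by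
    rw [tsum_jacobiSym_mul_comp_div hΦ hΦs hpp hp2 (half_pos hY)]
    congr 1
    refine tsum_congr fun k => ?_
    simp only [B]
    congr 2
    field_simp
  have hfull : ∑' m : ℤ, (jacobiSym m p : ℝ) * Φ (m / Y)
      = Y / √p * (jacobiSym 2 p * ∑' k : ℤ, B (k * 2)) := by
    rw [tsum_jacobiSym_mul_comp_div hΦ hΦs hpp hp2 hY,
      ← tsum_mul_left (a := (jacobiSym 2 p : ℝ))]
    congr 1
    refine tsum_congr fun k => ?_
    simp only [B]
    rw [jacobiSym.mul_left]
    have h : ((k * 2 : ℤ) : ℝ) * Y / (2 * p) = k / (p / Y) := by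
      push_cast
      field_simp
    rw [h, Int.cast_mul]
    linear_combination (-(jacobiSym k p : ℝ) * cosSinTransform Φ (k / (p / Y))) * hJ2
  have hfs : Summable fun m : ℤ => (jacobiSym m p : ℝ) * Φ (m / Y) :=
    summable_of_hasFiniteSupport (finite_support_mul_comp_div hΦs hY _)
  have hsplit := tsum_int_eq_sum_tsum_residue 2 hfs
  have hsplitB := tsum_int_eq_sum_tsum_residue 2 hB
  have hsplitE := tsum_int_eq_sum_tsum_residue 2 hE
  simp only [Fin.sum_univ_two, Fin.val_zero, Fin.val_one, Nat.cast_ofNat, Nat.cast_zero,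
    Nat.cast_one, neg_one_zpow_two_mul_add, zpow_zero, zpow_one, one_mul, neg_mul, tsum_neg,
    add_zero] at hsplit hsplitB hsplitE
  have heven : ∑' q : ℤ, (jacobiSym (q * 2) p : ℝ) * Φ ((q * 2 : ℤ) / Y)
      = jacobiSym 2 p * ∑' m : ℤ, (jacobiSym m p : ℝ) * Φ (m / (Y / 2)) := by
    rw [← tsum_mul_left]
    refine tsum_congr fun q => ?_
    have h : ((q * 2 : ℤ) : ℝ) / Y = q / (Y / 2) := by
      push_cast
      field_simp
    rw [h, jacobiSym.mul_left, Int.cast_mul]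
    ring
  rw [heven, hhalf, hfull] at hsplit
  have hEB : ∑' k : ℤ, (-1 : ℝ) ^ k * (jacobiSym k p : ℝ) *
      cosSinTransform Φ (k * Y / (2 * p)) = ∑' k : ℤ, (-1 : ℝ) ^ k * B k :=
    tsum_congr fun k => mul_assoc _ _ _
  rw [hEB]
  have h3 : √(p : ℝ) ≠ 0 := (Real.sqrt_pos.2 hp0).ne'
  have h5 : Y * jacobiSym 2 p / (2 * √p) = Y / √p * (jacobiSym 2 p / 2) := by field_simp
  rw [h5]
  linear_combination -hsplit + Y / √p * jacobiSym 2 p / 2 * (-hsplitB - hsplitE)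

lemma tsum_odd_sq_dvd_jacobiSym_mul_comp_div {Φ : ℝ → ℝ} (hΦ : ContDiff ℝ (⊤ : ℕ∞) Φ)
    (hΦs : HasCompactSupport Φ) {p : ℕ} (hpp : p.Prime) (hp2 : p ≠ 2) {X : ℝ} (hX : 0 < X)
    {a : ℕ} (ha : 0 < a) :
    ∑' d : ℤ, (if Odd d ∧ (a : ℤ) ^ 2 ∣ d then (jacobiSym d p : ℝ) else 0) * Φ (d / X)
      = if Odd a ∧ ¬ p ∣ a then X / a ^ 2 * jacobiSym 2 p / (2 * √p) *
          ∑' k : ℤ, (-1 : ℝ) ^ k * (jacobiSym k p : ℝ) *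
            cosSinTransform Φ (k * X / (2 * (a : ℝ) ^ 2 * p)) else 0 := by
  have ha0 : (0 : ℝ) < a := by exact_mod_cast ha
  split_ifs with h
  · obtain ⟨hodd, hpa⟩ := h
    have haodd : Odd ((a : ℤ) ^ 2) := ((Int.odd_coe_nat a).2 hodd).pow
    have hJa : jacobiSym ((a : ℤ) ^ 2) p = 1 := by
      rw [jacobiSym.pow_left]
      exact jacobiSym.sq_one (by simpa using ((Nat.Prime.coprime_iff_not_dvd hpp).2 hpa).symm)
    let g : ℤ → ℤ := fun q => (a : ℤ) ^ 2 * (q * 2 + 1)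
    have hg : Function.Injective g := fun x y hxy => by
      have := mul_left_cancel₀ (pow_ne_zero 2 (Int.natCast_ne_zero.2 ha.ne')) hxy
      omega
    rw [← hg.tsum_eq]
    · have htransform : ∀ k : ℤ, cosSinTransform Φ (k * X / (2 * (a : ℝ) ^ 2 * p))
          = cosSinTransform Φ (k * (X / a ^ 2) / (2 * p)) := fun k => by
        congr 1
        field_simp
      simp_rw [htransform]
      rw [← tsum_odd_jacobiSym_mul_comp_div hΦ hΦs hpp hp2 (by positivity)]
      refine tsum_congr fun q => ?_
      have hq : Odd (q * 2 + 1) := ⟨q, by ring⟩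
      rw [if_pos ⟨haodd.mul hq, dvd_mul_right _ _⟩, jacobiSym.mul_left, hJa, one_mul]
      congr 2
      simp only [g]
      push_cast
      field_simp
    · intro d hd
      have hd1 : Odd d ∧ (a : ℤ) ^ 2 ∣ d := by
        by_contra hn
        exact hd (by simp only [if_neg hn, zero_mul])
      obtain ⟨m, rfl⟩ := hd1.2
      obtain ⟨q, rfl⟩ := (Int.odd_mul.1 hd1.1).2
      exact ⟨q, by simp only [g]; ring⟩
  · refine (tsum_congr fun d => mul_eq_zero_of_left ?_ _).trans tsum_zero
    split_ifs with hd
    · obtain ⟨m, hm⟩ := hd.2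
      have hodd : Odd a := by
        rw [← Int.odd_coe_nat]
        rw [hm] at hd
        exact (Int.odd_pow.1 (Int.odd_mul.1 hd.1).1).resolve_right two_ne_zero
      have hpa : p ∣ a := by
        by_contra hn
        exact h ⟨hodd, hn⟩
      have hzero : jacobiSym d p = 0 := by
        have hpd : p ∣ d.natAbs := by
          rw [hm, Int.natAbs_mul, Int.natAbs_pow, Int.natAbs_natCast]
          exact (dvd_pow hpa two_ne_zero).mul_right _
        rw [jacobiSym.eq_zero_iff, Int.gcd, Int.natAbs_natCast, Nat.gcd_eq_right hpd]
        exact ⟨hpp.ne_zero, hpp.ne_one⟩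
      exact_mod_cast hzero
    · rfl

theorem soundararajan_poisson_identity
    (Φ : ℝ → ℝ) (hΦsmooth : ContDiff ℝ (⊤ : ℕ∞) Φ) (hΦsupp : HasCompactSupport Φ)
    (hΦpos : ∀ x, 0 ≤ Φ x) (hΦne : ∃ x, Φ x ≠ 0)
    (β : ℝ) (hβ : β = sSup ((fun x => |x|) '' {x : ℝ | 0 < Φ x}))
    (p : ℕ) (hp : p.Prime) (hp2 : p ≠ 2)
    (X : ℝ) (hX : 0 < X) (A : ℝ) (hA : 0 < A) (hAX : A ≤ Real.sqrt (β * X)) :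
    (1 / X) * (∑ᶠ d ∈ {d : ℤ | Odd d},
        (∑ a ∈ (Finset.range (Nat.floor A + 1)).filter
            (fun a : ℕ => 0 < a ∧ (a : ℝ) ≤ A ∧ (a : ℤ) ^ 2 ∣ |d|),
          (ArithmeticFunction.moebius a : ℝ)) *
          Φ ((d : ℝ) / X) * (jacobiSym d p : ℝ) * Real.sqrt p)
      = (1 / 2) * (jacobiSym 2 p : ℝ) *
          ∑ a ∈ (Finset.range (Nat.floor A + 1)).filter
              (fun a : ℕ => 0 < a ∧ (a : ℝ) ≤ A ∧ Odd a ∧ ¬ (p ∣ a)),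
            ((ArithmeticFunction.moebius a : ℝ) / (a : ℝ) ^ 2) *
              ∑' k : ℤ, (-1 : ℝ) ^ k * (jacobiSym k p : ℝ) *
                cosSinTransform Φ ((k : ℝ) * X / (2 * (a : ℝ) ^ 2 * p)) := by
  classical
  have hsqrt : √(p : ℝ) ≠ 0 := (Real.sqrt_pos.2 (by exact_mod_cast hp.pos)).ne'
  set S := (Finset.range (Nat.floor A + 1)).filter (fun a : ℕ => 0 < a ∧ (a : ℝ) ≤ A) with hS
  have hterm : ∀ d : ℤ, (∑ᶠ _ : d ∈ {d : ℤ | Odd d},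
        (∑ a ∈ (Finset.range (Nat.floor A + 1)).filter
            (fun a : ℕ => 0 < a ∧ (a : ℝ) ≤ A ∧ (a : ℤ) ^ 2 ∣ |d|),
          (ArithmeticFunction.moebius a : ℝ)) *
          Φ ((d : ℝ) / X) * (jacobiSym d p : ℝ) * Real.sqrt p)
      = ∑ a ∈ S, (ArithmeticFunction.moebius a * √p) *
        ((if Odd d ∧ (a : ℤ) ^ 2 ∣ d then (jacobiSym d p : ℝ) else 0) * Φ (d / X)) := by
    intro d
    rw [finsum_eq_if]
    split_ifs with hd
    · simp_rw [← and_assoc, dvd_abs]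
      rw [← filter_filter, ← hS, sum_filter, sum_mul, sum_mul, sum_mul]
      refine sum_congr rfl fun a _ => ?_
      have hd' : Odd d := hd
      by_cases h : (a : ℤ) ^ 2 ∣ d
      · simp only [h, hd', and_self, if_true]
        ring
      · simp [h]
    · have hd' : ¬ Odd d := hd
      simp [hd']
  have hsum : ∀ a : ℕ, (Function.support fun d : ℤ => (ArithmeticFunction.moebius a * √p) *
        ((if Odd d ∧ (a : ℤ) ^ 2 ∣ d then (jacobiSym d p : ℝ) else 0) * Φ (d / X))).Finite :=
    fun a => (finite_support_mul_comp_div hΦsupp hX _).subset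
      (Function.support_mul_subset_right _ _)
  rw [finsum_congr hterm, finsum_sum_comm _ _ fun a _ => hsum a, mul_sum, mul_sum]
  have hfilter : (Finset.range (Nat.floor A + 1)).filter
      (fun a : ℕ => 0 < a ∧ (a : ℝ) ≤ A ∧ Odd a ∧ ¬ (p ∣ a))
      = S.filter fun a => Odd a ∧ ¬ p ∣ a := by
    rw [hS, filter_filter]
    simp only [and_assoc]
  rw [hfilter, sum_filter (fun a => Odd a ∧ ¬ p ∣ a)]
  refine sum_congr rfl fun a ha => ?_
  have ha0 : 0 < a := (mem_filter.1 ha).2.1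
  have haR : (a : ℝ) ≠ 0 := by exact_mod_cast ha0.ne'
  rw [← tsum_eq_finsum (L := SummationFilter.unconditional ℤ) (hsum a), tsum_mul_left,
    tsum_odd_sq_dvd_jacobiSym_mul_comp_div hΦsmooth hΦsupp hp hp2 hX ha0]
  split_ifs with h
  · field_simp
  · simp
end

section
/- Define b_n for positive integers n by b_n = 0 if n is even and b_n = Σ_{a ∣ n} μ(a)/a if n is odd. Then for every complex number s with Re(s) > 1, the Dirichlet series Σ_{n ≥ 1} b_n · n^{−s} converges and equals ((1 − 2^{−s})/(1 − 2^{−s−1})) · ζ(s)/ζ(s+1), where ζ is the Riemann zeta function. -/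
open Finset

/-- The coefficients `b_n`: `b_n = 0` for even `n`, and `b_n = Σ_{a ∣ n} μ(a)/a`
for odd `n`. -/
noncomputable def bCoeff (n : ℕ) : ℂ :=
  if Odd n then ∑ a ∈ n.divisors, (ArithmeticFunction.moebius a : ℂ) / a else 0

/-- The principal Dirichlet character modulo `2` is the indicator function of odd numbers. -/
lemma dirichletCharacter_two_one_apply (n : ℕ) :
    (1 : DirichletCharacter ℂ 2) n = if Odd n then 1 else 0 := by
  split_ifs with h
  · rw [MulChar.one_apply ((ZMod.isUnit_iff_coprime n 2).mpr (Nat.coprime_two_right.mpr h))]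
  · exact MulChar.map_nonunit _ fun hu =>
      h (Nat.coprime_two_right.mp ((ZMod.isUnit_iff_coprime n 2).mp hu))

lemma LSeries_dirichletCharacter_two_one {s : ℂ} (hs : 1 < s.re) :
    LSeries (fun n => (1 : DirichletCharacter ℂ 2) n) s = (1 - 2 ^ (-s)) * riemannZeta s := by
  have h1 : s ≠ 1 := by rintro rfl; simp at hs
  rw [← DirichletCharacter.LFunction_eq_LSeries _ hs]
  have h := DirichletCharacter.LFunctionTrivChar_eq_mul_riemannZeta (N := 2) h1
  rw [Nat.Prime.primeFactors Nat.prime_two, prod_singleton] at h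
  exact_mod_cast h

lemma LSeries_term_div_natCast (f : ℕ → ℂ) (s : ℂ) :
    LSeries.term (fun n => f n / n) s = LSeries.term f (s + 1) := by
  ext n
  rcases eq_or_ne n 0 with rfl | hn
  · simp
  · have hn' : (n : ℂ) ≠ 0 := Nat.cast_ne_zero.mpr hn
    rw [LSeries.term_of_ne_zero hn, LSeries.term_of_ne_zero hn, Complex.cpow_add _ _ hn',
      Complex.cpow_one, div_div, mul_comm (n : ℂ)]

open scoped LSeries.notation in
lemma bCoeff_eq_convolution :
    bCoeff = (fun n : ℕ => (1 : DirichletCharacter ℂ 2) n) ⍟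
      (fun n : ℕ => (1 : DirichletCharacter ℂ 2) n * (ArithmeticFunction.moebius n : ℂ) / n) := by
  ext n
  simp only [LSeries.convolution_def, dirichletCharacter_two_one_apply]
  rw [Nat.sum_divisorsAntidiagonal' (n := n) (f := fun x y => (if Odd x then (1 : ℂ) else 0) *
    ((if Odd y then (1 : ℂ) else 0) * (ArithmeticFunction.moebius y : ℂ) / y)), bCoeff]
  split_ifs with h
  · refine sum_congr rfl fun a ha => ?_
    have had := Nat.dvd_of_mem_divisors ha
    rw [if_pos (h.of_dvd_nat (Nat.div_dvd_of_dvd had)), if_pos (h.of_dvd_nat had), one_mul, one_mul]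
  · refine (sum_eq_zero fun a ha => ?_).symm
    have had := Nat.dvd_of_mem_divisors ha
    by_cases h1 : Odd (n / a)
    · have h2 : ¬ Odd a := fun h2 => h (Nat.div_mul_cancel had ▸ h1.mul h2)
      simp [h2]
    · simp [h1]

theorem bCoeff_dirichlet_series (s : ℂ) (hs : 1 < s.re) :
    HasSum (fun n : ℕ => bCoeff n * (n : ℂ) ^ (-s))
      (((1 - 2 ^ (-s)) / (1 - 2 ^ (-s - 1))) * riemannZeta s / riemannZeta (s + 1)) := by
  have hs1 : 1 < (s + 1).re := by simp; linarith
  set χ : DirichletCharacter ℂ 2 := 1 with hχ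
  have hA : LSeriesHasSum (fun n => χ n) s ((1 - 2 ^ (-s)) * riemannZeta s) := by
    rw [← LSeries_dirichletCharacter_two_one hs]
    exact (DirichletCharacter.LSeriesSummable_of_one_lt_re χ hs).LSeriesHasSum
  have hB : LSeriesHasSum (fun n => χ n * (ArithmeticFunction.moebius n : ℂ) / n) s
      ((1 - 2 ^ (-(s + 1))) * riemannZeta (s + 1))⁻¹ := by
    have hsum := DirichletCharacter.LSeriesSummable_mul χ
      (ArithmeticFunction.LSeriesSummable_moebius_iff.mpr hs1)
    have hmul := DirichletCharacter.LSeries.mul_mu_eq_one χ hs1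
    rw [LSeries_dirichletCharacter_two_one hs1] at hmul
    rw [LSeriesHasSum, LSeries_term_div_natCast, inv_eq_of_mul_eq_one_right hmul]
    exact hsum.LSeriesHasSum
  have hAB := hA.convolution hB
  rw [hχ, ← bCoeff_eq_convolution, LSeriesHasSum] at hAB
  convert! hAB using 1
  · ext n
    rcases eq_or_ne n 0 with rfl | hn
    · simp [bCoeff]
    · rw [LSeries.term_of_ne_zero hn, Complex.cpow_neg, div_eq_mul_inv]
  · rw [neg_add', mul_inv]
    ring
end

section
/- Let a > 0 be a real number and let b ∈ (0, 1]. Then lim_{X → ∞} (1/(aX^b)) · Σ_{N ∈ ℤ, X ≤ N ≤ X + aX^b, N ≢ 2 (mod 4)} φ(N)/N = 5/π². -/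
open Filter Topology Finset

open scoped ArithmeticFunction.Moebius

theorem hasSum_moebius_div_sq :
    HasSum (fun n : ℕ => (μ n : ℝ) / (n : ℝ) ^ 2) (6 / Real.pi ^ 2) := by
  have h2 : (1 : ℝ) < (2 : ℂ).re := by norm_num
  have hs := (ArithmeticFunction.LSeriesSummable_moebius_iff.mpr h2).LSeriesHasSum
  have hL := LSeries_one_mul_Lseries_moebius h2
  rw [LSeries_one_eq_riemannZeta h2, riemannZeta_two] at hL
  have hpi : (Real.pi : ℂ) ≠ 0 := by exact_mod_cast Real.pi_ne_zero
  have hval : LSeries (fun n => (μ n : ℂ)) 2 = ((6 / Real.pi ^ 2 : ℝ) : ℂ) := by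
    push_cast
    field_simp at hL ⊢
    linear_combination hL
  rw [hval, LSeriesHasSum] at hs
  rw [← Complex.hasSum_ofReal]
  convert hs using 2 with n
  rcases eq_or_ne n 0 with rfl | hn
  · simp
  · rw [LSeries.term_of_ne_zero hn]
    push_cast
    congr 1
    norm_cast

theorem moebius_two_mul (m : ℕ) : μ (2 * m) = if Odd m then -μ m else 0 := by
  split_ifs with h
  · rw [ArithmeticFunction.isMultiplicative_moebius.map_mul_of_coprime
      (Nat.coprime_two_left.mpr h), ArithmeticFunction.moebius_apply_prime Nat.prime_two]
    ring
  · obtain ⟨k, rfl⟩ := even_iff_two_dvd.mp (Nat.not_odd_iff_even.mp h)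
    refine ArithmeticFunction.moebius_eq_zero_of_not_squarefree fun hsq => ?_
    have := hsq 2 ⟨k, by ring⟩
    simp at this

theorem hasSum_odd_moebius_div_sq :
    HasSum (fun n : ℕ => if Odd n then (μ n : ℝ) / (n : ℝ) ^ 2 else 0) (8 / Real.pi ^ 2) := by
  set o : ℕ → ℝ := fun n => if Odd n then (μ n : ℝ) / (n : ℝ) ^ 2 else 0 with ho
  have hall := hasSum_moebius_div_sq
  have hsum : Summable o := by
    refine Summable.of_norm_bounded hall.summable.norm fun n => ?_
    simp only [ho]
    split_ifs <;> simp
    positivity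
  obtain ⟨S, hS⟩ := hsum
  have heven : HasSum (fun n : ℕ => if Odd n then 0 else (μ n : ℝ) / (n : ℝ) ^ 2)
      (-(1 / 4) * S + 0) := by
    refine HasSum.even_add_odd ?_ ?_
    · refine (hS.mul_left (-(1 / 4))).congr_fun fun m => ?_
      simp only [ho]
      rw [if_neg (by simp), moebius_two_mul]
      split_ifs
      · push_cast
        ring
      · simp
    · simp [hasSum_zero]
  have hadd : HasSum (fun n : ℕ => (μ n : ℝ) / (n : ℝ) ^ 2) (S + (-(1 / 4) * S + 0)) := by
    convert hS.add heven using 2 with n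
    simp only [ho]
    split_ifs <;> simp
  have htot := hadd.unique hall
  convert hS using 1
  linear_combination (-4 / 3) * htot

/-- The function `d ↦ μ(d)/d` restricted to odd `d`. -/
noncomputable def oddMoebiusDiv : ArithmeticFunction ℝ where
  toFun d := if Odd d then (μ d : ℝ) / d else 0
  map_zero' := by simp

/-- The weight `1, 0, 1, 1/2` on the residue classes `1, 2, 3, 0` modulo `4`. -/
noncomputable def modFourWeight : ArithmeticFunction ℝ where
  toFun n := if n = 0 then 0 else if Odd n then 1 else if n % 4 = 2 then 0 else 1 / 2
  map_zero' := by simp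

theorem sum_moebius_div_eq_totient_div {n : ℕ} (hn : 0 < n) :
    ∑ d ∈ n.divisors, (μ d : ℝ) / d = (n.totient : ℝ) / n := by
  have h := (ArithmeticFunction.sum_eq_iff_sum_mul_moebius_eq
    (f := fun n => (n.totient : ℝ)) (g := fun n => (n : ℝ))).mp
    (fun n _ => by exact_mod_cast n.sum_totient) n hn
  rw [← h, Finset.sum_div, ← Nat.sum_divisorsAntidiagonal (fun d _ => (μ d : ℝ) / d)]
  refine Finset.sum_congr rfl fun x hx => ?_
  obtain ⟨hx, -⟩ := Nat.mem_divisorsAntidiagonal.mp hx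
  have h1 : (x.1 : ℝ) ≠ 0 := by
    rintro h
    simp_all
  have h2 : (x.2 : ℝ) ≠ 0 := by
    rintro h
    simp_all
  rw [← hx]
  push_cast
  field_simp

theorem sum_divisors_oddMoebiusDiv_of_odd {n : ℕ} (hn : Odd n) :
    ∑ d ∈ n.divisors, oddMoebiusDiv d = (n.totient : ℝ) / n := by
  rw [← sum_moebius_div_eq_totient_div hn.pos]
  refine Finset.sum_congr rfl fun d hd => ?_
  exact if_pos (hn.of_dvd_nat (Nat.dvd_of_mem_divisors hd))

theorem sum_divisors_oddMoebiusDiv_of_even {n : ℕ} (hn : Even n) (hn0 : n ≠ 0) :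
    ∑ d ∈ n.divisors, oddMoebiusDiv d = 2 * ((n.totient : ℝ) / n) := by
  obtain ⟨k, m, hm, rfl⟩ := Nat.exists_eq_two_pow_mul_odd hn0
  have hk : k ≠ 0 := by
    rintro rfl
    simp at hn
    exact (Nat.not_odd_iff_even.mpr hn) hm
  have hcop : Nat.Coprime (2 ^ k) m := (Nat.coprime_two_left.mpr hm).pow_left k
  have hsub : m.divisors ⊆ (2 ^ k * m).divisors :=
    Nat.divisors_subset_of_dvd hn0 (Dvd.intro_left _ rfl)
  rw [← Finset.sum_subset hsub, sum_divisors_oddMoebiusDiv_of_odd hm, Nat.totient_mul hcop,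
    Nat.totient_prime_pow Nat.prime_two (Nat.pos_of_ne_zero hk)]
  · have : (m : ℝ) ≠ 0 := by exact_mod_cast hm.pos.ne'
    obtain ⟨j, rfl⟩ := Nat.exists_eq_succ_of_ne_zero hk
    push_cast
    simp [pow_succ]
    field_simp
  · intro d hd hd'
    refine if_neg fun hodd => hd' ?_
    refine Nat.mem_divisors.mpr ⟨?_, hm.pos.ne'⟩
    exact ((Nat.coprime_two_right.mpr hodd).pow_right k).dvd_of_dvd_mul_left
      (Nat.dvd_of_mem_divisors hd)

theorem oddMoebiusDiv_mul_modFourWeight {n : ℕ} (hn : 0 < n) :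
    (oddMoebiusDiv * modFourWeight) n = if n % 4 = 2 then 0 else (n.totient : ℝ) / n := by
  have key : (oddMoebiusDiv * modFourWeight) n =
      (∑ d ∈ n.divisors, oddMoebiusDiv d) * modFourWeight n := by
    rw [ArithmeticFunction.mul_apply, ← Nat.sum_divisorsAntidiagonal (fun d _ => oddMoebiusDiv d),
      Finset.sum_mul]
    refine Finset.sum_congr rfl fun x hx => ?_
    obtain ⟨hx, -⟩ := Nat.mem_divisorsAntidiagonal.mp hx
    by_cases ho : Odd x.1
    · congr 1
      have h1 : x.2 ≠ 0 := by
        rintro h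
        simp_all
      have h2 : Odd n ↔ Odd x.2 := by rw [← hx, Nat.odd_mul]; simp [ho]
      have h3 : n % 4 = 2 ↔ x.2 % 4 = 2 := by
        obtain ⟨j, hj⟩ := ho
        have : n = 2 * (j * x.2) + x.2 := by rw [← hx, hj]; ring
        rcases Nat.even_or_odd' x.2 with ⟨i, hi | hi⟩
        · have : n = 4 * (j * i) + x.2 := by rw [this, hi]; ring
          omega
        · omega
      simp only [modFourWeight, ArithmeticFunction.coe_mk, h1, hn.ne', h2, h3]
    · simp [oddMoebiusDiv, ho]
  rw [key]
  rcases Nat.even_or_odd n with he | ho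
  · rw [sum_divisors_oddMoebiusDiv_of_even he hn.ne']
    have : ¬ Odd n := Nat.not_odd_iff_even.mpr he
    simp only [modFourWeight, ArithmeticFunction.coe_mk, hn.ne', this, if_false]
    split_ifs <;> ring
  · rw [sum_divisors_oddMoebiusDiv_of_odd ho]
    have : n % 4 ≠ 2 := by
      obtain ⟨j, hj⟩ := ho
      omega
    simp [modFourWeight, hn.ne', ho, this]

theorem sum_modFourWeight (m : ℕ) :
    ∑ n ∈ Ioc 0 m, modFourWeight n = 5 / 8 * m +
      (if m % 4 = 0 then 0 else if m % 4 = 1 then 3 / 8 else if m % 4 = 2 then -1 / 4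
        else 1 / 8) := by
  induction m with
  | zero => simp
  | succ m ih =>
    rw [Finset.sum_Ioc_succ_top (Nat.zero_le m), ih]
    have h4 : m % 4 < 4 := Nat.mod_lt _ (by norm_num)
    simp only [modFourWeight, ArithmeticFunction.coe_mk, Nat.odd_iff]
    have hcases : m % 4 = 0 ∨ m % 4 = 1 ∨ m % 4 = 2 ∨ m % 4 = 3 := by omega
    rcases hcases with h | h | h | h
    · have h1 : (m + 1) % 4 = 1 := by omega
      have h2 : (m + 1) % 2 = 1 := by omega
      simp [h, h1, h2]; ring
    · have h1 : (m + 1) % 4 = 2 := by omega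
      have h2 : (m + 1) % 2 = 0 := by omega
      simp [h, h1, h2]; ring
    · have h1 : (m + 1) % 4 = 3 := by omega
      have h2 : (m + 1) % 2 = 1 := by omega
      simp [h, h1, h2]; ring
    · have h1 : (m + 1) % 4 = 0 := by omega
      have h2 : (m + 1) % 2 = 0 := by omega
      simp [h, h1, h2]; ring

theorem abs_sum_modFourWeight_div_sub_le (n d : ℕ) :
    |∑ m ∈ Ioc 0 (n / d), modFourWeight m - 5 / 8 * ((n : ℝ) / d)| ≤ 1 := by
  have h1 : ((n / d : ℕ) : ℝ) ≤ (n : ℝ) / d := Nat.cast_div_le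
  have h2 : (n : ℝ) / d < (n / d : ℕ) + 1 := by
    rw [← Nat.floor_div_eq_div (K := ℝ)]
    exact Nat.lt_floor_add_one _
  rw [sum_modFourWeight, abs_le]
  constructor <;> split_ifs <;> linarith

theorem abs_oddMoebiusDiv_le (d : ℕ) : |oddMoebiusDiv d| ≤ (d : ℝ)⁻¹ := by
  simp only [oddMoebiusDiv, ArithmeticFunction.coe_mk]
  split_ifs
  · rw [abs_div, Nat.abs_cast, div_eq_mul_inv]
    refine mul_le_of_le_one_left (by positivity) ?_
    exact_mod_cast ArithmeticFunction.abs_moebius_le_one (n := d)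
  · simp

theorem abs_sum_oddMoebiusDiv_div_sub_le {n : ℕ} (hn : n ≠ 0) :
    |∑ d ∈ Ioc 0 n, oddMoebiusDiv d / d - 8 / Real.pi ^ 2| ≤ (n : ℝ)⁻¹ := by
  have hS : HasSum (fun d : ℕ => oddMoebiusDiv d / d) (8 / Real.pi ^ 2) := by
    convert hasSum_odd_moebius_div_sq using 2 with d
    simp only [oddMoebiusDiv, ArithmeticFunction.coe_mk]
    split_ifs
    · rw [div_div, sq]
    · simp
  have hlim : Tendsto (fun M : ℕ => |∑ d ∈ Ioc 0 n, oddMoebiusDiv d / d -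
      ∑ d ∈ range (M + 1), oddMoebiusDiv d / d|) atTop
      (𝓝 |∑ d ∈ Ioc 0 n, oddMoebiusDiv d / d - 8 / Real.pi ^ 2|) :=
    (tendsto_const_nhds.sub ((tendsto_add_atTop_iff_nat 1).mpr hS.tendsto_sum_nat)).abs
  refine le_of_tendsto hlim ?_
  filter_upwards [eventually_ge_atTop n] with M hM
  have hr : ∑ d ∈ range (M + 1), oddMoebiusDiv d / d = ∑ d ∈ Ioc 0 M, oddMoebiusDiv d / d := by
    refine (Finset.sum_subset (fun x hx => ?_) fun x hx hx' => ?_).symm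
    · simp at hx ⊢
      omega
    · have : x = 0 := by
        simp at hx hx'
        omega
      simp [this]
  rw [hr, ← Finset.sum_Ioc_consecutive _ (Nat.zero_le n) hM, sub_add_cancel_left, abs_neg]
  refine (Finset.abs_sum_le_sum_abs _ _).trans ?_
  calc ∑ d ∈ Ioc n M, |oddMoebiusDiv d / d| ≤ ∑ d ∈ Ioc n M, ((d : ℝ) ^ 2)⁻¹ := by
        refine Finset.sum_le_sum fun d _ => ?_
        rw [abs_div, Nat.abs_cast, sq, mul_inv, div_eq_mul_inv]
        gcongr
        exact abs_oddMoebiusDiv_le d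
    _ ≤ (n : ℝ)⁻¹ - (M : ℝ)⁻¹ := sum_Ioc_inv_sq_le_sub hn hM
    _ ≤ (n : ℝ)⁻¹ := by simp

theorem abs_sum_totient_div_sub_le {n : ℕ} (hn : n ≠ 0) :
    |∑ N ∈ Ioc 0 n, (if N % 4 = 2 then 0 else (N.totient : ℝ) / N) - 5 / Real.pi ^ 2 * n| ≤
      2 + Real.log n := by
  have hn' : (n : ℝ) ≠ 0 := by exact_mod_cast hn
  have hG : ∑ N ∈ Ioc 0 n, (if N % 4 = 2 then 0 else (N.totient : ℝ) / N) =
      ∑ d ∈ Ioc 0 n, oddMoebiusDiv d * ∑ m ∈ Ioc 0 (n / d), modFourWeight m := by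
    rw [← ArithmeticFunction.sum_Ioc_mul_eq_sum_sum]
    exact Finset.sum_congr rfl fun N hN =>
      (oddMoebiusDiv_mul_modFourWeight (Finset.mem_Ioc.mp hN).1).symm
  have hsplit : ∑ d ∈ Ioc 0 n, oddMoebiusDiv d * ∑ m ∈ Ioc 0 (n / d), modFourWeight m -
      5 / Real.pi ^ 2 * n =
      ∑ d ∈ Ioc 0 n, oddMoebiusDiv d *
        (∑ m ∈ Ioc 0 (n / d), modFourWeight m - 5 / 8 * ((n : ℝ) / d)) +
      5 / 8 * n * (∑ d ∈ Ioc 0 n, oddMoebiusDiv d / d - 8 / Real.pi ^ 2) := by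
    simp only [mul_sub, Finset.sum_sub_distrib, Finset.mul_sum]
    have : ∀ d ∈ Ioc 0 n, 5 / 8 * (n : ℝ) * (oddMoebiusDiv d / d) =
        oddMoebiusDiv d * (5 / 8 * ((n : ℝ) / d)) := fun d _ => by ring
    rw [Finset.sum_congr rfl this]
    ring
  have hfirst : |∑ d ∈ Ioc 0 n, oddMoebiusDiv d *
      (∑ m ∈ Ioc 0 (n / d), modFourWeight m - 5 / 8 * ((n : ℝ) / d))| ≤ 1 + Real.log n := by
    refine (Finset.abs_sum_le_sum_abs _ _).trans (le_trans ?_ (harmonic_le_one_add_log n))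
    rw [harmonic_eq_sum_Icc]
    push_cast
    refine Finset.sum_le_sum fun d _ => ?_
    rw [abs_mul]
    refine (mul_le_mul (abs_oddMoebiusDiv_le d) (abs_sum_modFourWeight_div_sub_le n d)
      (abs_nonneg _) (by positivity)).trans_eq (mul_one _)
  have hsecond : |5 / 8 * n * (∑ d ∈ Ioc 0 n, oddMoebiusDiv d / d - 8 / Real.pi ^ 2)| ≤ 1 := by
    rw [abs_mul, abs_of_nonneg (by positivity : (0 : ℝ) ≤ 5 / 8 * n)]
    calc 5 / 8 * (n : ℝ) * _ ≤ 5 / 8 * n * (n : ℝ)⁻¹ := by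
          gcongr
          exact abs_sum_oddMoebiusDiv_div_sub_le hn
      _ ≤ 1 := by
          rw [mul_assoc, mul_inv_cancel₀ hn']
          norm_num
  rw [hG, hsplit]
  refine (abs_add_le _ _).trans ?_
  linarith

theorem totient_ratio_average (a b : ℝ) (ha : 0 < a) (hb : b ∈ Set.Ioc (0 : ℝ) 1) :
    Tendsto
      (fun X : ℝ => (1 / (a * X ^ b)) *
        ∑ N ∈ (Finset.range (Nat.floor (X + a * X ^ b) + 1)).filter
            (fun N : ℕ => 0 < N ∧ X ≤ (N : ℝ) ∧ (N : ℝ) ≤ X + a * X ^ b ∧ N % 4 ≠ 2),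
          (Nat.totient N : ℝ) / N)
      atTop (𝓝 (5 / Real.pi ^ 2)) := by
  obtain ⟨hb0, hb1⟩ := hb
  set κ : ℝ := 5 / Real.pi ^ 2 with hκ
  have hκ0 : 0 ≤ κ := by positivity
  have hlog : Tendsto (fun X : ℝ => (κ * 2 + 4 + 2 * Real.log (1 + a)) / a * X ^ (-b) +
      2 / a * (Real.log X / X ^ b)) atTop (𝓝 0) := by
    have h1 := (tendsto_rpow_neg_atTop hb0).const_mul ((κ * 2 + 4 + 2 * Real.log (1 + a)) / a)
    have h2 := (isLittleO_log_rpow_atTop hb0).tendsto_div_nhds_zero.const_mul (2 / a)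
    simpa using h1.add h2
  rw [tendsto_iff_norm_sub_tendsto_zero]
  refine squeeze_zero' (Eventually.of_forall fun _ => norm_nonneg _) ?_ hlog
  filter_upwards [eventually_ge_atTop (2 : ℝ)] with X hX
  have hX0 : 0 < X := by linarith
  have hXb : 0 < X ^ b := Real.rpow_pos_of_pos hX0 b
  set Y : ℝ := a * X ^ b with hY
  have hY0 : 0 < Y := mul_pos ha hXb
  have hYX : Y ≤ a * X := by
    have := Real.rpow_le_rpow_of_exponent_le (by linarith : (1 : ℝ) ≤ X) hb1
    rw [Real.rpow_one] at this
    exact mul_le_mul_of_nonneg_left this ha.le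
  obtain ⟨A, hA⟩ : ∃ A, ⌈X⌉₊ = A + 1 :=
    Nat.exists_eq_succ_of_ne_zero (Nat.ceil_pos.mpr hX0).ne'
  set B := ⌊X + Y⌋₊ with hB
  have hA1 : X ≤ A + 1 := by exact_mod_cast hA ▸ Nat.le_ceil X
  have hA2 : (A : ℝ) < X := by
    have := Nat.ceil_lt_add_one hX0.le
    rw [hA] at this
    push_cast at this
    linarith
  have hB1 : (B : ℝ) ≤ X + Y := Nat.floor_le (by positivity)
  have hB2 : X + Y < B + 1 := Nat.lt_floor_add_one _
  have hA0 : A ≠ 0 := by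
    rintro rfl
    norm_num at hA1
    linarith
  have hAB : A ≤ B := Nat.le_floor (by linarith)
  have hsum : ∑ N ∈ (Finset.range (B + 1)).filter
      (fun N : ℕ => 0 < N ∧ X ≤ (N : ℝ) ∧ (N : ℝ) ≤ X + Y ∧ N % 4 ≠ 2), (Nat.totient N : ℝ) / N =
      ∑ N ∈ Ioc A B, (if N % 4 = 2 then 0 else (N.totient : ℝ) / N) := by
    have : (Finset.range (B + 1)).filter
        (fun N : ℕ => 0 < N ∧ X ≤ (N : ℝ) ∧ (N : ℝ) ≤ X + Y ∧ N % 4 ≠ 2) =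
        (Ioc A B).filter (fun N => ¬ N % 4 = 2) := by
      ext N
      have h1 : X ≤ (N : ℝ) ↔ A < N := by rw [← Nat.ceil_le, hA, Nat.succ_le_iff]
      have h2 : (N : ℝ) ≤ X + Y ↔ N ≤ B := by rw [hB, Nat.le_floor_iff (by positivity)]
      simp only [Finset.mem_filter, Finset.mem_range, Finset.mem_Ioc, h1, h2]
      omega
    rw [this, Finset.sum_filter]
    refine Finset.sum_congr rfl fun N _ => ?_
    split_ifs <;> simp_all
  rw [hsum]
  have hcons := Finset.sum_Ioc_consecutive
    (fun N : ℕ => if N % 4 = 2 then 0 else (N.totient : ℝ) / N) (Nat.zero_le A) hAB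
  have hbdA := abs_le.mp (abs_sum_totient_div_sub_le hA0)
  have hbdB := abs_le.mp (abs_sum_totient_div_sub_le (n := B) (by omega))
  have hlogle : ∀ n : ℕ, n ≠ 0 → (n : ℝ) ≤ X + Y →
      Real.log n ≤ Real.log (1 + a) + Real.log X := fun n hn hle => by
    rw [← Real.log_mul (by positivity) (by positivity)]
    refine Real.log_le_log (by positivity) ?_
    linarith
  have hlA := hlogle A hA0 (by linarith)
  have hlB := hlogle B (by omega) hB1
  have hmain : |∑ N ∈ Ioc A B, (if N % 4 = 2 then 0 else (N.totient : ℝ) / N) - κ * Y| ≤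
      κ * 2 + 4 + 2 * Real.log (1 + a) + 2 * Real.log X := by
    have h1 : κ * (B - A) ≤ κ * (Y + 2) := mul_le_mul_of_nonneg_left (by linarith) hκ0
    have h2 : κ * (Y - 2) ≤ κ * (B - A) := mul_le_mul_of_nonneg_left (by linarith) hκ0
    rw [abs_le]
    constructor <;> linarith [hbdA.1, hbdA.2, hbdB.1, hbdB.2]
  have heq : ∀ s : ℝ, 1 / Y * s - κ = (s - κ * Y) / Y := fun s => by field_simp
  rw [heq, Real.norm_eq_abs, abs_div, abs_of_pos hY0]
  refine (div_le_div_of_nonneg_right hmain hY0.le).trans_eq ?_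
  rw [Real.rpow_neg hX0.le, hY]
  field_simp
end
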